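/- For every real number x ≥ exp(3157.442), one has x·∑_{k=0}^{4} k!/log^{k+1}x + m_a·x/log⁶x ≤ π(x) ≤ x·∑_{k=0}^{4} k!/log^{k+1}x + M_a·x/log⁶x, where m_a = −936.64603213534 and M_a = 1177.56019022252. -/

import Mathlib

/-- The prime counting function `π(x)`: the number of primes not exceeding `x`. -/
noncomputable def primePi (x : ℝ) : ℝ := (Nat.primeCounting ⌊x⌋₊ : ℝ)

section

open Filter Topology Metric

/-- An entire function with finite order of vanishing at `a` factors through `(z - a) ^ n`. -/
lemma exists_entire_factor_at {f : ℂ → ℂ} (hf : Differentiable ℂ f) (a : ℂ)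
    (ha : analyticOrderAt f a ≠ ⊤) :
    ∃ g : ℂ → ℂ, Differentiable ℂ g ∧ g a ≠ 0 ∧
      ∀ z, f z = (z - a) ^ analyticOrderNatAt f a * g z := by
  obtain ⟨h, hh, hha, hfh⟩ := (hf.analyticAt a).analyticOrderAt_ne_top.1 ha
  set n := analyticOrderNatAt f a
  refine ⟨Function.update (fun z => f z / (z - a) ^ n) a (h a), ?_, by simpa using hha, ?_⟩
  · intro z
    by_cases hz : z = a
    · subst hz
      refine hh.differentiableAt.congr_of_eventuallyEq ?_
      filter_upwards [hfh] with w hw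
      by_cases hwz : w = z
      · subst hwz; simp
      · have : (w - z) ^ n ≠ 0 := pow_ne_zero _ (sub_ne_zero.2 hwz)
        simp [Function.update_of_ne hwz, hw, this]
    · have hne : ∀ᶠ w in 𝓝 z, w ≠ a := isOpen_ne.mem_nhds hz
      have hd : DifferentiableAt ℂ (fun z => f z / (z - a) ^ n) z :=
        (hf z).div (by fun_prop) (pow_ne_zero _ (sub_ne_zero.2 hz))
      refine hd.congr_of_eventuallyEq ?_
      filter_upwards [hne] with w hw
      simp [Function.update_of_ne hw]
  · intro z
    by_cases hz : z = a
    · subst hz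
      have := hfh.self_of_nhds
      simpa using this
    · have : (z - a) ^ n ≠ 0 := pow_ne_zero _ (sub_ne_zero.2 hz)
      simp only [Function.update_of_ne hz]
      field_simp

lemma analyticOrderAt_ne_top_of_entire {f : ℂ → ℂ} (hf : Differentiable ℂ f) {w : ℂ}
    (hw : f w ≠ 0) (a : ℂ) : analyticOrderAt f a ≠ ⊤ := by
  have hfa : AnalyticOnNhd ℂ f Set.univ := fun z _ => hf.analyticAt z
  refine hfa.analyticOrderAt_ne_top_of_isPreconnected isPreconnected_univ (Set.mem_univ w)
    (Set.mem_univ a) ?_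
  rw [(hf.analyticAt w).analyticOrderAt_eq_zero.2 hw]
  simp

/-- Removing finitely many zeros of an entire function. -/
lemma exists_entire_factor {f : ℂ → ℂ} (hf : Differentiable ℂ f) {w : ℂ} (hw : f w ≠ 0)
    (S : Finset ℂ) :
    ∃ g : ℂ → ℂ, Differentiable ℂ g ∧ (∀ a ∈ S, g a ≠ 0) ∧
      ∀ z, f z = (∏ a ∈ S, (z - a) ^ analyticOrderNatAt f a) * g z := by
  induction S using Finset.induction_on with
  | empty => exact ⟨f, hf, by simp, by simp⟩
  | insert b S hb ih =>
    obtain ⟨g, hg, hgS, hfg⟩ := ih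
    have hgw : g w ≠ 0 := fun h => hw (by rw [hfg, h, mul_zero])
    have hgb := analyticOrderAt_ne_top_of_entire hg hgw b
    set P : ℂ → ℂ := fun z => ∏ a ∈ S, (z - a) ^ analyticOrderNatAt f a with hP
    have hPd : Differentiable ℂ P := by
      simp only [hP]; fun_prop
    have hPb : P b ≠ 0 := Finset.prod_ne_zero_iff.2 fun a ha =>
      pow_ne_zero _ (sub_ne_zero.2 fun h => hb (h ▸ ha))
    have hord : analyticOrderNatAt f b = analyticOrderNatAt g b := by
      have hfe : f = P * g := funext hfg
      have hP0 : analyticOrderAt P b = 0 := (hPd.analyticAt b).analyticOrderAt_eq_zero.2 hPb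
      rw [hfe, analyticOrderNatAt, analyticOrderAt_mul (hPd.analyticAt b) (hg.analyticAt b),
        hP0, zero_add, analyticOrderNatAt]
    obtain ⟨k, hk, hkb, hgk⟩ := exists_entire_factor_at hg b hgb
    refine ⟨k, hk, ?_, ?_⟩
    · intro a ha
      rcases Finset.mem_insert.1 ha with rfl | ha
      · exact hkb
      · intro h0
        exact hgS a ha (by rw [hgk, h0, mul_zero])
    · intro z
      rw [Finset.prod_insert hb, hfg, hgk z, hord]
      ring

/-- Variation of the logarithmic derivative of a zero-free bounded function. -/
lemma norm_logDeriv_sub_le {g : ℂ → ℂ} (hg : Differentiable ℂ g) {R M : ℝ} (hR : 0 < R)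
    (hM : 0 < M) (h0 : g 0 = 1) (hne : ∀ z, ‖z‖ < R → g z ≠ 0)
    (hb : ∀ z, ‖z‖ < R → ‖g z‖ ≤ Real.exp M) {s : ℂ} (hs : ‖s‖ < R / 8) :
    ‖logDeriv g s - logDeriv g 0‖ ≤ 64 * M * ‖s‖ / R ^ 2 := by
  have hgd : Differentiable ℂ (deriv g) := fun z =>
    ((hg.analyticAt z).deriv).differentiableAt
  have hud : DifferentiableOn ℂ (logDeriv g) (ball 0 R) := by
    intro z hz
    exact ((hgd z).div (hg z) (hne z (by simpa using hz))).differentiableWithinAt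
  obtain ⟨h₁, hh₁⟩ := hud.isExactOn_ball
  set h : ℂ → ℂ := fun z => h₁ z - h₁ 0 with hh
  have hhd : ∀ z ∈ ball (0 : ℂ) R, HasDerivAt h (logDeriv g z) z := fun z hz =>
    (hh₁ z hz).sub_const _
  have hh0 : h 0 = 0 := by simp [hh]
  have hexp : ∀ z ∈ ball (0 : ℂ) R, g z = Complex.exp (h z) := by
    intro z hz
    have hd : ∀ w ∈ ball (0 : ℂ) R, HasDerivAt (fun w => g w * Complex.exp (-h w)) 0 w := by
      intro w hw
      have h1 := ((hg w).hasDerivAt).mul ((hhd w hw).neg.cexp)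
      have hgw : g w ≠ 0 := hne w (by simpa using hw)
      refine h1.congr_deriv ?_
      rw [logDeriv_apply]
      field_simp
      ring
    have hconst := (convex_ball (0 : ℂ) R).is_const_of_fderivWithin_eq_zero (𝕜 := ℂ)
      (f := fun w => g w * Complex.exp (-h w))
      (fun w hw => (hd w hw).differentiableAt.differentiableWithinAt)
      (fun w hw => by
        rw [fderivWithin_of_isOpen isOpen_ball hw]
        have := (hd w hw).hasFDerivAt.fderiv
        rw [this]; ext; simp) hz (mem_ball_self hR)
    simp only [hh0, h0, neg_zero, Complex.exp_zero, mul_one] at hconst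
    rw [Complex.exp_neg] at hconst
    field_simp at hconst
    exact hconst
  have hre : Set.MapsTo h (ball 0 R) {z | z.re ≤ M} := by
    intro z hz
    have h1 := hb z (by simpa using hz)
    rw [hexp z hz, Complex.norm_exp] at h1
    exact Real.exp_le_exp.1 h1
  have hhdo : DifferentiableOn ℂ h (ball 0 R) := fun z hz =>
    (hhd z hz).differentiableAt.differentiableWithinAt
  have hbd : ∀ z, ‖z‖ ≤ R / 2 → ‖h z‖ ≤ 2 * M := by
    intro z hz
    have h1 := Complex.borelCaratheodory_zero hM hhdo hre hR (z := z)
      (by simp; linarith) hh0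
    refine h1.trans ?_
    rw [div_le_iff₀ (by linarith)]
    nlinarith
  have hder : ∀ z, ‖z‖ ≤ R / 4 → ‖logDeriv g z‖ ≤ 8 * M / R := by
    intro z hz
    rw [← (hhd z (by simp; linarith)).deriv]
    have := Complex.norm_deriv_le_of_forall_mem_sphere_norm_le (c := z) (R := R / 4) (C := 2 * M)
      (f := h) (by linarith) ?_ ?_
    · refine this.trans (le_of_eq ?_); field_simp; ring
    · refine (hhdo.mono ?_).diffContOnCl_ball (U := ball 0 R) ?_
      · exact subset_rfl
      · intro w hw
        have : ‖w - z‖ ≤ R / 4 := by simpa [dist_eq_norm] using hw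
        have h2 : ‖w‖ ≤ ‖w - z‖ + ‖z‖ := by simpa using norm_add_le (w - z) z
        simp; linarith
    · intro w hw
      have : ‖w - z‖ = R / 4 := by simpa [dist_eq_norm] using hw
      have h2 : ‖w‖ ≤ ‖w - z‖ + ‖z‖ := by simpa using norm_add_le (w - z) z
      exact hbd w (by linarith)
  have hder2 : ∀ z, ‖z‖ < R / 8 → ‖deriv (logDeriv g) z‖ ≤ 64 * M / R ^ 2 := by
    intro z hz
    have := Complex.norm_deriv_le_of_forall_mem_sphere_norm_le (c := z) (R := R / 8)
      (C := 8 * M / R) (f := logDeriv g) (by linarith) ?_ ?_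
    · refine this.trans (le_of_eq ?_); field_simp; norm_num
    · refine hud.diffContOnCl_ball ?_
      intro w hw
      have : ‖w - z‖ ≤ R / 8 := by simpa [dist_eq_norm] using hw
      have h2 : ‖w‖ ≤ ‖w - z‖ + ‖z‖ := by simpa using norm_add_le (w - z) z
      simp; linarith
    · intro w hw
      have : ‖w - z‖ = R / 8 := by simpa [dist_eq_norm] using hw
      have h2 : ‖w‖ ≤ ‖w - z‖ + ‖z‖ := by simpa using norm_add_le (w - z) z
      exact hder w (by linarith)
  have hmv := (convex_ball (0 : ℂ) (R / 8)).norm_image_sub_le_of_norm_deriv_le (𝕜 := ℂ)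
    (f := logDeriv g) (C := 64 * M / R ^ 2) (x := 0) (y := s)
    (fun w hw => (hud w (ball_subset_ball (by linarith) hw)).differentiableAt
      (isOpen_ball.mem_nhds (ball_subset_ball (by linarith) hw)))
    (fun w hw => hder2 w (by simpa using hw)) (mem_ball_self (by linarith)) (by simpa using hs)
  refine hmv.trans (le_of_eq ?_)
  simp; ring

end

section

open Filter Topology Metric

lemma finite_zeros_closedBall {f : ℂ → ℂ} (hf : Differentiable ℂ f) {w : ℂ} (hw : f w ≠ 0)
    (R : ℝ) : {z : ℂ | f z = 0 ∧ ‖z‖ ≤ R}.Finite := by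
  have hfa : AnalyticOnNhd ℂ f Set.univ := fun z _ => hf.analyticAt z
  have h1 := hfa.preimage_zero_mem_codiscrete (x := w) hw
  by_contra hinf
  have hinf : {z : ℂ | f z = 0 ∧ ‖z‖ ≤ R}.Infinite := hinf
  obtain ⟨a, -, ha⟩ := hinf.exists_accPt_of_subset_isCompact (isCompact_closedBall (0 : ℂ) R)
    (fun z hz => by simpa using hz.2)
  have h2 : ∃ᶠ z in 𝓝[≠] a, f z = 0 := by
    have := accPt_iff_frequently_nhdsNE.1 ha
    exact this.mono fun z hz => hz.1
  have := hfa.eqOn_zero_of_preconnected_of_frequently_eq_zero isPreconnected_univ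
    (Set.mem_univ a) h2
  exact hw (this (Set.mem_univ w))

/-- Removing finitely many zeros of modulus at most `R` from an entire function normalised at the
origin. -/
lemma exists_quotient_bound {f : ℂ → ℂ} (hf : Differentiable ℂ f) (h0 : f 0 = 1) {R M : ℝ}
    (hR : 0 < R) (hM : ∀ z, ‖z‖ ≤ 4 * R → ‖f z‖ ≤ Real.exp M) (S : Finset ℂ)
    (hS : ∀ a ∈ S, f a = 0 ∧ ‖a‖ ≤ R) :
    ∃ g : ℂ → ℂ, Differentiable ℂ g ∧ (∀ a ∈ S, g a ≠ 0) ∧ g 0 = 1 ∧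
      (∀ z, f z = (∏ a ∈ S, (1 - z / a) ^ analyticOrderNatAt f a) * g z) ∧
      ∀ z, ‖z‖ ≤ 4 * R → ‖g z‖ * 3 ^ (∑ a ∈ S, analyticOrderNatAt f a) ≤ Real.exp M := by
  have hS0 : ∀ a ∈ S, a ≠ 0 := fun a ha h => by
    have := (hS a ha).1; rw [h, h0] at this; exact one_ne_zero this
  obtain ⟨g, hg, hgS, hfg⟩ := exists_entire_factor hf (w := 0) (by simp [h0]) S
  set n := fun a => analyticOrderNatAt f a
  set c : ℂ := ∏ a ∈ S, (-a) ^ n a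
  have hc : c ≠ 0 := Finset.prod_ne_zero_iff.2 fun a ha => pow_ne_zero _ (neg_ne_zero.2 (hS0 a ha))
  have hprod : ∀ z, f z = (∏ a ∈ S, (1 - z / a) ^ n a) * (c * g z) := by
    intro z
    rw [hfg z, ← mul_assoc]
    congr 1
    rw [← Finset.prod_mul_distrib]
    refine Finset.prod_congr rfl fun a ha => ?_
    rw [← mul_pow]
    congr 1
    have := hS0 a ha
    field_simp
    ring
  have hG0 : c * g 0 = 1 := by
    have := hprod 0
    simpa [h0] using this.symm
  refine ⟨fun z => c * g z, by fun_prop, fun a ha => mul_ne_zero hc (hgS a ha), hG0, hprod, ?_⟩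
  have hP : ∀ z, ‖z‖ = 4 * R →
      (3 : ℝ) ^ (∑ a ∈ S, n a) ≤ ‖∏ a ∈ S, (1 - z / a) ^ n a‖ := by
    intro z hz
    rw [norm_prod, ← Finset.prod_pow_eq_pow_sum]
    refine Finset.prod_le_prod (fun _ _ => by positivity) fun a ha => ?_
    rw [norm_pow]
    refine pow_le_pow_left₀ (by norm_num) ?_ _
    have h1 : 4 ≤ ‖z / a‖ := by
      rw [norm_div, hz, le_div_iff₀ (norm_pos_iff.2 (hS0 a ha))]
      linarith [(hS a ha).2]
    have h2 : ‖z / a‖ - ‖(1 : ℂ)‖ ≤ ‖z / a - 1‖ := norm_sub_norm_le _ _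
    rw [norm_sub_rev] at h2
    rw [norm_one] at h2
    linarith
  have hbdry : ∀ z ∈ frontier (ball (0 : ℂ) (4 * R)),
      ‖c * g z‖ ≤ Real.exp M / 3 ^ (∑ a ∈ S, n a) := by
    intro z hz
    rw [frontier_ball (0 : ℂ) (by positivity)] at hz
    have hz' : ‖z‖ = 4 * R := by simpa using hz
    rw [le_div_iff₀ (by positivity)]
    calc ‖c * g z‖ * 3 ^ (∑ a ∈ S, n a)
        ≤ ‖c * g z‖ * ‖∏ a ∈ S, (1 - z / a) ^ n a‖ := by gcongr; exact hP z hz'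
      _ = ‖f z‖ := by rw [hprod z, norm_mul, norm_mul, mul_comm]; simp
      _ ≤ _ := hM z hz'.le
  intro z hz
  have hd : Differentiable ℂ (fun z => c * g z) := by fun_prop
  have := Complex.norm_le_of_forall_mem_frontier_norm_le (isBounded_ball (x := (0 : ℂ)) (r := 4 * R))
    (f := fun z => c * g z) hd.diffContOnCl hbdry (z := z)
    (by rw [closure_ball (0 : ℂ) (by positivity)]; simpa using hz)
  rwa [le_div_iff₀ (by positivity)] at this

/-- Zero counting bound. -/
lemma sum_order_mul_log_three_le {f : ℂ → ℂ} (hf : Differentiable ℂ f) (h0 : f 0 = 1) {R M : ℝ}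
    (hR : 0 < R) (hM : ∀ z, ‖z‖ ≤ 4 * R → ‖f z‖ ≤ Real.exp M) (S : Finset ℂ)
    (hS : ∀ a ∈ S, f a = 0 ∧ ‖a‖ ≤ R) :
    (∑ a ∈ S, (analyticOrderNatAt f a : ℝ)) ≤ M := by
  obtain ⟨g, -, -, hg0, -, hb⟩ := exists_quotient_bound hf h0 hR hM S hS
  have h1 := hb 0 (by simp; positivity)
  rw [hg0] at h1
  simp only [norm_one, one_mul] at h1
  have h2 : Real.exp (∑ a ∈ S, (analyticOrderNatAt f a : ℝ)) ≤ Real.exp M := by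
    refine le_trans ?_ h1
    rw [← Nat.cast_sum, ← mul_one ((_ : ℕ) : ℝ), Real.exp_nat_mul]
    exact pow_le_pow_left₀ (Real.exp_pos _).le (by linarith [Real.exp_one_lt_d9]) _
  exact Real.exp_le_exp.1 h2

/-- The convergence exponent bound for an entire function of order at most `3 / 2`. -/
lemma summable_order_div_norm_sq {f : ℂ → ℂ} (hf : Differentiable ℂ f) (h0 : f 0 = 1) {C : ℝ}
    (hC : 0 < C) (hb : ∀ z, ‖f z‖ ≤ Real.exp (C * ((1 + ‖z‖) * √(1 + ‖z‖)))) :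
    Summable fun a : ℂ => (analyticOrderNatAt f a : ℝ) / ‖a‖ ^ 2 := by
  obtain ⟨r, hr, hr0⟩ : ∃ r > 0, ∀ a, f a = 0 → r ≤ ‖a‖ := by
    have : ∀ᶠ z in 𝓝 (0 : ℂ), f z ≠ 0 := hf.continuous.continuousAt.eventually_ne (by simp [h0])
    obtain ⟨r, hr, h⟩ := Metric.eventually_nhds_iff.1 this
    refine ⟨r, hr, fun a ha => ?_⟩
    by_contra hlt
    exact h (by simpa using hlt) ha
  set D : ℝ := max 4 (1 / r ^ 2)
  have hD4 : 4 ≤ D := le_max_left _ _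
  set q : ℝ := √2 / 2
  have hs2 : √2 ^ 2 = 2 := Real.sq_sqrt (by norm_num)
  have hq1 : q < 1 := by
    have : √2 < 2 := by nlinarith [Real.sqrt_nonneg 2]
    simp only [q]; linarith
  have hq0 : 0 ≤ q := by positivity
  have hcount : ∀ (S : Finset ℂ) (k : ℕ), (∀ a ∈ S, f a = 0) →
      (1 / 4 : ℝ) ^ k * ∑ a ∈ S with ‖a‖ ≤ 2 ^ k, (analyticOrderNatAt f a : ℝ)
        ≤ C * (5 * √5) * q ^ k := by
    intro S k hS
    have h1 := sum_order_mul_log_three_le hf h0 (R := 2 ^ k) (M := C * (5 * √5) * (2 * √2) ^ k)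
      (by positivity) (fun z hz => (hb z).trans ?_) (S.filter fun a => ‖a‖ ≤ 2 ^ k) (fun a ha => by
        simp only [Finset.mem_filter] at ha; exact ⟨hS a ha.1, ha.2⟩)
    · calc _ ≤ (1 / 4 : ℝ) ^ k * (C * (5 * √5) * (2 * √2) ^ k) := by gcongr
        _ = C * (5 * √5) * ((1 / 4) * (2 * √2)) ^ k := by rw [mul_pow (1 / 4 : ℝ)]; ring
        _ = _ := by congr 2; simp only [q]; ring
    · rw [Real.exp_le_exp]
      have h5 : 1 + ‖z‖ ≤ 5 * 2 ^ k := by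
        have : (1 : ℝ) ≤ 2 ^ k := one_le_pow₀ (by norm_num)
        linarith
      have h6 : √(1 + ‖z‖) ≤ √5 * √2 ^ k := by
        have : √5 * √2 ^ k = √(5 * 2 ^ k) := by
          rw [Real.sqrt_mul (by norm_num)]
          congr 1
          rw [eq_comm, Real.sqrt_eq_iff_mul_self_eq (by positivity) (by positivity), ← pow_two,
            ← pow_mul, mul_comm k 2, pow_mul, hs2]
        rw [this]
        exact Real.sqrt_le_sqrt h5
      calc C * ((1 + ‖z‖) * √(1 + ‖z‖)) ≤ C * ((5 * 2 ^ k) * (√5 * √2 ^ k)) := by gcongr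
        _ = _ := by rw [mul_pow]; ring
  have hterm : ∀ a : ℂ, f a = 0 → ∀ K : ℕ, ‖a‖ ≤ 2 ^ K →
      1 / ‖a‖ ^ 2 ≤ D * ∑ k ∈ Finset.range (K + 1), if ‖a‖ ≤ 2 ^ k then (1 / 4 : ℝ) ^ k else 0 := by
    intro a ha K hK
    have hpos : 0 < ‖a‖ := hr.trans_le (hr0 a ha)
    have hex : ∃ k : ℕ, ‖a‖ ≤ 2 ^ k := ⟨K, hK⟩
    set k := Nat.find hex
    have hk : ‖a‖ ≤ 2 ^ k := Nat.find_spec hex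
    have hkK : k ≤ K := Nat.find_min' hex hK
    have h1 : (1 / 4 : ℝ) ^ k ≤ ∑ k ∈ Finset.range (K + 1),
        if ‖a‖ ≤ 2 ^ k then (1 / 4 : ℝ) ^ k else 0 := by
      have := Finset.single_le_sum (f := fun k : ℕ => if ‖a‖ ≤ 2 ^ k then (1 / 4 : ℝ) ^ k else 0)
        (s := Finset.range (K + 1)) (fun i _ => by positivity)
        (Finset.mem_range.2 (Nat.lt_succ_of_le hkK))
      simpa [hk] using this
    refine le_trans ?_ (mul_le_mul_of_nonneg_left h1 (by positivity))
    rcases Nat.eq_zero_or_pos k with h0k | hkp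
    · rw [h0k, pow_zero, mul_one]
      refine le_trans ?_ (le_max_right _ _)
      exact one_div_le_one_div_of_le (by positivity) (pow_le_pow_left₀ hr.le (hr0 a ha) 2)
    · have hlt : ¬ ‖a‖ ≤ 2 ^ (k - 1) := Nat.find_min hex (by omega)
      push Not at hlt
      have h2 : (2 : ℝ) ^ k = 2 * 2 ^ (k - 1) := by rw [← pow_succ']; congr 1; omega
      have h3 : (2 : ℝ) ^ k < 2 * ‖a‖ := by rw [h2]; linarith
      have h4 : (4 : ℝ) ^ k = 2 ^ k * 2 ^ k := by rw [← mul_pow]; norm_num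
      have h5 : (4 : ℝ) ^ k ≤ 4 * ‖a‖ ^ 2 := by
        rw [h4]; nlinarith [pow_pos (show (0 : ℝ) < 2 by norm_num) k]
      rw [one_div_pow, mul_one_div, div_le_div_iff₀ (by positivity) (by positivity)]
      nlinarith [sq_nonneg ‖a‖]
  refine summable_of_sum_le (c := D * (C * (5 * √5) * (1 - q)⁻¹)) (fun a => by positivity) ?_
  intro S
  have hz : ∑ a ∈ S, (analyticOrderNatAt f a : ℝ) / ‖a‖ ^ 2 =
      ∑ a ∈ S with f a = 0, (analyticOrderNatAt f a : ℝ) / ‖a‖ ^ 2 := by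
    rw [Finset.sum_filter]
    refine Finset.sum_congr rfl fun a _ => ?_
    split_ifs with h
    · rfl
    · have : analyticOrderNatAt f a = 0 := by
        by_contra h'
        exact h (apply_eq_zero_of_analyticOrderNatAt_ne_zero h')
      simp [this]
  rw [hz]
  set Z := S.filter fun a => f a = 0
  obtain ⟨K, hK⟩ : ∃ K : ℕ, ∀ a ∈ Z, ‖a‖ ≤ 2 ^ K := by
    obtain ⟨K, hK⟩ := pow_unbounded_of_one_lt (∑ a ∈ Z, ‖a‖) (show (1 : ℝ) < 2 by norm_num)
    exact ⟨K, fun a ha => (Finset.single_le_sum (f := fun a : ℂ => ‖a‖)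
      (fun _ _ => norm_nonneg _) ha).trans hK.le⟩
  have hZ0 : ∀ a ∈ Z, f a = 0 := fun a ha => (Finset.mem_filter.1 ha).2
  calc ∑ a ∈ Z, (analyticOrderNatAt f a : ℝ) / ‖a‖ ^ 2
      ≤ ∑ a ∈ Z, (analyticOrderNatAt f a : ℝ) * (D * ∑ k ∈ Finset.range (K + 1),
          if ‖a‖ ≤ 2 ^ k then (1 / 4 : ℝ) ^ k else 0) := by
        refine Finset.sum_le_sum fun a ha => ?_
        rw [div_eq_mul_one_div]
        exact mul_le_mul_of_nonneg_left (hterm a (hZ0 a ha) K (hK a ha)) (by positivity)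
    _ = D * ∑ k ∈ Finset.range (K + 1), (1 / 4 : ℝ) ^ k *
          ∑ a ∈ Z with ‖a‖ ≤ 2 ^ k, (analyticOrderNatAt f a : ℝ) := by
        simp_rw [Finset.sum_filter, Finset.mul_sum]
        rw [Finset.sum_comm]
        refine Finset.sum_congr rfl fun k _ => Finset.sum_congr rfl fun a _ => ?_
        split_ifs <;> ring
    _ ≤ D * ∑ k ∈ Finset.range (K + 1), C * (5 * √5) * q ^ k := by
        exact mul_le_mul_of_nonneg_left (Finset.sum_le_sum fun k _ => hcount Z k hZ0)
          (by positivity)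
    _ ≤ D * (C * (5 * √5) * (1 - q)⁻¹) := by
        rw [← Finset.mul_sum]
        gcongr
        rw [← tsum_geometric_of_lt_one hq0 hq1]
        exact (summable_geometric_of_lt_one hq0 hq1).sum_le_tsum _ fun _ _ => by positivity

end

section

open Filter Topology Metric

lemma order_eq_zero_of_ne {f : ℂ → ℂ} {a : ℂ} (h : f a ≠ 0) : analyticOrderNatAt f a = 0 := by
  by_contra h'
  exact h (apply_eq_zero_of_analyticOrderNatAt_ne_zero h')

lemma norm_inv_sub_add_inv_le {s a : ℂ} (ha : a ≠ 0) (h : 2 * ‖s‖ ≤ ‖a‖) :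
    ‖1 / (s - a) + 1 / a‖ ≤ 2 * ‖s‖ / ‖a‖ ^ 2 := by
  have hpos : 0 < ‖a‖ := norm_pos_iff.2 ha
  have h1 : ‖a‖ / 2 ≤ ‖s - a‖ := by
    have := norm_sub_norm_le a s
    rw [norm_sub_rev] at this
    linarith
  have hne : s - a ≠ 0 := norm_pos_iff.1 (by linarith)
  have : 1 / (s - a) + 1 / a = s / ((s - a) * a) := by field_simp; ring
  rw [this, norm_div, norm_mul, div_le_div_iff₀ (by positivity) (by positivity)]
  nlinarith [mul_le_mul_of_nonneg_left h1 (mul_nonneg (norm_nonneg s) hpos.le)]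

/-- Summability of the partial fraction expansion attached to the zeros. -/
lemma summable_order_mul_inv_sub_add_inv {f : ℂ → ℂ} (hf : Differentiable ℂ f) (h0 : f 0 = 1)
    (hsum : Summable fun a : ℂ => (analyticOrderNatAt f a : ℝ) / ‖a‖ ^ 2) (s : ℂ) :
    Summable fun a : ℂ => (analyticOrderNatAt f a : ℂ) * (1 / (s - a) + 1 / a) := by
  refine Summable.of_norm_bounded_eventually (hsum.mul_left (2 * ‖s‖)) ?_
  have hfin := finite_zeros_closedBall hf (w := 0) (by simp [h0]) (2 * ‖s‖)
  filter_upwards [hfin.compl_mem_cofinite] with a ha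
  by_cases hfa : f a = 0
  · have h1 : 2 * ‖s‖ ≤ ‖a‖ := by
      by_contra hlt
      exact ha ⟨hfa, (not_le.1 hlt).le⟩
    have ha0 : a ≠ 0 := fun h => by rw [h, h0] at hfa; exact one_ne_zero hfa
    rw [norm_mul, Complex.norm_natCast]
    calc _ ≤ (analyticOrderNatAt f a : ℝ) * (2 * ‖s‖ / ‖a‖ ^ 2) := by
          gcongr; exact norm_inv_sub_add_inv_le ha0 h1
      _ = _ := by ring
  · simp [order_eq_zero_of_ne hfa]

/-- The partial fraction expansion of the logarithmic derivative of an entire function of order at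
most `3 / 2`. -/
lemma logDeriv_eq_tsum_zeros {f : ℂ → ℂ} (hf : Differentiable ℂ f) (h0 : f 0 = 1) {C : ℝ}
    (hC : 0 < C) (hb : ∀ z, ‖f z‖ ≤ Real.exp (C * ((1 + ‖z‖) * √(1 + ‖z‖)))) {s : ℂ}
    (hs : f s ≠ 0) :
    logDeriv f s = logDeriv f 0 +
      ∑' a : ℂ, (analyticOrderNatAt f a : ℂ) * (1 / (s - a) + 1 / a) := by
  set t : ℂ → ℂ := fun a => (analyticOrderNatAt f a : ℂ) * (1 / (s - a) + 1 / a) with ht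
  have hts : Summable t :=
    summable_order_mul_inv_sub_add_inv hf h0 (summable_order_div_norm_sq hf h0 hC hb) s
  have hfin : ∀ k : ℕ, {z : ℂ | f z = 0 ∧ ‖z‖ ≤ k}.Finite := fun k =>
    finite_zeros_closedBall hf (w := 0) (by simp [h0]) k
  set Z : ℕ → Finset ℂ := fun k => (hfin k).toFinset with hZ
  have hZmem : ∀ k a, a ∈ Z k ↔ f a = 0 ∧ ‖a‖ ≤ k := fun k a => by simp [hZ]
  have hlim : Tendsto (fun k => ∑ a ∈ Z k, t a) atTop (𝓝 (∑' a, t a)) := by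
    have h1 : ∀ k, ∑ a ∈ Z k, t a = ∑' a, if a ∈ Z k then t a else 0 := by
      intro k
      rw [tsum_eq_sum (s := Z k) (fun a ha => by simp [ha])]
      exact Finset.sum_congr rfl fun a ha => by simp [ha]
    simp_rw [h1]
    refine tendsto_tsum_of_dominated_convergence (bound := fun a => ‖t a‖) hts.norm ?_ ?_
    · intro a
      by_cases hfa : f a = 0
      · obtain ⟨K, hK⟩ := exists_nat_ge ‖a‖
        refine tendsto_const_nhds.congr' ?_
        filter_upwards [eventually_ge_atTop K] with k hk
        rw [if_pos ((hZmem k a).2 ⟨hfa, hK.trans (by exact_mod_cast hk)⟩)]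
      · have : t a = 0 := by simp [ht, order_eq_zero_of_ne hfa]
        simp [this]
    · filter_upwards with k a
      split_ifs <;> simp
  have hbound : ∀ᶠ k : ℕ in atTop, ‖logDeriv f s - logDeriv f 0 - ∑ a ∈ Z k, t a‖ ≤
      64 * C * (5 * √5) * ‖s‖ * (√k)⁻¹ := by
    obtain ⟨K, hK⟩ := exists_nat_gt (8 * ‖s‖)
    filter_upwards [eventually_ge_atTop (max K 1)] with k hk
    have hk1 : (1 : ℝ) ≤ k := by exact_mod_cast (le_max_right K 1).trans hk
    have hkK : 8 * ‖s‖ < k := hK.trans_le (by exact_mod_cast (le_max_left K 1).trans hk)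
    set M : ℝ := C * ((1 + 4 * k) * √(1 + 4 * k)) with hM
    have hMpos : 0 < M := by positivity
    obtain ⟨g, hg, hgZ, hg0, hfg, hgb⟩ := exists_quotient_bound hf h0 (R := k) (M := M)
      (by positivity) (fun z hz => (hb z).trans (by
        rw [Real.exp_le_exp, hM]; gcongr)) (Z k) (fun a ha => (hZmem k a).1 ha)
    have hgne : ∀ z, ‖z‖ < k → g z ≠ 0 := by
      intro z hz h
      have : f z = 0 := by rw [hfg, h, mul_zero]
      exact hgZ z ((hZmem k z).2 ⟨this, hz.le⟩) h
    have hgM : ∀ z, ‖z‖ < k → ‖g z‖ ≤ Real.exp M := by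
      intro z hz
      refine le_trans ?_ (hgb z (by linarith))
      exact le_mul_of_one_le_right (norm_nonneg _) (one_le_pow₀ (by norm_num))
    have hvar := norm_logDeriv_sub_le hg (R := k) (M := M) (by positivity) hMpos hg0 hgne hgM
      (s := s) (by linarith)
    have hld : ∀ w, f w ≠ 0 → logDeriv f w =
        ∑ a ∈ Z k, (analyticOrderNatAt f a : ℂ) * (1 / (w - a)) + logDeriv g w := by
      intro w hw
      have hfw : f = fun z => (∏ a ∈ Z k, (1 - z / a) ^ analyticOrderNatAt f a) * g z := funext hfg
      have hw' := hw
      rw [hfg w] at hw'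
      have hP := left_ne_zero_of_mul hw'
      have hgw := right_ne_zero_of_mul hw'
      have hfac := Finset.prod_ne_zero_iff.1 hP
      conv_lhs => rw [hfw]
      rw [logDeriv_mul w hP hgw (by fun_prop) (hg w)]
      congr 1
      rw [logDeriv_prod (f := fun a z => (1 - z / a) ^ analyticOrderNatAt f a) hfac
        (fun a _ => by fun_prop)]
      refine Finset.sum_congr rfl fun a ha => ?_
      have ha0 : a ≠ 0 := fun h => by
        have := ((hZmem k a).1 ha).1; rw [h, h0] at this; exact one_ne_zero this
      have hwa : w - a ≠ 0 := by
        intro h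
        have : w = a := sub_eq_zero.1 h
        exact hw (this ▸ ((hZmem k a).1 ha).1)
      have hd : HasDerivAt (fun z : ℂ => 1 - z / a) (-(1 / a)) w := by
        simpa using ((hasDerivAt_id w).div_const a).const_sub 1
      rw [logDeriv_fun_pow hd.differentiableAt, logDeriv_apply, hd.deriv]
      congr 1
      have h2 : 1 - w / a ≠ 0 := by
        have : 1 - w / a = -(w - a) / a := by field_simp; ring
        rw [this]; exact div_ne_zero (neg_ne_zero.2 hwa) ha0
      have h3 : a - w ≠ 0 := by rw [← neg_sub]; exact neg_ne_zero.2 hwa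
      field_simp
      ring
    have heq : logDeriv f s - logDeriv f 0 - ∑ a ∈ Z k, t a = logDeriv g s - logDeriv g 0 := by
      rw [hld s hs, hld 0 (by simp [h0])]
      simp only [ht, mul_add, Finset.sum_add_distrib]
      have : ∀ a : ℂ, 1 / (0 - a) = -(1 / a) := fun a => by rw [zero_sub, one_div, one_div, inv_neg]
      simp only [this, mul_neg, Finset.sum_neg_distrib]
      ring
    rw [heq]
    refine hvar.trans ?_
    have hMle : M ≤ C * ((5 * k) * (√5 * √k)) := by
      rw [hM, ← Real.sqrt_mul (by norm_num)]
      gcongr <;> linarith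
    have hsq : √(k : ℝ) * √k = k := Real.mul_self_sqrt (by positivity)
    have hsp : 0 < √(k : ℝ) := by positivity
    calc 64 * M * ‖s‖ / (k : ℝ) ^ 2 ≤ 64 * (C * ((5 * k) * (√5 * √k))) * ‖s‖ / (k : ℝ) ^ 2 := by
          gcongr
      _ = 64 * C * (5 * √5) * ‖s‖ * (√k)⁻¹ := by
          nth_rewrite 1 3 [← hsq]
          field_simp
  have hz : Tendsto (fun k : ℕ => 64 * C * (5 * √5) * ‖s‖ * (√(k : ℝ))⁻¹) atTop (𝓝 0) := by
    have h1 : Tendsto (fun k : ℕ => (√(k : ℝ))⁻¹) atTop (𝓝 0) :=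
      tendsto_inv_atTop_zero.comp (Real.tendsto_sqrt_atTop.comp tendsto_natCast_atTop_atTop)
    simpa using h1.const_mul (64 * C * (5 * √5) * ‖s‖)
  have hzero := squeeze_zero_norm' hbound hz
  have h2 := tendsto_nhds_unique hzero (tendsto_const_nhds.sub hlim)
  linear_combination -h2

end

section

open Filter Topology Metric

/-- The entire function `s (s - 1) Λ(s)`, normalised to take the value `1` at the origin. -/
noncomputable def riemannXi (s : ℂ) : ℂ := s * (s - 1) * completedRiemannZeta₀ s + 1

lemma differentiable_riemannXi : Differentiable ℂ riemannXi := by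
  have := differentiable_completedZeta₀
  unfold riemannXi
  fun_prop

lemma riemannXi_zero : riemannXi 0 = 1 := by simp [riemannXi]

lemma riemannXi_one_sub (s : ℂ) : riemannXi (1 - s) = riemannXi s := by
  simp only [riemannXi, completedRiemannZeta₀_one_sub]
  ring

lemma riemannXi_eq_completed {s : ℂ} (h0 : s ≠ 0) (h1 : s ≠ 1) :
    riemannXi s = s * (s - 1) * completedRiemannZeta s := by
  have h2 : 1 - s ≠ 0 := sub_ne_zero.2 h1.symm
  rw [riemannXi, completedRiemannZeta_eq]
  field_simp
  ring

lemma riemannXi_eq {s : ℂ} (hs : 0 < s.re) (h1 : s ≠ 1) :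
    riemannXi s = 2 * (s - 1) * (Real.pi : ℂ) ^ (-s / 2) * Complex.Gamma (s / 2 + 1) *
      riemannZeta s := by
  have h0 : s ≠ 0 := by rintro rfl; simp at hs
  rw [riemannXi_eq_completed h0 h1, riemannZeta_def_of_ne_zero h0,
    Complex.Gamma_add_one _ (div_ne_zero h0 two_ne_zero)]
  have hG := Complex.Gammaℝ_ne_zero_of_re_pos hs
  have hd := Complex.Gammaℝ_def s
  rw [mul_div_assoc', eq_div_iff hG, hd]
  ring

lemma riemannXi_conj (s : ℂ) :
    riemannXi (starRingEnd ℂ s) = starRingEnd ℂ (riemannXi s) := by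
  have key : ∀ s : ℂ, 0 < s.re → riemannXi (starRingEnd ℂ s) = starRingEnd ℂ (riemannXi s) := by
    intro s hs
    by_cases h1 : s = 1
    · subst h1
      simp [riemannXi]
    · have h1' : starRingEnd ℂ s ≠ 1 := fun h => h1 (by
        have := congrArg (starRingEnd ℂ) h; simpa using this)
      rw [riemannXi_eq (by simpa using hs) h1', riemannXi_eq hs h1, riemannZeta_conj]
      have h2 : starRingEnd ℂ s / 2 + 1 = starRingEnd ℂ (s / 2 + 1) := by simp [map_ofNat]
      have h3 : (Real.pi : ℂ) ^ (-starRingEnd ℂ s / 2) =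
          starRingEnd ℂ ((Real.pi : ℂ) ^ (-s / 2)) := by
        have : -starRingEnd ℂ s / 2 = starRingEnd ℂ (-s / 2) := by simp [map_ofNat]
        rw [this, Complex.cpow_conj _ _ (by
          rw [Complex.arg_ofReal_of_nonneg Real.pi_pos.le]; exact Real.pi_ne_zero.symm),
          Complex.conj_ofReal]
      rw [h2, Complex.Gamma_conj, h3]
      simp [map_ofNat]
  by_cases hs : 0 < s.re
  · exact key s hs
  · have h := key (1 - s) (by simp; linarith)
    rw [riemannXi_one_sub] at h
    rw [← h, map_sub, map_one, riemannXi_one_sub]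

lemma riemannXi_ne_zero_of_one_le_re {s : ℂ} (hs : 1 ≤ s.re) : riemannXi s ≠ 0 := by
  by_cases h1 : s = 1
  · simp [h1, riemannXi]
  · rw [riemannXi_eq (by linarith) h1]
    have hp : (Real.pi : ℂ) ^ (-s / 2) ≠ 0 := by
      simp [Complex.cpow_eq_zero_iff, Real.pi_ne_zero]
    have hG : Complex.Gamma (s / 2 + 1) ≠ 0 := Complex.Gamma_ne_zero_of_re_pos (by
      simp; linarith)
    exact mul_ne_zero (mul_ne_zero (mul_ne_zero (mul_ne_zero two_ne_zero (sub_ne_zero.2 h1)) hp) hG)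
      (riemannZeta_ne_zero_of_one_le_re hs)

lemma re_mem_Ioo_of_riemannXi_eq_zero {s : ℂ} (hs : riemannXi s = 0) : 0 < s.re ∧ s.re < 1 := by
  constructor
  · by_contra h
    rw [← riemannXi_one_sub] at hs
    exact riemannXi_ne_zero_of_one_le_re (s := 1 - s) (by simp; linarith) hs
  · by_contra h
    exact riemannXi_ne_zero_of_one_le_re (not_lt.1 h) hs

lemma norm_Gamma_le_Gamma_re {s : ℂ} (hs : 0 < s.re) :
    ‖Complex.Gamma s‖ ≤ Real.Gamma s.re := by
  rw [Complex.Gamma_eq_integral hs, Real.Gamma_eq_integral hs, Complex.GammaIntegral]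
  refine (MeasureTheory.norm_integral_le_integral_norm _).trans (le_of_eq ?_)
  refine MeasureTheory.setIntegral_congr_fun measurableSet_Ioi fun x hx => ?_
  have hx : 0 < x := hx
  simp only [norm_mul]
  rw [Complex.norm_cpow_eq_rpow_re_of_pos hx, Complex.norm_real, Real.norm_of_nonneg
    (Real.exp_pos _).le]
  simp

lemma exists_completedRiemannZeta₀_strip_bound :
    ∃ K : ℝ, 0 < K ∧ ∀ s : ℂ, 1 / 2 ≤ s.re → s.re ≤ 2 → ‖completedRiemannZeta₀ s‖ ≤ K := by
  set P := HurwitzZeta.hurwitzEvenFEPair 0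
  have hconv : ∀ s, MellinConvergent P.f_modif s := fun s =>
    (P.isStrongFEPair_toStrongFEPair.hasMellin s).1
  set F : ℝ → ℝ := fun t => ‖(t : ℂ) ^ ((1 / 4 : ℂ) - 1) • P.f_modif t‖ +
    ‖(t : ℂ) ^ ((1 : ℂ) - 1) • P.f_modif t‖
  have hF : MeasureTheory.IntegrableOn F (Set.Ioi 0) := (hconv (1 / 4)).norm.add (hconv 1).norm
  refine ⟨1 + ∫ t in Set.Ioi 0, F t, ?_, ?_⟩
  · have : 0 ≤ ∫ t in Set.Ioi 0, F t := MeasureTheory.integral_nonneg fun t => by positivity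
    linarith
  intro s h1 h2
  have hle : ‖mellin P.f_modif (s / 2)‖ ≤ ∫ t in Set.Ioi 0, F t := by
    refine (MeasureTheory.norm_integral_le_integral_norm _).trans ?_
    refine MeasureTheory.setIntegral_mono_on (hconv _).norm hF measurableSet_Ioi fun t ht => ?_
    have ht : 0 < t := ht
    simp only [F, norm_smul, Complex.norm_cpow_eq_rpow_re_of_pos ht]
    rw [← add_mul]
    refine mul_le_mul_of_nonneg_right ?_ (norm_nonneg _)
    have e1 : (s / 2 - 1).re = s.re / 2 - 1 := by simp
    have e2 : ((1 / 4 : ℂ) - 1).re = -3 / 4 := by norm_num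
    have e3 : ((1 : ℂ) - 1).re = 0 := by simp
    rw [e1, e2, e3, Real.rpow_zero]
    rcases le_total t 1 with h | h
    · have := Real.rpow_le_rpow_of_exponent_ge ht h (show (-3 / 4 : ℝ) ≤ s.re / 2 - 1 by linarith)
      linarith
    · have := Real.rpow_le_one_of_one_le_of_nonpos h (show s.re / 2 - 1 ≤ 0 by linarith)
      have := Real.rpow_nonneg ht.le (-3 / 4 : ℝ)
      linarith
  have heq : completedRiemannZeta₀ s = mellin P.f_modif (s / 2) / 2 := rfl
  rw [heq, norm_div]
  have : ‖(2 : ℂ)‖ = 2 := by simp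
  rw [this]
  have := norm_nonneg (mellin P.f_modif (s / 2))
  linarith

lemma Gamma_le_exp {x : ℝ} (hx : 2 ≤ x) :
    Real.Gamma x ≤ Real.exp (2 * (x * √x)) := by
  set n := ⌊x⌋₊ with hn
  have hn2 : 2 ≤ n := Nat.le_floor (by exact_mod_cast hx)
  have hnx : (n : ℝ) ≤ x := Nat.floor_le (by linarith)
  have hxn : x < n + 1 := Nat.lt_floor_add_one x
  have h1 : Real.Gamma x ≤ Real.Gamma (n + 1) :=
    Real.Gamma_strictMonoOn_Ici.monotoneOn (by simpa using hx)
      (by simp; have : (2 : ℝ) ≤ n := by exact_mod_cast hn2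
          linarith) hxn.le
  rw [Real.Gamma_nat_eq_factorial] at h1
  have h2 : ((n.factorial : ℕ) : ℝ) ≤ (n : ℝ) ^ n := by exact_mod_cast Nat.factorial_le_pow n
  have hx0 : 0 < x := by linarith
  have h3 : (n : ℝ) ^ n ≤ x ^ n := pow_le_pow_left₀ (by positivity) hnx n
  have h4 : x ^ n = Real.exp (n * Real.log x) := by
    rw [Real.exp_nat_mul, Real.exp_log hx0]
  have h5 : Real.log x ≤ 2 * √x := by
    have e : Real.log x = 2 * Real.log (√x) := by rw [Real.log_sqrt hx0.le]; ring
    have := Real.log_le_sub_one_of_pos (Real.sqrt_pos.2 hx0)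
    linarith
  refine (h1.trans (h2.trans (h3.trans_eq h4))).trans ?_
  rw [Real.exp_le_exp]
  calc (n : ℝ) * Real.log x ≤ x * (2 * √x) := by
        gcongr
        exact Real.log_nonneg (by linarith)
    _ = _ := by ring

lemma exists_riemannZeta_bound :
    ∃ K : ℝ, 0 < K ∧ ∀ s : ℂ, 2 ≤ s.re → ‖riemannZeta s‖ ≤ K := by
  have hs2 : Summable fun n : ℕ => 1 / ((n : ℝ) + 1) ^ 2 := by
    have := (summable_nat_add_iff 1).2 (Real.summable_one_div_nat_pow.2 (show 1 < 2 by norm_num))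
    simpa using this
  refine ⟨1 + ∑' n : ℕ, 1 / ((n : ℝ) + 1) ^ 2, by positivity, fun s hs => ?_⟩
  rw [zeta_eq_tsum_one_div_nat_add_one_cpow (by linarith)]
  have hle : ∀ n : ℕ, ‖1 / ((n : ℂ) + 1) ^ s‖ ≤ 1 / ((n : ℝ) + 1) ^ 2 := by
    intro n
    have hpos : (0 : ℝ) < (n : ℝ) + 1 := by positivity
    have : ((n : ℂ) + 1) = (((n : ℝ) + 1 : ℝ) : ℂ) := by push_cast; ring
    rw [norm_div, norm_one, this, Complex.norm_cpow_eq_rpow_re_of_pos hpos]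
    gcongr
    rw [← Real.rpow_natCast]
    exact Real.rpow_le_rpow_of_exponent_le (by linarith [(Nat.cast_nonneg n : (0:ℝ) ≤ n)])
      (by exact_mod_cast hs)
  have := tsum_of_norm_bounded hs2.hasSum hle
  linarith

lemma exists_riemannXi_growth : ∃ C : ℝ, 0 < C ∧
    ∀ z, ‖riemannXi z‖ ≤ Real.exp (C * ((1 + ‖z‖) * √(1 + ‖z‖))) := by
  obtain ⟨K, hK, hKb⟩ := exists_completedRiemannZeta₀_strip_bound
  obtain ⟨Z, hZ, hZb⟩ := exists_riemannZeta_bound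
  have half : ∃ C : ℝ, 0 < C ∧ ∀ z : ℂ, 1 / 2 ≤ z.re →
      ‖riemannXi z‖ ≤ Real.exp (C * ((1 + ‖z‖) * √(1 + ‖z‖))) := by
    refine ⟨2 + K + Z + 8, by positivity, fun z hz => ?_⟩
    set r := 1 + ‖z‖ with hr
    have hr1 : 1 ≤ r := by simp [hr]
    have hsr : 1 ≤ √r := Real.one_le_sqrt.2 hr1
    have hrr : r ≤ r * √r := le_mul_of_one_le_right (by linarith) hsr
    have hz1 : ‖z - 1‖ ≤ r := by
      have := norm_sub_le z 1; simp at this; linarith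
    have hzr : ‖z‖ ≤ r := by linarith
    have hexpK : 1 + K ≤ Real.exp K := by linarith [Real.add_one_le_exp K]
    have hre : z.re ≤ ‖z‖ := Complex.re_le_norm z
    rcases le_total z.re 2 with h2 | h2
    · have h3 : ‖riemannXi z‖ ≤ r * r * (1 + K) := by
        have : ‖riemannXi z‖ ≤ ‖z‖ * ‖z - 1‖ * ‖completedRiemannZeta₀ z‖ + 1 := by
          unfold riemannXi
          refine (norm_add_le _ _).trans ?_
          simp
        have h4 : ‖z‖ * ‖z - 1‖ * ‖completedRiemannZeta₀ z‖ ≤ r * r * K := by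
          gcongr; exact hKb z hz h2
        nlinarith
      have hre' : r ≤ Real.exp r := by linarith [Real.add_one_le_exp r]
      calc ‖riemannXi z‖ ≤ Real.exp r * Real.exp r * Real.exp K := by
            refine h3.trans ?_; gcongr
        _ = Real.exp (r + r + K) := by rw [Real.exp_add (r + r), Real.exp_add r r]
        _ ≤ _ := by
          rw [Real.exp_le_exp]
          nlinarith
    · have hne : z ≠ 1 := by rintro rfl; norm_num at h2
      rw [riemannXi_eq (by linarith) hne]
      have hpi : ‖(Real.pi : ℂ) ^ (-z / 2)‖ ≤ 1 := by
        rw [Complex.norm_cpow_eq_rpow_re_of_pos Real.pi_pos]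
        refine Real.rpow_le_one_of_one_le_of_nonpos (by linarith [Real.pi_gt_three]) ?_
        simp; linarith
      have hG : ‖Complex.Gamma (z / 2 + 1)‖ ≤ Real.exp (4 * (r * √r)) := by
        refine (norm_Gamma_le_Gamma_re (by simp; linarith)).trans ?_
        have e : (z / 2 + 1).re = z.re / 2 + 1 := by simp
        rw [e]
        have hx : z.re / 2 + 1 ≤ r := by linarith
        refine (Gamma_le_exp (by linarith)).trans ?_
        rw [Real.exp_le_exp]
        have : (z.re / 2 + 1) * √(z.re / 2 + 1) ≤ r * √r := by gcongr
        nlinarith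
      have hexpZ : Z ≤ Real.exp Z := by linarith [Real.add_one_le_exp Z]
      have h2r : 2 * r ≤ Real.exp (2 * r) := by linarith [Real.add_one_le_exp (2 * r)]
      rw [norm_mul, norm_mul, norm_mul, norm_mul]
      have : ‖(2 : ℂ)‖ = 2 := by simp
      rw [this]
      calc 2 * ‖z - 1‖ * ‖(Real.pi : ℂ) ^ (-z / 2)‖ * ‖Complex.Gamma (z / 2 + 1)‖ *
            ‖riemannZeta z‖ ≤ 2 * r * 1 * Real.exp (4 * (r * √r)) * Z := by
            gcongr; exact hZb z h2
        _ ≤ Real.exp (2 * r) * 1 * Real.exp (4 * (r * √r)) * Real.exp Z := by gcongr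
        _ = Real.exp (2 * r + 4 * (r * √r) + Z) := by rw [mul_one, ← Real.exp_add, ← Real.exp_add]
        _ ≤ _ := by
          rw [Real.exp_le_exp]
          nlinarith
  obtain ⟨C, hC, hb⟩ := half
  refine ⟨4 * C, by positivity, fun z => ?_⟩
  have hmono : ∀ w : ℂ, ‖w‖ ≤ 1 + ‖z‖ → C * ((1 + ‖w‖) * √(1 + ‖w‖)) ≤
      4 * C * ((1 + ‖z‖) * √(1 + ‖z‖)) := by
    intro w hw
    have h1 : 1 + ‖w‖ ≤ 2 * (1 + ‖z‖) := by linarith [norm_nonneg z]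
    have h2 : √(1 + ‖w‖) ≤ 2 * √(1 + ‖z‖) := by
      rw [Real.sqrt_le_left (by positivity), mul_pow, Real.sq_sqrt (by positivity)]
      linarith [norm_nonneg z]
    calc C * ((1 + ‖w‖) * √(1 + ‖w‖)) ≤ C * ((2 * (1 + ‖z‖)) * (2 * √(1 + ‖z‖))) := by gcongr
      _ = _ := by ring
  rcases le_total (1 / 2) z.re with h | h
  · exact (hb z h).trans (Real.exp_le_exp.2 (hmono z (by linarith)))
  · rw [← riemannXi_one_sub]
    refine (hb (1 - z) (by simp; linarith)).trans (Real.exp_le_exp.2 (hmono _ ?_))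
    simpa using norm_sub_le 1 z

end

section

open Filter Topology Metric ComplexConjugate

/-- The multiplicity of a zero of `riemannXi`. -/
noncomputable def xiOrder (ρ : ℂ) : ℕ := analyticOrderNatAt riemannXi ρ

lemma xiOrder_eq_zero {ρ : ℂ} (h : riemannXi ρ ≠ 0) : xiOrder ρ = 0 := order_eq_zero_of_ne h

lemma riemannXi_eq_zero_of_xiOrder {ρ : ℂ} (h : xiOrder ρ ≠ 0) : riemannXi ρ = 0 := by
  by_contra h'
  exact h (xiOrder_eq_zero h')

lemma xiOrder_re_mem {ρ : ℂ} (h : xiOrder ρ ≠ 0) : 0 < ρ.re ∧ ρ.re < 1 :=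
  re_mem_Ioo_of_riemannXi_eq_zero (riemannXi_eq_zero_of_xiOrder h)

lemma riemannXi_order_ne_top (ρ : ℂ) : analyticOrderAt riemannXi ρ ≠ ⊤ :=
  analyticOrderAt_ne_top_of_entire differentiable_riemannXi (w := 0) (by simp [riemannXi_zero]) ρ

lemma xiOrder_eq_of_factor {ρ : ℂ} {n : ℕ} {g : ℂ → ℂ} (hg : Differentiable ℂ g) (h0 : g ρ ≠ 0)
    (h : ∀ z, riemannXi z = (z - ρ) ^ n * g z) : xiOrder ρ = n := by
  refine ((differentiable_riemannXi.analyticAt ρ).analyticOrderNatAt_eq_iff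
    (riemannXi_order_ne_top ρ)).2 ⟨g, hg.analyticAt ρ, h0, ?_⟩
  exact Eventually.of_forall fun z => by simpa using h z

lemma xiOrder_conj (ρ : ℂ) : xiOrder (conj ρ) = xiOrder ρ := by
  obtain ⟨g, hg, hg0, hfg⟩ := exists_entire_factor_at differentiable_riemannXi ρ
    (riemannXi_order_ne_top ρ)
  refine xiOrder_eq_of_factor (g := conj ∘ g ∘ conj)
    (fun z => by simpa using (hg (conj z)).conj_conj) ?_ fun z => ?_
  · simpa using hg0
  · have := congrArg conj (hfg (conj z))
    rw [riemannXi_conj] at this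
    simpa [xiOrder] using this

lemma xiOrder_one_sub (ρ : ℂ) : xiOrder (1 - ρ) = xiOrder ρ := by
  obtain ⟨g, hg, hg0, hfg⟩ := exists_entire_factor_at differentiable_riemannXi ρ
    (riemannXi_order_ne_top ρ)
  refine xiOrder_eq_of_factor (g := fun z => (-1) ^ xiOrder ρ * g (1 - z)) (by fun_prop) ?_
    fun z => ?_
  · simpa using hg0
  · rw [← riemannXi_one_sub, hfg (1 - z), ← mul_assoc, ← mul_pow]
    simp only [xiOrder]
    congr 2
    ring

lemma summable_xiOrder_div_norm_sq : Summable fun ρ : ℂ => (xiOrder ρ : ℝ) / ‖ρ‖ ^ 2 := by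
  obtain ⟨C, hC, hb⟩ := exists_riemannXi_growth
  exact summable_order_div_norm_sq differentiable_riemannXi riemannXi_zero hC hb

lemma summable_xiOrder_mul_inv (s : ℂ) :
    Summable fun ρ : ℂ => (xiOrder ρ : ℂ) * (1 / (s - ρ) + 1 / ρ) :=
  summable_order_mul_inv_sub_add_inv differentiable_riemannXi riemannXi_zero
    summable_xiOrder_div_norm_sq s

lemma logDeriv_riemannXi {s : ℂ} (hs : riemannXi s ≠ 0) :
    logDeriv riemannXi s = logDeriv riemannXi 0 +
      ∑' ρ : ℂ, (xiOrder ρ : ℂ) * (1 / (s - ρ) + 1 / ρ) := by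
  obtain ⟨C, hC, hb⟩ := exists_riemannXi_growth
  exact logDeriv_eq_tsum_zeros differentiable_riemannXi riemannXi_zero hC hb hs

lemma logDeriv_riemannXi_one_sub (s : ℂ) :
    logDeriv riemannXi (1 - s) = -logDeriv riemannXi s := by
  have h : riemannXi = fun z => riemannXi (1 - z) := funext fun z => (riemannXi_one_sub z).symm
  have h1 : deriv riemannXi s = -deriv riemannXi (1 - s) := by
    conv_lhs => rw [h]
    exact deriv_comp_const_sub (f := riemannXi) 1 s
  rw [logDeriv_apply, logDeriv_apply, riemannXi_one_sub, h1]
  ring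

lemma re_one_div (z : ℂ) : (1 / z).re = z.re / ‖z‖ ^ 2 := by
  rw [one_div, Complex.inv_re, Complex.normSq_eq_norm_sq]

lemma summable_xiOrder_re_inv : Summable fun ρ : ℂ => (xiOrder ρ : ℝ) * (1 / ρ).re := by
  refine Summable.of_nonneg_of_le (fun ρ => ?_) (fun ρ => ?_) summable_xiOrder_div_norm_sq
  · by_cases h : xiOrder ρ = 0
    · simp [h]
    · rw [re_one_div]
      have := (xiOrder_re_mem h).1
      positivity
  · by_cases h : xiOrder ρ = 0
    · simp [h]
    · rw [re_one_div, mul_div_assoc']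
      have := (xiOrder_re_mem h).2
      gcongr
      exact mul_le_of_le_one_right (by positivity) this.le

lemma tsum_xiOrder_one_sub (F : ℂ → ℝ) :
    ∑' ρ : ℂ, (xiOrder ρ : ℝ) * F (1 - ρ) = ∑' ρ : ℂ, (xiOrder ρ : ℝ) * F ρ := by
  rw [← (Equiv.subLeft (1 : ℂ)).tsum_eq (fun ρ => (xiOrder ρ : ℝ) * F ρ)]
  simp [xiOrder_one_sub]

lemma tsum_xiOrder_conj (F : ℂ → ℝ) :
    ∑' ρ : ℂ, (xiOrder ρ : ℝ) * F (conj ρ) = ∑' ρ : ℂ, (xiOrder ρ : ℝ) * F ρ := by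
  rw [← (starRingAut (R := ℂ)).toEquiv.tsum_eq (fun ρ => (xiOrder ρ : ℝ) * F ρ)]
  simp only [RingEquiv.toEquiv_eq_coe, EquivLike.coe_coe, starRingAut_apply]
  refine tsum_congr fun ρ => ?_
  have := xiOrder_conj ρ
  simp only [starRingEnd_apply] at this ⊢
  rw [this]

lemma summable_xiOrder_one_sub {F : ℂ → ℝ} (h : Summable fun ρ => (xiOrder ρ : ℝ) * F ρ) :
    Summable fun ρ : ℂ => (xiOrder ρ : ℝ) * F (1 - ρ) := by
  have := (Equiv.subLeft (1 : ℂ)).summable_iff.2 h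
  refine this.congr fun ρ => ?_
  simp [xiOrder_one_sub]

lemma summable_xiOrder_conj {F : ℂ → ℝ} (h : Summable fun ρ => (xiOrder ρ : ℝ) * F ρ) :
    Summable fun ρ : ℂ => (xiOrder ρ : ℝ) * F (conj ρ) := by
  have := (starRingAut (R := ℂ)).toEquiv.summable_iff.2 h
  refine this.congr fun ρ => ?_
  simp [starRingAut_apply, ← starRingEnd_apply, xiOrder_conj]

lemma re_logDeriv_riemannXi_zero :
    (logDeriv riemannXi 0).re = -∑' ρ : ℂ, (xiOrder ρ : ℝ) * (1 / ρ).re := by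
  have h1 := logDeriv_riemannXi (s := 1) (riemannXi_ne_zero_of_one_le_re (by simp))
  have h2 := logDeriv_riemannXi_one_sub 0
  rw [sub_zero] at h2
  rw [h2] at h1
  have h3 := congrArg Complex.re h1
  rw [Complex.add_re, Complex.re_tsum (summable_xiOrder_mul_inv 1)] at h3
  have h4 : ∀ ρ : ℂ, ((xiOrder ρ : ℂ) * (1 / (1 - ρ) + 1 / ρ)).re =
      (xiOrder ρ : ℝ) * (1 / (1 - ρ)).re + (xiOrder ρ : ℝ) * (1 / ρ).re := by
    intro ρ
    rw [← Complex.ofReal_natCast, Complex.re_ofReal_mul, Complex.add_re, mul_add]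
  simp_rw [h4] at h3
  have hs := summable_xiOrder_re_inv
  rw [Summable.tsum_add (summable_xiOrder_one_sub (F := fun ρ => (1 / ρ).re) hs) hs,
    tsum_xiOrder_one_sub (fun ρ => (1 / ρ).re)] at h3
  rw [Complex.neg_re] at h3
  linarith

lemma hasSum_re_logDeriv_riemannXi {s : ℂ} (hs : riemannXi s ≠ 0) :
    HasSum (fun ρ : ℂ => (xiOrder ρ : ℝ) * (1 / (s - ρ)).re) (logDeriv riemannXi s).re := by
  have h1 := (Complex.hasSum_re (summable_xiOrder_mul_inv s).hasSum).sub
    summable_xiOrder_re_inv.hasSum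
  rw [logDeriv_riemannXi hs, Complex.add_re, re_logDeriv_riemannXi_zero]
  have e1 : (fun ρ : ℂ => (xiOrder ρ : ℝ) * (1 / (s - ρ)).re) = fun ρ : ℂ =>
      ((xiOrder ρ : ℂ) * (1 / (s - ρ) + 1 / ρ)).re - (xiOrder ρ : ℝ) * (1 / ρ).re := by
    funext ρ
    rw [← Complex.ofReal_natCast, Complex.re_ofReal_mul, Complex.add_re]
    ring
  rw [e1, neg_add_eq_sub]
  exact h1

end

section

open Filter Topology Metric ComplexConjugate

open Complex (digamma)

lemma digamma_ofReal {x : ℝ} (hx : 0 < x) :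
    digamma (x : ℂ) = ((deriv (Real.log ∘ Real.Gamma) x : ℝ) : ℂ) := by
  have hd : DifferentiableAt ℝ Real.Gamma x :=
    Real.differentiableAt_Gamma fun m => by have : (0 : ℝ) ≤ m := m.cast_nonneg; linarith
  have hdc : DifferentiableAt ℂ Complex.Gamma x :=
    Complex.differentiableAt_Gamma _ fun m h => by
      have := congrArg Complex.re h
      simp at this
      have h2 : (0 : ℝ) ≤ m := m.cast_nonneg
      linarith
  have h1 : HasDerivAt (fun y : ℝ => Complex.Gamma y) (deriv Complex.Gamma x) x :=
    hdc.hasDerivAt.comp_ofReal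
  have h2 : HasDerivAt (fun y : ℝ => (Real.Gamma y : ℂ)) (deriv Real.Gamma x : ℝ) x :=
    hd.hasDerivAt.ofReal_comp
  have h3 : (fun y : ℝ => (Real.Gamma y : ℂ)) = fun y : ℝ => Complex.Gamma y := by
    funext y; rw [Complex.Gamma_ofReal]
  rw [h3] at h2
  have h4 := h1.unique h2
  have h5 : deriv (Real.log ∘ Real.Gamma) x = deriv Real.Gamma x / Real.Gamma x :=
    (hd.hasDerivAt.log (Real.Gamma_pos_of_pos hx).ne').deriv
  rw [Complex.digamma_def, logDeriv_apply, h4, h5, Complex.Gamma_ofReal]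
  push_cast
  rfl

lemma digamma_re_bounds {x : ℝ} (hx : 0 < x) :
    Real.log x ≤ (digamma ((x + 1 : ℝ) : ℂ)).re ∧
      (digamma (x : ℂ)).re ≤ Real.log x := by
  have hc := Real.convexOn_log_Gamma
  have hder {x : ℝ} (hx : 0 < x) : DifferentiableAt ℝ (Real.log ∘ Real.Gamma) x := by
    refine ((Real.differentiableAt_Gamma ?_).log (Real.Gamma_ne_zero ?_)) <;>
    exact fun m ↦ ne_of_gt (by have : (0 : ℝ) ≤ m := m.cast_nonneg; linarith)
  have hrec : (Real.log ∘ Real.Gamma) (x + 1) = (Real.log ∘ Real.Gamma) x + Real.log x := by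
    simp only [Function.comp_apply, Real.Gamma_add_one hx.ne',
      Real.log_mul hx.ne' (Real.Gamma_pos_of_pos hx).ne', add_comm]
  have hslope : slope (Real.log ∘ Real.Gamma) x (x + 1) = Real.log x := by
    rw [slope_def_field, hrec]; simp
  have hx1 : 0 < x + 1 := by linarith
  rw [digamma_ofReal hx, digamma_ofReal hx1, Complex.ofReal_re, Complex.ofReal_re]
  constructor
  · have := hc.slope_le_deriv (Set.mem_Ioi.2 hx) (Set.mem_Ioi.2 hx1) (by linarith) (hder hx1)
    rwa [hslope] at this
  · have := hc.deriv_le_slope (Set.mem_Ioi.2 hx) (Set.mem_Ioi.2 hx1) (by linarith) (hder hx)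
    rwa [hslope] at this

lemma ne_neg_nat_of_re_pos {z : ℂ} (hz : 0 < z.re) (m : ℕ) : z ≠ -m := fun h => by
  have := congrArg Complex.re h
  simp at this
  have h2 : (0 : ℝ) ≤ m := m.cast_nonneg
  linarith

lemma digamma_add_nat {z : ℂ} (hz : 0 < z.re) (n : ℕ) :
    digamma (z + n) = digamma z + ∑ k ∈ Finset.range n, 1 / (z + k) := by
  induction n with
  | zero => simp
  | succ n ih =>
    have h : 0 < (z + n).re := by
      have : (0 : ℝ) ≤ n := n.cast_nonneg
      simp; linarith
    rw [Finset.sum_range_succ, ← add_assoc, ← ih, Nat.cast_add_one, ← add_assoc,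
      Complex.digamma_apply_add_one _ (ne_neg_nat_of_re_pos h), one_div]

lemma norm_digamma_term_le {z : ℂ} {R : ℝ} (hR : 1 ≤ R) (hz : 1 / R < z.re) (hz' : ‖z‖ < R)
    (k : ℕ) : ‖(1 : ℂ) / (k + 1) - 1 / (z + k)‖ ≤ (R + 1) * R * (1 / ((k + 1 : ℕ) : ℝ) ^ 2) := by
  have hk : (0 : ℝ) ≤ k := k.cast_nonneg
  have hR0 : 0 < R := by linarith
  have h0 : 0 < z.re := lt_trans (by positivity) hz
  have hlow : ((k : ℝ) + 1) / R ≤ ‖z + k‖ := by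
    refine le_trans ?_ (Complex.re_le_norm _)
    rw [Complex.add_re, Complex.natCast_re, add_div]
    have : (k : ℝ) / R ≤ k := div_le_self hk hR
    linarith
  have hk1 : (k : ℂ) + 1 ≠ 0 := by exact_mod_cast Nat.succ_ne_zero k
  have hzk : z + k ≠ 0 := by
    rw [← norm_pos_iff]
    exact lt_of_lt_of_le (by positivity) hlow
  have e : (1 : ℂ) / (k + 1) - 1 / (z + k) = (z - 1) / ((k + 1) * (z + k)) := by
    field_simp
    ring
  have hn1 : ‖(k : ℂ) + 1‖ = (k : ℝ) + 1 := by
    exact_mod_cast Complex.norm_natCast (k + 1)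
  rw [e, norm_div, norm_mul, hn1]
  have h2 : ‖z - 1‖ ≤ R + 1 := (norm_sub_le _ _).trans (by simp; linarith)
  calc ‖z - 1‖ / (((k : ℝ) + 1) * ‖z + k‖) ≤ (R + 1) / (((k : ℝ) + 1) * (((k : ℝ) + 1) / R)) := by
        gcongr
    _ = _ := by push_cast; field_simp

lemma summable_digamma_bound (c : ℝ) :
    Summable fun k : ℕ => c * (1 / ((k + 1 : ℕ) : ℝ) ^ 2) :=
  ((summable_nat_add_iff 1).2 (Real.summable_one_div_nat_pow.2 (by norm_num))).mul_left c

lemma exists_digamma_region {z : ℂ} (hz : 0 < z.re) :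
    ∃ R : ℝ, 1 ≤ R ∧ 1 / R < z.re ∧ ‖z‖ < R := by
  refine ⟨max (max 1 (2 / z.re)) (‖z‖ + 1), ?_, ?_, ?_⟩
  · exact (le_max_left _ _).trans (le_max_left _ _)
  · have h : 2 / z.re ≤ max (max 1 (2 / z.re)) (‖z‖ + 1) :=
      (le_max_right _ _).trans (le_max_left _ _)
    have h0 : 0 < 2 / z.re := by positivity
    calc 1 / max (max 1 (2 / z.re)) (‖z‖ + 1) ≤ 1 / (2 / z.re) := by gcongr
      _ < z.re := by rw [one_div_div]; linarith
  · exact lt_of_lt_of_le (by linarith) (le_max_right _ _)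

lemma summable_digamma {z : ℂ} (hz : 0 < z.re) :
    Summable fun k : ℕ => (1 : ℂ) / (k + 1) - 1 / (z + k) := by
  obtain ⟨R, h1, h2, h3⟩ := exists_digamma_region hz
  exact Summable.of_norm_bounded (summable_digamma_bound _) (norm_digamma_term_le h1 h2 h3)

lemma differentiableOn_digamma_tsum :
    DifferentiableOn ℂ (fun z : ℂ => ∑' k : ℕ, ((1 : ℂ) / (k + 1) - 1 / (z + k)))
      {z | 0 < z.re} := by
  intro z hz
  obtain ⟨R, h1, h2, h3⟩ := exists_digamma_region hz
  have hopen : IsOpen {z : ℂ | 1 / R < z.re ∧ ‖z‖ < R} :=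
    (isOpen_lt continuous_const Complex.continuous_re).inter
      (isOpen_lt continuous_norm continuous_const)
  have hpos : ∀ w ∈ {z : ℂ | 1 / R < z.re ∧ ‖z‖ < R}, 0 < w.re := fun w hw =>
    lt_trans (by positivity) hw.1
  have := Complex.differentiableOn_tsum_of_summable_norm
    (F := fun (k : ℕ) (z : ℂ) => (1 : ℂ) / (k + 1) - 1 / (z + k))
    (summable_digamma_bound ((R + 1) * R)) (U := {z : ℂ | 1 / R < z.re ∧ ‖z‖ < R})
    (fun k w hw => ?_) hopen (fun k w hw => norm_digamma_term_le h1 hw.1 hw.2 k)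
  · exact (this.differentiableAt (hopen.mem_nhds ⟨h2, h3⟩)).differentiableWithinAt
  · have : w + k ≠ 0 := fun h => ne_neg_nat_of_re_pos (hpos w hw) k (eq_neg_of_add_eq_zero_left h)
    fun_prop (disch := assumption)

lemma differentiableOn_digamma : DifferentiableOn ℂ digamma {z | 0 < z.re} := by
  intro z hz
  have h1 : AnalyticAt ℂ Complex.Gamma z := by
    refine DifferentiableOn.analyticAt (s := {z | 0 < z.re}) (fun w hw => ?_)
      ((isOpen_lt continuous_const Complex.continuous_re).mem_nhds hz)
    exact (Complex.differentiableAt_Gamma _ (ne_neg_nat_of_re_pos hw)).differentiableWithinAt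
  exact (h1.deriv.div h1 (Complex.Gamma_ne_zero_of_re_pos hz)).differentiableAt.differentiableWithinAt

lemma tendsto_log_add_sub_log (a b : ℝ) :
    Tendsto (fun n : ℕ => Real.log (n + a) - Real.log (n + b)) atTop (𝓝 0) := by
  have h := fun c : ℝ => (Real.tendsto_log_comp_add_sub_log c).comp tendsto_natCast_atTop_atTop
  simpa using (h a).sub (h b)

lemma tendsto_digamma_ofReal_sub {x : ℝ} (hx : 0 < x) :
    Tendsto (fun n : ℕ => (digamma ((x : ℂ) + n)).re - Real.log n) atTop (𝓝 0) := by
  have h1 := tendsto_log_add_sub_log (x - 1) 0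
  have h2 := tendsto_log_add_sub_log x 0
  refine tendsto_of_tendsto_of_tendsto_of_le_of_le' h1 h2 ?_ ?_ <;>
  · filter_upwards [eventually_ge_atTop 1] with n hn
    have hn' : (1 : ℝ) ≤ n := by exact_mod_cast hn
    have h3 := (digamma_re_bounds (x := n + (x - 1)) (by linarith)).1
    have h4 := (digamma_re_bounds (x := n + x) (by linarith)).2
    have e1 : (((n + (x - 1) + 1 : ℝ)) : ℂ) = (x : ℂ) + n := by push_cast; ring
    have e2 : (((n + x : ℝ)) : ℂ) = (x : ℂ) + n := by push_cast; ring
    rw [e1] at h3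
    rw [e2] at h4
    simp only [add_zero]
    linarith

lemma hasSum_digamma_ofReal {x : ℝ} (hx : 0 < x) :
    digamma (x : ℂ) + Real.eulerMascheroniConstant =
      ∑' k : ℕ, ((1 : ℂ) / (k + 1) - 1 / ((x : ℂ) + k)) := by
  have hre : 0 < (x : ℂ).re := by simpa
  have h1 := (summable_digamma hre).hasSum.tendsto_sum_nat
  have him : ∀ {y : ℝ}, 0 < y → ((digamma (y : ℂ)).re : ℂ) = digamma (y : ℂ) := fun hy => by
    rw [digamma_ofReal hy, Complex.ofReal_re]
  have h2 := (tendsto_digamma_ofReal_sub hx).sub (tendsto_digamma_ofReal_sub one_pos)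
  have h3 : Tendsto (fun n : ℕ => digamma ((x : ℂ) + n) - digamma (1 + n)) atTop (𝓝 0) := by
    have := (Complex.continuous_ofReal.tendsto _).comp h2
    simp only [sub_zero, Complex.ofReal_zero] at this
    refine this.congr fun n => ?_
    have e1 := him (y := x + n) (by positivity)
    have e2 := him (y := 1 + n) (by positivity)
    push_cast at e1 e2
    simp only [Function.comp_apply, Complex.ofReal_sub, Complex.ofReal_one]
    rw [e1, e2]
    ring
  have h4 : ∀ n : ℕ, digamma ((x : ℂ) + n) - digamma (1 + n) =
      digamma x + Real.eulerMascheroniConstant -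
        ∑ k ∈ Finset.range n, ((1 : ℂ) / (k + 1) - 1 / ((x : ℂ) + k)) := by
    intro n
    rw [digamma_add_nat hre, digamma_add_nat (z := 1) (by simp), Complex.digamma_one,
      Finset.sum_sub_distrib]
    simp_rw [add_comm (1 : ℂ)]
    ring
  simp_rw [h4] at h3
  have h5 := tendsto_nhds_unique h3 (h1.const_sub _)
  exact (sub_eq_zero.1 h5.symm)

theorem digamma_eq_tsum {z : ℂ} (hz : 0 < z.re) :
    digamma z + Real.eulerMascheroniConstant =
      ∑' k : ℕ, ((1 : ℂ) / (k + 1) - 1 / (z + k)) := by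
  have hopen : IsOpen {z : ℂ | 0 < z.re} := isOpen_lt continuous_const Complex.continuous_re
  have hf := (differentiableOn_digamma.add_const
    (Real.eulerMascheroniConstant : ℂ)).analyticOnNhd hopen
  have hg := differentiableOn_digamma_tsum.analyticOnNhd hopen
  have hpre : IsPreconnected {z : ℂ | 0 < z.re} := (convex_halfSpace_re_gt 0).isPreconnected
  refine hf.eqOn_of_preconnected_of_frequently_eq hg hpre (z₀ := 1) (by simp) ?_ hz
  have ht : Tendsto (fun n : ℕ => (((1 : ℝ) + 1 / ((n : ℝ) + 1) : ℝ) : ℂ)) atTop (𝓝[≠] 1) := by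
    refine tendsto_nhdsWithin_iff.2 ⟨?_, Eventually.of_forall fun n => ?_⟩
    · have h := (tendsto_one_div_add_atTop_nhds_zero_nat (𝕜 := ℝ)).const_add 1
      rw [add_zero] at h
      exact (Complex.continuous_ofReal.tendsto _).comp h
    · intro h
      have h2 : (1 : ℝ) + 1 / ((n : ℝ) + 1) = 1 := by
        have := congrArg Complex.re (Set.mem_singleton_iff.1 h)
        simpa only [Complex.ofReal_re, Complex.one_re] using this
      have : 0 < 1 / ((n : ℝ) + 1) := by positivity
      linarith
  refine ht.frequently (Frequently.of_forall fun n => ?_)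
  exact hasSum_digamma_ofReal (by positivity)

end

section

open Filter Topology Metric ComplexConjugate

open Complex (digamma)

/-! ### Numerical bounds for logarithms -/

lemma log_le_of_pow_le {a : ℝ} (ha : 0 < a) (m n : ℕ) (hn : 0 < n)
    (h : a ^ n ≤ (2.7182818283 : ℝ) ^ m) : Real.log a ≤ m / n := by
  have h1 : a ^ n ≤ Real.exp m := by
    calc a ^ n ≤ (2.7182818283 : ℝ) ^ m := h
      _ ≤ Real.exp 1 ^ m := by gcongr; exact Real.exp_one_gt_d9.le
      _ = Real.exp m := by rw [← Real.exp_nat_mul, mul_one]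
  have h2 := Real.log_le_log (by positivity) h1
  rw [Real.log_pow, Real.log_exp] at h2
  rw [le_div_iff₀ (by exact_mod_cast hn)]
  linarith

lemma le_log_of_le_pow {a : ℝ} (m n : ℕ) (hn : 0 < n)
    (h : (2.7182818286 : ℝ) ^ m ≤ a ^ n) : (m : ℝ) / n ≤ Real.log a := by
  have h1 : Real.exp m ≤ a ^ n := by
    calc Real.exp m = Real.exp 1 ^ m := by rw [← Real.exp_nat_mul, mul_one]
      _ ≤ (2.7182818286 : ℝ) ^ m := by gcongr; exact Real.exp_one_lt_d9.le
      _ ≤ a ^ n := h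
  have h2 := Real.log_le_log (Real.exp_pos _) h1
  rw [Real.log_pow, Real.log_exp] at h2
  rw [div_le_iff₀ (by exact_mod_cast hn)]
  linarith

/-! ### Stirling's approximation for the digamma function -/

lemma log_one_add_inv_eq {z : ℂ} (hz : 0 < z.re) :
    Complex.log (1 + 1 / z) = Complex.log (z + 1) - Complex.log z := by
  have hz0 : z ≠ 0 := fun h => by simp [h] at hz
  have hz1 : 0 < (1 + 1 / z).re := by
    rw [Complex.add_re, re_one_div, Complex.one_re]
    positivity
  have hne : (1 + 1 / z) ≠ 0 := fun h => by rw [h] at hz1; simp at hz1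
  have h1 := Complex.abs_arg_lt_pi_div_two_iff.2 (Or.inl hz)
  have h2 := Complex.abs_arg_lt_pi_div_two_iff.2 (Or.inl hz1)
  rw [abs_lt] at h1 h2
  have h3 := (Complex.log_mul_eq_add_log_iff hz0 hne).2 ⟨by linarith, by linarith⟩
  rw [mul_add, mul_one, mul_one_div_cancel hz0] at h3
  rw [h3]
  ring

lemma tendsto_digamma_add_nat_sub_log {z : ℂ} (hz : 0 < z.re) :
    Tendsto (fun n : ℕ => digamma (z + n) - Complex.log (z + n)) atTop (𝓝 0) := by
  have h1 : Tendsto (fun n : ℕ => digamma (z + n) - digamma (1 + n)) atTop (𝓝 0) := by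
    have h := ((summable_digamma hz).hasSum.tendsto_sum_nat).const_sub
      (digamma z + Real.eulerMascheroniConstant)
    rw [← digamma_eq_tsum hz, sub_self] at h
    refine h.congr fun n => ?_
    rw [digamma_add_nat hz, digamma_add_nat (z := 1) (by simp), Complex.digamma_one,
      Finset.sum_sub_distrib]
    simp_rw [add_comm (1 : ℂ)]
    ring
  have h2 : Tendsto (fun n : ℕ => digamma (1 + n) - Complex.log n) atTop (𝓝 0) := by
    have h := (Complex.continuous_ofReal.tendsto _).comp (tendsto_digamma_ofReal_sub one_pos)
    rw [Complex.ofReal_zero] at h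
    refine h.congr fun n => ?_
    have e1 := digamma_ofReal (x := 1 + n) (by positivity)
    push_cast at e1
    simp only [Function.comp_apply, Complex.ofReal_sub, Complex.ofReal_one]
    rw [e1, Complex.ofReal_re, Complex.natCast_log]
  have h3 : Tendsto (fun n : ℕ => Complex.log (z + n) - Complex.log n) atTop (𝓝 0) := by
    have h : Tendsto (fun n : ℕ => Complex.log (1 + z / n)) atTop (𝓝 (Complex.log (1 + 0))) := by
      refine Tendsto.clog (tendsto_const_nhds.add ?_) (by simp)
      exact tendsto_const_div_atTop_nhds_zero_nat z
    rw [add_zero, Complex.log_one] at h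
    refine h.congr' ?_
    filter_upwards [eventually_ge_atTop 1] with n hn
    have hn0 : (n : ℂ) ≠ 0 := by exact_mod_cast (by omega : n ≠ 0)
    have hnp : (0 : ℝ) < n := by exact_mod_cast (by omega : 0 < n)
    have hne : 1 + z / n ≠ 0 := by
      intro h
      have h2 := congrArg Complex.re h
      rw [Complex.add_re, Complex.div_natCast_re] at h2
      simp only [Complex.one_re, Complex.zero_re] at h2
      have : 0 < z.re / n := by positivity
      linarith
    have h4 := Complex.log_ofReal_mul hnp hne
    have e : ((n : ℝ) : ℂ) * (1 + z / n) = z + n := by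
      push_cast; field_simp; ring
    rw [e] at h4
    rw [h4, ← Complex.natCast_log]
    simp
  have h := (h1.add h2).sub h3
  simp only [add_zero, sub_zero] at h
  refine h.congr fun n => ?_
  ring

lemma hasSum_digamma_sub_log {z : ℂ} (hz : 0 < z.re) :
    Tendsto (fun n : ℕ => ∑ k ∈ Finset.range n,
      (Complex.log (1 + 1 / (z + k)) - 1 / (z + k))) atTop (𝓝 (digamma z - Complex.log z)) := by
  have h := (tendsto_digamma_add_nat_sub_log hz).const_sub (digamma z - Complex.log z)
  rw [sub_zero] at h
  refine h.congr fun n => ?_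
  have h1 : ∀ k : ℕ, Complex.log (1 + 1 / (z + k)) =
      Complex.log (z + (k + 1 : ℕ)) - Complex.log (z + k) := fun k => by
    have : 0 < (z + k).re := by
      have : (0 : ℝ) ≤ k := k.cast_nonneg
      simp; linarith
    rw [log_one_add_inv_eq this]
    push_cast
    ring_nf
  rw [Finset.sum_sub_distrib, Finset.sum_congr rfl fun k _ => h1 k,
    Finset.sum_range_sub (fun k : ℕ => Complex.log (z + k)), digamma_add_nat hz]
  push_cast
  ring_nf

theorem norm_digamma_sub_log_le {z : ℂ} (hz : 3 / 2 ≤ z.re) :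
    ‖digamma z - Complex.log z‖ ≤ 3 / (‖z‖ - 1) := by
  have hz0 : 0 < z.re := by linarith
  set r := ‖z‖ with hr
  have hr1 : 3 / 2 ≤ r := hz.trans (Complex.re_le_norm z)
  have hterm : ∀ k : ℕ, ‖Complex.log (1 + 1 / (z + k)) - 1 / (z + k)‖ ≤
      3 * (1 / (r - 1 + k) - 1 / (r - 1 + (k + 1 : ℕ))) := by
    intro k
    have hk : (0 : ℝ) ≤ k := k.cast_nonneg
    have hre : 3 / 2 ≤ ‖z + k‖ := by
      refine le_trans ?_ (Complex.re_le_norm _)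
      simp; linarith
    have hsq : (r + k) ^ 2 ≤ 2 * ‖z + k‖ ^ 2 := by
      have e1 : ‖z + k‖ ^ 2 = r ^ 2 + 2 * k * z.re + k ^ 2 := by
        rw [hr, ← Complex.normSq_eq_norm_sq, ← Complex.normSq_eq_norm_sq, Complex.normSq_apply,
          Complex.normSq_apply]
        simp
        ring
      rw [e1]
      nlinarith [sq_nonneg (r - k), mul_nonneg hk hz0.le]
    have hw : ‖1 / (z + k)‖ ≤ 2 / 3 := by
      rw [norm_div, norm_one, div_le_iff₀ (by linarith)]
      linarith
    have h1 := Complex.norm_log_one_add_sub_self_le (z := 1 / (z + k)) (by linarith)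
    refine h1.trans ?_
    have h2 : (1 - ‖1 / (z + k)‖)⁻¹ ≤ 3 := by
      rw [inv_le_comm₀ (by linarith) (by norm_num)]
      linarith
    calc ‖1 / (z + k)‖ ^ 2 * (1 - ‖1 / (z + k)‖)⁻¹ / 2 ≤ ‖1 / (z + k)‖ ^ 2 * 3 / 2 := by gcongr
      _ = 3 / (2 * ‖z + k‖ ^ 2) := by
        rw [norm_div, norm_one]
        field_simp
      _ ≤ 3 / ((r - 1 + k) * (r + k)) := by
        have : 0 < r - 1 + k := by linarith
        have : 0 < r + k := by linarith
        refine div_le_div_of_nonneg_left (by norm_num) (by positivity) ?_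
        nlinarith
      _ = 3 * (1 / (r - 1 + k) - 1 / (r - 1 + (k + 1 : ℕ))) := by
        have h5 : r - 1 + k ≠ 0 := by linarith
        have h6 : r + k ≠ 0 := by linarith
        have : r - 1 + ((k + 1 : ℕ) : ℝ) = r + k := by push_cast; ring
        rw [this]
        field_simp
        ring
  refine le_of_tendsto (hasSum_digamma_sub_log hz0).norm (Eventually.of_forall fun n => ?_)
  refine (norm_sum_le _ _).trans ((Finset.sum_le_sum fun k _ => hterm k).trans ?_)
  rw [← Finset.mul_sum, Finset.sum_range_sub' (fun k : ℕ => 1 / (r - 1 + k))]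
  have : 0 ≤ 1 / (r - 1 + n) := by
    have : (0 : ℝ) ≤ n := n.cast_nonneg
    have : 0 ≤ r - 1 + n := by linarith
    positivity
  simp only [CharP.cast_eq_zero, add_zero]
  calc 3 * (1 / (r - 1) - 1 / (r - 1 + n)) ≤ 3 * (1 / (r - 1)) := by gcongr; linarith
    _ = _ := by ring

lemma digamma_re_mono {x y y' : ℝ} (hx : 0 < x) (h : |y| ≤ |y'|) :
    (digamma (x + y * Complex.I)).re ≤ (digamma (x + y' * Complex.I)).re := by
  have hz : ∀ y : ℝ, 0 < ((x : ℂ) + y * Complex.I).re := fun y => by simpa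
  have key : ∀ y : ℝ, (digamma (x + y * Complex.I)).re + Real.eulerMascheroniConstant =
      ∑' k : ℕ, ((1 : ℂ) / (k + 1) - 1 / (x + y * Complex.I + k)).re := fun y => by
    rw [← Complex.re_tsum (summable_digamma (hz y)), ← digamma_eq_tsum (hz y)]
    simp
  have hs : ∀ y : ℝ, Summable fun k : ℕ =>
      ((1 : ℂ) / (k + 1) - 1 / (x + y * Complex.I + k)).re := fun y =>
    (Complex.hasSum_re (summable_digamma (hz y)).hasSum).summable
  have h2 := (hs y).tsum_le_tsum (fun k => ?_) (hs y')
  · rw [← key, ← key] at h2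
    linarith
  · have hk : (0 : ℝ) ≤ k := k.cast_nonneg
    rw [Complex.sub_re, Complex.sub_re, re_one_div (x + y * Complex.I + k),
      re_one_div (x + y' * Complex.I + k)]
    have e : ∀ y : ℝ, ‖(x : ℂ) + y * Complex.I + k‖ ^ 2 = (x + k) ^ 2 + |y| ^ 2 := fun y => by
      rw [← Complex.normSq_eq_norm_sq, Complex.normSq_apply, sq_abs]
      simp
      ring
    have e2 : ∀ y : ℝ, ((x : ℂ) + y * Complex.I + k).re = x + k := fun y => by simp
    rw [e, e, e2, e2]
    gcongr

end

section

open Filter Topology Metric ComplexConjugate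

open Complex (digamma)

open scoped ArithmeticFunction.vonMangoldt

theorem LSeries_vonMangoldt_eq {s : ℂ} (hs : 1 < s.re) :
    LSeries (fun n : ℕ => (Λ n : ℂ)) s = 1 / (s - 1) - Real.log Real.pi / 2 + digamma (s / 2 + 1) / 2 -
      logDeriv riemannXi s := by
  have hs1 : s ≠ 1 := fun h => by simp [h] at hs
  have hs1' : s - 1 ≠ 0 := sub_ne_zero.2 hs1
  have hopen : IsOpen {z : ℂ | 1 < z.re} := isOpen_lt continuous_const Complex.continuous_re
  have hG : 0 < (s / 2 + 1).re := by
    have : (s / 2 + 1).re = s.re / 2 + 1 := by simp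
    rw [this]; linarith
  have hpi : (Real.pi : ℂ) ≠ 0 := by exact_mod_cast Real.pi_ne_zero
  have hev : riemannXi =ᶠ[𝓝 s] fun s => 2 * (s - 1) * (Real.pi : ℂ) ^ (-s / 2) *
      Complex.Gamma (s / 2 + 1) * riemannZeta s := by
    filter_upwards [hopen.mem_nhds hs] with z hz
    exact riemannXi_eq (by have : 1 < z.re := hz; linarith) fun h => by simp [h] at hz
  have d1 : HasDerivAt (fun s : ℂ => 2 * (s - 1)) 2 s := by
    simpa using ((hasDerivAt_id s).sub_const 1).const_mul 2
  have d2 : HasDerivAt (fun s : ℂ => (Real.pi : ℂ) ^ (-s / 2))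
      ((Real.pi : ℂ) ^ (-s / 2) * Complex.log Real.pi * (-1 / 2)) s :=
    (((hasDerivAt_id s).neg).div_const 2).const_cpow (Or.inl hpi)
  have dG0 := (Complex.differentiableAt_Gamma _ (ne_neg_nat_of_re_pos hG)).hasDerivAt
  have d3 : HasDerivAt (fun s : ℂ => Complex.Gamma (s / 2 + 1))
      (deriv Complex.Gamma (s / 2 + 1) * (1 / 2)) s :=
    dG0.comp s (((hasDerivAt_id s).div_const 2).add_const 1)
  have d4 := (differentiableAt_riemannZeta hs1).hasDerivAt
  have hz := riemannZeta_ne_zero_of_one_le_re hs.le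
  have hGn := Complex.Gamma_ne_zero_of_re_pos hG
  have hp : (Real.pi : ℂ) ^ (-s / 2) ≠ 0 := by simp [Complex.cpow_eq_zero_iff, hpi]
  have d := ((d1.mul d2).mul d3).mul d4
  have e : logDeriv riemannXi s = 1 / (s - 1) - Real.log Real.pi / 2 +
      digamma (s / 2 + 1) / 2 + deriv riemannZeta s / riemannZeta s := by
    rw [logDeriv_apply, hev.deriv_eq, hev.eq_of_nhds, Complex.digamma_def, logDeriv_apply,
      Complex.ofReal_log Real.pi_pos.le]
    refine (congrArg (· / _) d.deriv).trans ?_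
    simp only [Pi.mul_apply]
    clear d d3 dG0 hG hev
    generalize deriv Complex.Gamma (s / 2 + 1) = G' at *
    generalize Complex.Gamma (s / 2 + 1) = G at *
    field_simp
    ring
  rw [ArithmeticFunction.LSeries_vonMangoldt_eq_deriv_riemannZeta_div hs, e]
  ring

lemma LSeries_vonMangoldt_ofReal {σ : ℝ} (hs : 1 < σ) :
    HasSum (fun n : ℕ => Λ n * (n : ℝ) ^ (-σ)) (LSeries (fun n : ℕ => (Λ n : ℂ)) σ).re := by
  have h := (ArithmeticFunction.LSeriesSummable_vonMangoldt
    (s := (σ : ℂ)) (by simpa using hs)).hasSum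
  have h2 := Complex.hasSum_re h
  have e : (fun n : ℕ => Λ n * (n : ℝ) ^ (-σ)) =
      fun n => (LSeries.term (fun n : ℕ => (Λ n : ℂ)) (σ : ℂ) n).re := funext fun n => ?_
  · rw [e]
    exact h2
  rcases Nat.eq_zero_or_pos n with rfl | hn
  · simp
  · rw [LSeries.term_of_ne_zero hn.ne', Real.rpow_neg n.cast_nonneg, ← div_eq_mul_inv]
    have : ((n : ℂ) ^ (σ : ℂ)) = (((n : ℝ) ^ σ : ℝ) : ℂ) := by
      rw [Complex.ofReal_cpow n.cast_nonneg]; simp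
    rw [this]
    norm_cast

lemma logDeriv_riemannXi_ofReal_re {σ : ℝ} (hs : 1 < σ) :
    (logDeriv riemannXi σ).re = 1 / (σ - 1) - Real.log Real.pi / 2 +
      (digamma ((σ / 2 + 1 : ℝ) : ℂ)).re / 2 - ∑' n : ℕ, Λ n * (n : ℝ) ^ (-σ) := by
  have h := congrArg Complex.re (LSeries_vonMangoldt_eq (s := (σ : ℂ)) (by simpa using hs))
  rw [← (LSeries_vonMangoldt_ofReal hs).tsum_eq] at h
  have e1 : (1 / ((σ : ℂ) - 1)).re = 1 / (σ - 1) := by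
    have : (1 / ((σ : ℂ) - 1)) = ((1 / (σ - 1) : ℝ) : ℂ) := by push_cast; rfl
    rw [this, Complex.ofReal_re]
  have e2 : ((Real.log Real.pi : ℂ) / 2).re = Real.log Real.pi / 2 := by
    have : ((Real.log Real.pi : ℂ) / 2) = ((Real.log Real.pi / 2 : ℝ) : ℂ) := by push_cast; rfl
    rw [this, Complex.ofReal_re]
  have e3 : (digamma ((σ : ℂ) / 2 + 1) / 2).re = (digamma ((σ / 2 + 1 : ℝ) : ℂ)).re / 2 := by
    push_cast
    simp
  rw [Complex.sub_re, Complex.add_re, Complex.sub_re, e1, e2, e3] at h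
  linarith

lemma le_log_pi : (103 : ℝ) / 90 ≤ Real.log Real.pi := by
  have := le_log_of_le_pow (a := Real.pi) 103 90 (by norm_num) (by
    calc (2.7182818286 : ℝ) ^ 103 ≤ 3.141592 ^ 90 := by norm_num
      _ ≤ Real.pi ^ 90 := by gcongr; exact Real.pi_gt_d6.le)
  exact_mod_cast this

lemma one_div_sub_re (s ρ : ℂ) :
    (1 / (s - ρ)).re = (s.re - ρ.re) / ((s.re - ρ.re) ^ 2 + (s.im - ρ.im) ^ 2) := by
  rw [re_one_div, ← Complex.normSq_eq_norm_sq, Complex.normSq_apply]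
  simp [sq]

lemma summable_xiOrder_re_sub {s : ℂ} (hs : 1 ≤ s.re) :
    HasSum (fun ρ : ℂ => (xiOrder ρ : ℝ) * (1 / (s - ρ)).re) (logDeriv riemannXi s).re :=
  hasSum_re_logDeriv_riemannXi (riemannXi_ne_zero_of_one_le_re hs)

lemma xiOrder_mul_re_sub_nonneg {s : ℂ} (hs : 1 ≤ s.re) (ρ : ℂ) :
    0 ≤ (xiOrder ρ : ℝ) * (1 / (s - ρ)).re := by
  by_cases h : xiOrder ρ = 0
  · simp [h]
  · have h1 := xiOrder_re_mem h
    rw [one_div_sub_re]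
    have : 0 ≤ s.re - ρ.re := by linarith
    positivity

/-- There are no nontrivial zeros of low height. -/
theorem one_lt_abs_im_of_xiOrder {ρ : ℂ} (h : xiOrder ρ ≠ 0) : 1 < |ρ.im| := by
  by_contra hle
  push Not at hle
  have h1 := summable_xiOrder_re_sub (s := ((2 : ℝ) : ℂ)) (by simp)
  have h2 := le_hasSum h1 ρ fun b _ => xiOrder_mul_re_sub_nonneg (by simp) b
  rw [logDeriv_riemannXi_ofReal_re (by norm_num)] at h2
  have h3 : (digamma ((2 / 2 + 1 : ℝ) : ℂ)).re ≤ 1 / 2 := by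
    have e := Complex.digamma_apply_add_one 1 (ne_neg_nat_of_re_pos (by simp))
    rw [Complex.digamma_one] at e
    have e2 : ((2 / 2 + 1 : ℝ) : ℂ) = 1 + 1 := by norm_num
    rw [e2, e]
    have := Real.one_half_lt_eulerMascheroniConstant
    simp
    linarith
  have h4 : Real.log 2 / 4 + Real.log 3 / 9 ≤ ∑' n : ℕ, Λ n * (n : ℝ) ^ (-(2 : ℝ)) := by
    have hs := LSeries_vonMangoldt_ofReal (σ := 2) (by norm_num)
    have := hs.summable.sum_le_tsum {2, 3} fun n _ =>
      mul_nonneg ArithmeticFunction.vonMangoldt_nonneg (by positivity)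
    refine le_trans (le_of_eq ?_) this
    rw [Finset.sum_pair (by norm_num), ArithmeticFunction.vonMangoldt_apply_prime Nat.prime_two,
      ArithmeticFunction.vonMangoldt_apply_prime Nat.prime_three, Real.rpow_neg (by positivity),
      Real.rpow_neg (by positivity)]
    norm_num
    ring
  have h5 := Real.log_two_gt_d9
  have h6 : (1 : ℝ) ≤ Real.log 3 := by
    have := le_log_of_le_pow (a := 3) 1 1 (by norm_num) (by norm_num)
    simpa using this
  have h7 := le_log_pi
  have h8 : (2 : ℝ) / 5 ≤ (xiOrder ρ : ℝ) * (1 / (((2 : ℝ) : ℂ) - ρ)).re := by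
    have hm : (1 : ℝ) ≤ xiOrder ρ := by exact_mod_cast Nat.one_le_iff_ne_zero.2 h
    have hb := xiOrder_re_mem h
    have hi : ρ.im ^ 2 ≤ 1 := by rw [← sq_abs]; nlinarith [abs_nonneg ρ.im]
    have : (2 : ℝ) / 5 ≤ (1 / (((2 : ℝ) : ℂ) - ρ)).re := by
      rw [one_div_sub_re, Complex.ofReal_re, Complex.ofReal_im, zero_sub, neg_sq,
        div_le_div_iff₀ (by norm_num) (by nlinarith)]
      nlinarith
    nlinarith
  linarith

lemma xiOrder_div_sq_add_im_sq_le {T : ℝ} (hT : 1 < T) (ρ : ℂ) :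
    (xiOrder ρ : ℝ) * (1 / (T ^ 2 + ρ.im ^ 2)) ≤
      1 / (T - 1) * ((xiOrder ρ : ℝ) * (1 / ((T : ℂ) - ρ)).re) := by
  by_cases h : xiOrder ρ = 0
  · simp [h]
  · have hb := xiOrder_re_mem h
    rw [mul_left_comm]
    refine mul_le_mul_of_nonneg_left ?_ (Nat.cast_nonneg _)
    rw [one_div_sub_re, Complex.ofReal_re, Complex.ofReal_im, zero_sub, neg_sq, div_mul_div_comm,
      one_mul, div_le_div_iff₀ (by positivity) (by
        have : 0 < T - 1 := by linarith
        have : 0 < T - ρ.re := by linarith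
        positivity), one_mul]
    have h1 : T - 1 ≤ T - ρ.re := by linarith
    have h2 : (T - ρ.re) ^ 2 ≤ T ^ 2 := by nlinarith
    have h3 : 0 < T - 1 := by linarith
    have h4 : 0 ≤ T - ρ.re := by linarith
    calc (T - 1) * ((T - ρ.re) ^ 2 + ρ.im ^ 2) ≤ (T - ρ.re) * (T ^ 2 + ρ.im ^ 2) := by gcongr
      _ = _ := by ring

lemma summable_xiOrder_div_sq_add_im_sq {T : ℝ} (hT : 1 < T) :
    Summable fun ρ : ℂ => (xiOrder ρ : ℝ) * (1 / (T ^ 2 + ρ.im ^ 2)) :=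
  Summable.of_nonneg_of_le (fun ρ => by positivity) (xiOrder_div_sq_add_im_sq_le hT)
    ((summable_xiOrder_re_sub (s := (T : ℂ)) (by simpa using hT.le)).summable.mul_left _)

theorem tsum_xiOrder_div_sq_add_im_sq_le {T : ℝ} (hT : 10 ≤ T) :
    ∑' ρ : ℂ, (xiOrder ρ : ℝ) * (1 / (T ^ 2 + ρ.im ^ 2)) ≤ Real.log T / (2 * (T - 1)) := by
  have hT1 : 1 < T := by linarith
  have h1 := summable_xiOrder_re_sub (s := (T : ℂ)) (by simpa using hT1.le)
  have h2 := (summable_xiOrder_div_sq_add_im_sq hT1).tsum_le_tsum (xiOrder_div_sq_add_im_sq_le hT1)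
    (h1.summable.mul_left _)
  rw [tsum_mul_left, h1.tsum_eq, logDeriv_riemannXi_ofReal_re hT1] at h2
  have h3 : 0 ≤ ∑' n : ℕ, Λ n * (n : ℝ) ^ (-T) :=
    tsum_nonneg fun n => mul_nonneg ArithmeticFunction.vonMangoldt_nonneg (by positivity)
  have h4 := (digamma_re_bounds (x := T / 2 + 1) (by linarith)).2
  have h5 : Real.log (T / 2 + 1) ≤ Real.log T := Real.log_le_log (by linarith) (by linarith)
  have h6 : 1 / (T - 1) ≤ 1 / 9 := by
    apply one_div_le_one_div_of_le <;> linarith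
  have h7 := le_log_pi
  refine h2.trans ?_
  rw [show Real.log T / (2 * (T - 1)) = 1 / (T - 1) * (Real.log T / 2) by field_simp]
  have : 0 ≤ 1 / (T - 1) := by
    have : 0 < T - 1 := by linarith
    positivity
  gcongr
  linarith

end

section

open Filter Topology Metric ComplexConjugate

open Complex (digamma)

lemma norm_add_mul_I_sq (x y : ℝ) : ‖(x : ℂ) + y * Complex.I‖ ^ 2 = x ^ 2 + y ^ 2 := by
  rw [← Complex.normSq_eq_norm_sq, Complex.normSq_add_mul_I]

lemma digamma_re_le_of_large {x y : ℝ} (hx : 3 / 2 ≤ x) (hx' : x ≤ 31 / 20) (hy : 1 < y) :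
    (digamma (x + y * Complex.I)).re ≤ Real.log y + 121 / 100 / y ^ 2 + 3 / (y - 1) := by
  have hz : (3 : ℝ) / 2 ≤ ((x : ℂ) + y * Complex.I).re := by simpa using hx
  have h1 := (Complex.abs_re_le_norm _).trans (norm_digamma_sub_log_le hz)
  rw [Complex.sub_re, Complex.log_re, abs_le] at h1
  have hn := norm_add_mul_I_sq x y
  have hny : y ≤ ‖(x : ℂ) + y * Complex.I‖ := by
    refine le_of_sq_le_sq ?_ (norm_nonneg _)
    rw [hn]; nlinarith
  have h2 : 3 / (‖(x : ℂ) + y * Complex.I‖ - 1) ≤ 3 / (y - 1) := by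
    have : 0 < y - 1 := by linarith
    gcongr
  have hn0 : 0 < ‖(x : ℂ) + y * Complex.I‖ := by linarith
  have h3 : 2 * Real.log ‖(x : ℂ) + y * Complex.I‖ ≤ 2 * Real.log y + 242 / 100 / y ^ 2 := by
    have e1 : 2 * Real.log ‖(x : ℂ) + y * Complex.I‖ = Real.log (y ^ 2 * (1 + x ^ 2 / y ^ 2)) := by
      have : y ^ 2 * (1 + x ^ 2 / y ^ 2) = ‖(x : ℂ) + y * Complex.I‖ ^ 2 := by
        rw [hn]; field_simp; ring
      rw [this, Real.log_pow]; norm_num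
    have e2 : Real.log (1 + x ^ 2 / y ^ 2) ≤ x ^ 2 / y ^ 2 := by
      have := Real.log_le_sub_one_of_pos (x := 1 + x ^ 2 / y ^ 2) (by positivity)
      linarith
    have e3 : x ^ 2 / y ^ 2 ≤ 242 / 100 / y ^ 2 := by
      gcongr
      nlinarith
    rw [e1, Real.log_mul (by positivity) (by positivity), Real.log_pow]
    push_cast
    linarith
  have h4 : 242 / 100 / y ^ 2 = 2 * (121 / 100 / y ^ 2) := by ring
  linarith [h1.2]

lemma le_digamma_re_of_large {x y : ℝ} (hx : 3 / 2 ≤ x) (hy : 1 < y) :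
    Real.log y - 3 / (y - 1) ≤ (digamma (x + y * Complex.I)).re := by
  have hz : (3 : ℝ) / 2 ≤ ((x : ℂ) + y * Complex.I).re := by simpa using hx
  have h1 := (Complex.abs_re_le_norm _).trans (norm_digamma_sub_log_le hz)
  rw [Complex.sub_re, Complex.log_re, abs_le] at h1
  have hn := norm_add_mul_I_sq x y
  have hny : y ≤ ‖(x : ℂ) + y * Complex.I‖ := by
    refine le_of_sq_le_sq ?_ (norm_nonneg _)
    rw [hn]; nlinarith
  have h2 : 3 / (‖(x : ℂ) + y * Complex.I‖ - 1) ≤ 3 / (y - 1) := by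
    have : 0 < y - 1 := by linarith
    gcongr
  have h3 := Real.log_le_log (by linarith) hny
  linarith [h1.1]

lemma digamma_re_abs (x y : ℝ) (hx : 0 < x) :
    (digamma (x + y * Complex.I)).re = (digamma (x + (|y| : ℝ) * Complex.I)).re :=
  le_antisymm (digamma_re_mono hx (abs_abs y).ge) (digamma_re_mono hx (abs_abs y).le)

/-- The combined archimedean contribution in Stechkin's argument. -/
lemma digamma_combination_le {x y l : ℝ} (hx : 3 / 2 ≤ x) (hx' : x ≤ 31 / 20) (hl : 5 ≤ l)
    (hy : Real.log (2 * |y|) - 9 / 5 ≤ l) :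
    (digamma (x + y * Complex.I)).re / 2 -
      25 / 113 * (digamma ((363 / 200 : ℝ) + y * Complex.I)).re - 63 / 226 * Real.log Real.pi ≤
      63 / 226 * l := by
  rw [digamma_re_abs x y (by linarith), digamma_re_abs (363 / 200) y (by norm_num)]
  have hpi := le_log_pi
  have hlow : -(23 : ℝ) / 100 ≤ (digamma ((363 / 200 : ℝ) + (|y| : ℝ) * Complex.I)).re := by
    have h1 := digamma_re_mono (x := 363 / 200) (y := 0) (y' := |y|) (by norm_num) (by simp)
    have h2 := (digamma_re_bounds (x := 163 / 200) (by norm_num)).1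
    rw [show ((163 / 200 + 1 : ℝ)) = 363 / 200 by norm_num] at h2
    have h3 := Real.one_sub_inv_le_log_of_pos (x := 163 / 200) (by norm_num)
    norm_num at h1 h2 h3 ⊢
    linarith
  have h0 := abs_nonneg y
  generalize |y| = Y at *
  by_cases h22 : Y ≤ 22
  · have h1 := digamma_re_mono (x := x) (y := Y) (y' := 22) (by linarith)
      (by rw [abs_of_nonneg h0]; norm_num; linarith)
    have h2 := digamma_re_le_of_large hx hx' (y := 22) (by norm_num)
    have h3 := log_le_of_pow_le (a := 22) (by norm_num) 31 10 (by norm_num) (by norm_num)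
    norm_num at h1 h2 h3 hlow ⊢
    linarith
  · push Not at h22
    have h1 := digamma_re_le_of_large hx hx' (y := Y) (by linarith)
    have h2 := le_digamma_re_of_large (x := 363 / 200) (y := Y) (by norm_num) (by linarith)
    have h5 : Real.log (2 * Y) = Real.log 2 + Real.log Y :=
      Real.log_mul (by norm_num) (by linarith)
    have hl2 := Real.log_two_gt_d9
    by_cases h299 : Y ≤ 299
    · have h3 := log_le_of_pow_le (a := 299) (by norm_num) 115 20 (by norm_num) (by norm_num)
      have h4 := Real.log_le_log (by linarith) h299
      have h6 : 121 / 100 / Y ^ 2 ≤ 121 / 100 / 22 ^ 2 := by gcongr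
      have h7 : 3 / (Y - 1) ≤ 3 / 21 := by gcongr; linarith
      norm_num at *
      linarith
    · push Not at h299
      have h6 : 121 / 100 / Y ^ 2 ≤ 121 / 100 / 299 ^ 2 := by gcongr
      have h7 : 3 / (Y - 1) ≤ 3 / 298 := by gcongr; linarith
      norm_num at *
      linarith

/-! ### Stechkin's kernel -/

/-- The contribution of a zero with real part `β` to Stechkin's weighted combination,
symmetrised over `β ↦ 1 - β`. -/
noncomputable def stechkinPair (η β y : ℝ) : ℝ :=
  (1 + η - β) / ((1 + η - β) ^ 2 + y ^ 2) + (η + β) / ((η + β) ^ 2 + y ^ 2) -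
    50 / 113 * ((163 / 100 - β) / ((163 / 100 - β) ^ 2 + y ^ 2) +
      (63 / 100 + β) / ((63 / 100 + β) ^ 2 + y ^ 2))

lemma div_add_div_sq_add {a b Y : ℝ} (ha : 0 < a) (hb : 0 < b) (hY : 0 ≤ Y) :
    a / (a ^ 2 + Y) + b / (b ^ 2 + Y) =
      (a + b) * (a * b + Y) / ((a * b + Y) ^ 2 + (a - b) ^ 2 * Y) := by
  have h1 : 0 < a ^ 2 + Y := by positivity
  have h2 : 0 < b ^ 2 + Y := by positivity
  have e : (a * b + Y) ^ 2 + (a - b) ^ 2 * Y = (a ^ 2 + Y) * (b ^ 2 + Y) := by ring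
  rw [e, div_add_div _ _ h1.ne' h2.ne']
  congr 1
  ring

lemma stechkinPair_second (β y : ℝ) (h0 : 0 < β) (h1 : β < 1) :
    50 / 113 * ((163 / 100 - β) / ((163 / 100 - β) ^ 2 + y ^ 2) +
      (63 / 100 + β) / ((63 / 100 + β) ^ 2 + y ^ 2)) =
    ((163 / 100 - β) * (63 / 100 + β) + y ^ 2) /
      (((163 / 100 - β) * (63 / 100 + β) + y ^ 2) ^ 2 + (2 * β - 1) ^ 2 * y ^ 2) := by
  have a1 : 0 < 163 / 100 - β := by linarith
  have a2 : 0 < 63 / 100 + β := by linarith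
  rw [div_add_div_sq_add a1 a2 (sq_nonneg y),
    show (163 / 100 - β) - (63 / 100 + β) = -(2 * β - 1) by ring,
    show (163 / 100 - β) + (63 / 100 + β) = 113 / 50 by ring, neg_sq, ← mul_div_assoc, ← mul_assoc]
  norm_num

lemma stechkinPair_second_le (β y : ℝ) (h0 : 0 < β) (h1 : β < 1) :
    50 / 113 * ((163 / 100 - β) / ((163 / 100 - β) ^ 2 + y ^ 2) +
      (63 / 100 + β) / ((63 / 100 + β) ^ 2 + y ^ 2)) ≤ 1 / (10269 / 10000 + y ^ 2) := by
  rw [stechkinPair_second β y h0 h1]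
  have a3 : 10269 / 10000 ≤ (163 / 100 - β) * (63 / 100 + β) := by nlinarith
  set t := (163 / 100 - β) * (63 / 100 + β)
  rw [div_le_div_iff₀ (by positivity) (by positivity)]
  nlinarith [sq_nonneg y, mul_nonneg (sq_nonneg (2 * β - 1)) (sq_nonneg y)]

lemma stechkin_aux {η p r Y c : ℝ} (hη : 0 < η) (hp : 0 < p) (hr : 1 ≤ r) (hpr : p ≤ r)
    (hY : 0 ≤ Y) (hc0 : 0 ≤ c) (hcY : c ≤ Y) :
    (r + Y) / ((r + Y) ^ 2 + c) ≤ (1 + 2 * η) * (p + Y) / ((p + Y) ^ 2 + c) := by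
  obtain ⟨u, hu⟩ : ∃ u, u = p + Y := ⟨_, rfl⟩
  obtain ⟨v, hv⟩ : ∃ v, v = r + Y := ⟨_, rfl⟩
  rw [← hu, ← hv]
  have hu1 : 0 < u := by linarith
  have hv1 : 0 < v := by linarith
  have huv : c ≤ u * v := by
    have h2 : Y ≤ u := by linarith
    have h3 : 1 ≤ v := by linarith
    nlinarith
  have hle : u ≤ v := by linarith
  calc v / (v ^ 2 + c) ≤ u / (u ^ 2 + c) := by
        rw [div_le_div_iff₀ (by positivity) (by positivity)]
        linarith [mul_nonneg (sub_nonneg.2 hle) (sub_nonneg.2 huv)]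
    _ ≤ (1 + 2 * η) * u / (u ^ 2 + c) := by
        gcongr
        nlinarith

lemma stechkinPair_nonneg {η β : ℝ} (hη : 0 < η) (hη' : η ≤ 1 / 10) (h0 : 0 < β) (h1 : β < 1)
    (y : ℝ) : 0 ≤ stechkinPair η β y := by
  have a1 : 0 < 1 + η - β := by linarith
  have a2 : 0 < η + β := by linarith
  have hu0 : 0 < (1 + η - β) * (η + β) := mul_pos a1 a2
  have hfirst : (1 + η - β) / ((1 + η - β) ^ 2 + y ^ 2) + (η + β) / ((η + β) ^ 2 + y ^ 2) =
      (1 + 2 * η) * ((1 + η - β) * (η + β) + y ^ 2) /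
        (((1 + η - β) * (η + β) + y ^ 2) ^ 2 + (2 * β - 1) ^ 2 * y ^ 2) := by
    rw [div_add_div_sq_add a1 a2 (sq_nonneg y),
      show (1 + η - β) - (η + β) = -(2 * β - 1) by ring,
      show (1 + η - β) + (η + β) = 1 + 2 * η by ring, neg_sq]
  unfold stechkinPair
  rw [hfirst, stechkinPair_second β y h0 h1, sub_nonneg]
  have hlt : (1 + η - β) * (η + β) ≤ (163 / 100 - β) * (63 / 100 + β) := by nlinarith
  have ht : 1 ≤ (163 / 100 - β) * (63 / 100 + β) := by nlinarith
  exact stechkin_aux hη (mul_pos a1 a2) ht hlt (sq_nonneg y) (by positivity)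
    (mul_le_of_le_one_left (sq_nonneg y) (by nlinarith))

lemma le_stechkinPair_zero {η β : ℝ} (hη : 0 < η) (hη' : η ≤ 1 / 10) (h0 : 0 < β) (h1 : β < 1) :
    1 / (η + (1 - β)) - 13 / 200 ≤ stechkinPair η β 0 := by
  have h2 := stechkinPair_second_le β 0 h0 h1
  have a1 : 0 < 1 + η - β := by linarith
  have a2 : 0 < η + β := by linarith
  have e1 : (1 + η - β) / ((1 + η - β) ^ 2 + 0 ^ 2) = 1 / (η + (1 - β)) := by
    have : η + (1 - β) = 1 + η - β := by ring
    rw [this]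
    field_simp
    ring
  have e2 : 1 / (11 / 10) ≤ (η + β) / ((η + β) ^ 2 + 0 ^ 2) := by
    have : (η + β) / ((η + β) ^ 2 + 0 ^ 2) = 1 / (η + β) := by
      field_simp
      ring
    rw [this]
    apply one_div_le_one_div_of_le <;> linarith
  unfold stechkinPair
  rw [e1]
  norm_num at *
  linarith

lemma le_stechkinPair {η β : ℝ} (hη : 0 < η) (hη' : η ≤ 1 / 10) (h0 : 0 < β) (h1 : β < 1)
    (h3 : 1 - β ≤ 3 * η) (y : ℝ) :
    1 / 2 * ((1 + η - β) / ((1 + η - β) ^ 2 + y ^ 2)) ≤ stechkinPair η β y := by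
  have h2 := stechkinPair_second_le β y h0 h1
  have key : 1 / (10269 / 10000 + y ^ 2) ≤
      1 / 2 * ((1 + η - β) / ((1 + η - β) ^ 2 + y ^ 2)) + (η + β) / ((η + β) ^ 2 + y ^ 2) := by
    have hY : 0 ≤ y ^ 2 := sq_nonneg y
    generalize y ^ 2 = Y at *
    obtain ⟨e, he⟩ : ∃ e, e = 1 + η - β := ⟨_, rfl⟩
    obtain ⟨a, ha⟩ : ∃ a, a = η + β := ⟨_, rfl⟩
    rw [← he, ← ha]
    have he0 : 0 < e := by linarith
    have ha0 : 0 < a := by linarith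
    have hg2 : a / (a ^ 2 + Y) - 1 / (a * (1 + Y)) = Y * (a ^ 2 - 1) / (a * (1 + Y) * (a ^ 2 + Y)) := by
      field_simp
      ring
    rcases le_total a 1 with h | h
    · have g1 : e / (1 + Y) ≤ e / (e ^ 2 + Y) := by
        gcongr
        nlinarith
      have g2 : a / (1 + Y) ≤ a / (a ^ 2 + Y) := by
        gcongr
        nlinarith
      calc 1 / (10269 / 10000 + Y) ≤ (1 / 2 * e + a) / (1 + Y) := by
            gcongr <;> linarith
        _ = 1 / 2 * (e / (1 + Y)) + a / (1 + Y) := by ring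
        _ ≤ _ := by gcongr
    · rcases le_total a Y with hY1 | hY1
      · have g2 : 1 / (1 + Y) ≤ a / (a ^ 2 + Y) := by
          rw [div_le_div_iff₀ (by positivity) (by positivity)]
          nlinarith
        have g1 : 0 ≤ 1 / 2 * (e / (e ^ 2 + Y)) := by positivity
        have g3 : 1 / (10269 / 10000 + Y) ≤ 1 / (1 + Y) := by
          gcongr; norm_num
        linarith
      · have he1 : e ≤ 1 / 5 := by linarith
        have hae : a - 1 ≤ e := by linarith
        have ha1 : a ≤ 11 / 10 := by linarith
        have g1 : 9 / 5 * e / (1 + Y) ≤ e / (e ^ 2 + Y) := by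
          rw [div_le_div_iff₀ (by positivity) (by positivity)]
          nlinarith
        have g2 : (2 - a) / (1 + Y) ≤ a / (a ^ 2 + Y) := by
          rw [div_le_div_iff₀ (by positivity) (by positivity)]
          nlinarith [mul_nonneg hY (sub_nonneg.2 h), mul_nonneg (sub_nonneg.2 h) (sub_nonneg.2 h),
            mul_nonneg ha0.le (mul_nonneg (sub_nonneg.2 h) (sub_nonneg.2 h))]
        calc 1 / (10269 / 10000 + Y) ≤ (1 / 2 * (9 / 5 * e) + (2 - a)) / (1 + Y) := by
              rw [div_le_div_iff₀ (by positivity) (by positivity)]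
              nlinarith
          _ = 1 / 2 * (9 / 5 * e / (1 + Y)) + (2 - a) / (1 + Y) := by ring
          _ ≤ _ := by gcongr
  unfold stechkinPair
  linarith

end

section

open Filter Topology Metric ComplexConjugate

open Complex (digamma)

open scoped ArithmeticFunction.vonMangoldt

lemma hasSum_vonMangoldt_cos {σ : ℝ} (hs : 1 < σ) (τ : ℝ) :
    HasSum (fun n : ℕ => Λ n * (n : ℝ) ^ (-σ) * Real.cos (τ * Real.log n))
      (LSeries (fun n : ℕ => (Λ n : ℂ)) (σ + τ * Complex.I)).re := by
  have h := (ArithmeticFunction.LSeriesSummable_vonMangoldt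
    (s := (σ + τ * Complex.I : ℂ)) (by simpa using hs)).hasSum
  have h2 := Complex.hasSum_re h
  have e : (fun n : ℕ => Λ n * (n : ℝ) ^ (-σ) * Real.cos (τ * Real.log n)) =
      fun n => (LSeries.term (fun n : ℕ => (Λ n : ℂ)) (σ + τ * Complex.I : ℂ) n).re := funext fun n => ?_
  · rw [e]
    exact h2
  rcases Nat.eq_zero_or_pos n with rfl | hn
  · simp
  · have hn' : (n : ℂ) ≠ 0 := by exact_mod_cast hn.ne'
    rw [LSeries.term_of_ne_zero hn.ne', Real.rpow_neg n.cast_nonneg, div_eq_mul_inv,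
      ← Complex.cpow_neg, neg_add, Complex.cpow_add _ _ hn']
    have e1 : ((n : ℂ) ^ (-σ : ℂ)) = (((n : ℝ) ^ (-σ) : ℝ) : ℂ) := by
      rw [Complex.ofReal_cpow n.cast_nonneg]; simp
    have e2 : ((n : ℂ) ^ (-(τ * Complex.I) : ℂ)) =
        Complex.exp ((-(τ * Real.log n) : ℝ) * Complex.I) := by
      rw [Complex.cpow_def_of_ne_zero hn', ← Complex.natCast_log]
      congr 1
      push_cast
      ring
    rw [e1, e2, ← mul_assoc, ← Complex.ofReal_mul, Complex.re_ofReal_mul,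
      Complex.exp_ofReal_mul_I_re, Real.cos_neg, Real.rpow_neg n.cast_nonneg]

/-- The nonnegative Dirichlet coefficients of Stechkin's combination. -/
noncomputable def stechkinCoeff (η : ℝ) (n : ℕ) : ℝ :=
  Λ n * (n : ℝ) ^ (-(1 + η)) - 50 / 113 * (Λ n * (n : ℝ) ^ (-(163 / 100 : ℝ)))

lemma stechkinCoeff_nonneg {η : ℝ} (hη : η ≤ 63 / 100) (n : ℕ) : 0 ≤ stechkinCoeff η n := by
  unfold stechkinCoeff
  rcases Nat.eq_zero_or_pos n with rfl | hn
  · simp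
  · have h1 : (n : ℝ) ^ (-(163 / 100 : ℝ)) ≤ (n : ℝ) ^ (-(1 + η)) :=
      Real.rpow_le_rpow_of_exponent_le (by exact_mod_cast hn) (by linarith)
    have h2 : (0 : ℝ) ≤ (n : ℝ) ^ (-(163 / 100 : ℝ)) := by positivity
    have h3 : 0 ≤ Λ n := ArithmeticFunction.vonMangoldt_nonneg
    have h4 := mul_le_mul_of_nonneg_left h1 h3
    have h5 := mul_nonneg h3 h2
    linarith

/-- Stechkin's combination of real parts of the negated logarithmic derivative of zeta on two vertical
lines. -/
noncomputable def stechkinF (η τ : ℝ) : ℝ :=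
  (LSeries (fun n : ℕ => (Λ n : ℂ)) ((1 + η : ℝ) + τ * Complex.I)).re -
    50 / 113 * (LSeries (fun n : ℕ => (Λ n : ℂ)) ((163 / 100 : ℝ) + τ * Complex.I)).re

lemma hasSum_stechkinF {η : ℝ} (hη : 0 < η) (τ : ℝ) :
    HasSum (fun n : ℕ => stechkinCoeff η n * Real.cos (τ * Real.log n)) (stechkinF η τ) := by
  have h := (hasSum_vonMangoldt_cos (σ := 1 + η) (by linarith) τ).sub
    ((hasSum_vonMangoldt_cos (σ := 163 / 100) (by norm_num) τ).mul_left (50 / 113))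
  have e : (fun n : ℕ => stechkinCoeff η n * Real.cos (τ * Real.log n)) = fun n : ℕ =>
      Λ n * (n : ℝ) ^ (-(1 + η)) * Real.cos (τ * Real.log n) -
        50 / 113 * (Λ n * (n : ℝ) ^ (-(163 / 100 : ℝ)) * Real.cos (τ * Real.log n)) := by
    funext n
    unfold stechkinCoeff
    ring
  rw [e]
  exact h

lemma hasSum_xiOrder_mirror {F : ℂ → ℝ} {a : ℝ} (h : HasSum (fun ρ => (xiOrder ρ : ℝ) * F ρ) a) :
    HasSum (fun ρ => (xiOrder ρ : ℝ) * F (1 - conj ρ)) a := by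
  have h1 := summable_xiOrder_one_sub h.summable
  have h2 := summable_xiOrder_conj (F := fun ρ => F (1 - ρ)) h1
  have h3 := h2.hasSum
  rwa [tsum_xiOrder_conj fun ρ => F (1 - ρ), tsum_xiOrder_one_sub, h.tsum_eq] at h3

lemma stechkinPair_mirror (η β y : ℝ) : stechkinPair η (1 - β) y = stechkinPair η β y := by
  unfold stechkinPair
  rw [show 1 + η - (1 - β) = η + β by ring, show η + (1 - β) = 1 + η - β by ring,
    show 163 / 100 - (1 - β) = 63 / 100 + β by ring, show 63 / 100 + (1 - β) = 163 / 100 - β by ring]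
  ring

lemma hasSum_stechkinPair {η : ℝ} (hη : 0 < η) (τ : ℝ) :
    HasSum (fun ρ : ℂ => (xiOrder ρ : ℝ) * stechkinPair η ρ.re (τ - ρ.im))
      (2 * ((logDeriv riemannXi ((1 + η : ℝ) + τ * Complex.I)).re -
        50 / 113 * (logDeriv riemannXi ((163 / 100 : ℝ) + τ * Complex.I)).re)) := by
  have h1 := summable_xiOrder_re_sub (s := ((1 + η : ℝ) + τ * Complex.I)) (by simp; linarith)
  have h2 := summable_xiOrder_re_sub (s := ((163 / 100 : ℝ) + τ * Complex.I)) (by simp; norm_num)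
  have h3 := hasSum_xiOrder_mirror h1
  have h4 := hasSum_xiOrder_mirror h2
  have h := (h1.add h3).sub ((h2.add h4).mul_left (50 / 113))
  have e : (fun ρ : ℂ => (xiOrder ρ : ℝ) * stechkinPair η ρ.re (τ - ρ.im)) = fun ρ =>
      (xiOrder ρ : ℝ) * (1 / (((1 + η : ℝ) + τ * Complex.I) - ρ)).re +
        (xiOrder ρ : ℝ) * (1 / (((1 + η : ℝ) + τ * Complex.I) - (1 - conj ρ))).re -
      50 / 113 * ((xiOrder ρ : ℝ) * (1 / (((163 / 100 : ℝ) + τ * Complex.I) - ρ)).re +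
        (xiOrder ρ : ℝ) * (1 / (((163 / 100 : ℝ) + τ * Complex.I) - (1 - conj ρ))).re) := by
    funext ρ
    simp only [one_div_sub_re]
    have r1 (a : ℝ) : ((a : ℂ) + τ * Complex.I).re = a := by simp
    have r2 (a : ℝ) : ((a : ℂ) + τ * Complex.I).im = τ := by simp
    have r3 : (1 - conj ρ).re = 1 - ρ.re := by simp
    have r4 : (1 - conj ρ).im = ρ.im := by simp
    rw [r1, r1, r2, r2, r3, r4]
    unfold stechkinPair
    rw [show 1 + η - (1 - ρ.re) = η + ρ.re by ring,
      show 163 / 100 - (1 - ρ.re) = 63 / 100 + ρ.re by ring]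
    ring
  rw [e]
  rw [two_mul, sub_add_sub_comm, ← mul_add]
  exact h

lemma stechkinF_eq {η : ℝ} (hη : 0 < η) (τ : ℝ) :
    stechkinF η τ = η / (η ^ 2 + τ ^ 2) -
      50 / 113 * (63 / 100 / ((63 / 100) ^ 2 + τ ^ 2)) +
      ((digamma (((3 + η) / 2 : ℝ) + (τ / 2 : ℝ) * Complex.I)).re / 2 -
        25 / 113 * (digamma ((363 / 200 : ℝ) + (τ / 2 : ℝ) * Complex.I)).re -
        63 / 226 * Real.log Real.pi) -
      1 / 2 * ∑' ρ : ℂ, (xiOrder ρ : ℝ) * stechkinPair η ρ.re (τ - ρ.im) := by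
  have key (σ : ℝ) (hσ : 1 < σ) : (LSeries (fun n : ℕ => (Λ n : ℂ)) (σ + τ * Complex.I)).re =
      (σ - 1) / ((σ - 1) ^ 2 + τ ^ 2) - Real.log Real.pi / 2 +
      (digamma ((σ / 2 + 1 : ℝ) + (τ / 2 : ℝ) * Complex.I)).re / 2 -
      (logDeriv riemannXi (σ + τ * Complex.I)).re := by
    have h := congrArg Complex.re (LSeries_vonMangoldt_eq (s := (σ + τ * Complex.I)) (by simpa using hσ))
    rw [h, Complex.sub_re, Complex.add_re, Complex.sub_re, one_div_sub_re]
    have e1 : (σ + τ * Complex.I : ℂ) / 2 + 1 = (σ / 2 + 1 : ℝ) + (τ / 2 : ℝ) * Complex.I := by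
      push_cast
      ring
    have e2 : ((Real.log Real.pi : ℂ) / 2).re = Real.log Real.pi / 2 := by
      rw [← Complex.ofReal_ofNat, ← Complex.ofReal_div, Complex.ofReal_re]
    have e3 (z : ℂ) : (z / 2).re = z.re / 2 := by
      rw [← Complex.ofReal_ofNat, Complex.div_ofReal_re]
    rw [e1, e2, e3]
    simp
  rw [(hasSum_stechkinPair hη τ).tsum_eq]
  unfold stechkinF
  rw [key _ (by linarith), key _ (by norm_num)]
  rw [show (1 + η) / 2 + 1 = (3 + η) / 2 by ring, show (163 / 100 : ℝ) / 2 + 1 = 363 / 200 by norm_num,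
    show 1 + η - 1 = η by ring, show (163 / 100 : ℝ) - 1 = 63 / 100 by norm_num]
  ring

lemma stechkinF_le_sub_tsum {η τ l : ℝ} (hη : 0 < η) (hη' : η ≤ 1 / 10) (hl : 5 ≤ l)
    (hτ : Real.log |τ| - 9 / 5 ≤ l) :
    stechkinF η τ ≤ η / (η ^ 2 + τ ^ 2) -
      50 / 113 * (63 / 100 / ((63 / 100) ^ 2 + τ ^ 2)) + 63 / 226 * l -
      1 / 2 * ∑' ρ : ℂ, (xiOrder ρ : ℝ) * stechkinPair η ρ.re (τ - ρ.im) := by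
  rw [stechkinF_eq hη]
  have := digamma_combination_le (x := (3 + η) / 2) (y := τ / 2) (l := l) (by linarith)
    (by linarith) hl (by rwa [abs_div, abs_two, mul_div_cancel₀ _ two_ne_zero])
  linarith

lemma xiOrder_mul_stechkinPair_nonneg {η : ℝ} (hη : 0 < η) (hη' : η ≤ 1 / 10) (ρ : ℂ) (y : ℝ) :
    0 ≤ (xiOrder ρ : ℝ) * stechkinPair η ρ.re y := by
  by_cases h : xiOrder ρ = 0
  · simp [h]
  · have h1 := xiOrder_re_mem h
    exact mul_nonneg (Nat.cast_nonneg _) (stechkinPair_nonneg hη hη' h1.1 h1.2 y)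

lemma stechkinF_le {η τ l : ℝ} (hη : 0 < η) (hη' : η ≤ 1 / 10) (hl : 5 ≤ l)
    (hτ : Real.log |τ| - 9 / 5 ≤ l) :
    stechkinF η τ ≤ η / (η ^ 2 + τ ^ 2) + 63 / 226 * l := by
  have h1 := stechkinF_le_sub_tsum hη hη' hl hτ
  have h2 : 0 ≤ ∑' ρ : ℂ, (xiOrder ρ : ℝ) * stechkinPair η ρ.re (τ - ρ.im) :=
    tsum_nonneg fun ρ => xiOrder_mul_stechkinPair_nonneg hη hη' ρ _
  have h3 : 0 ≤ 50 / 113 * (63 / 100 / ((63 / 100) ^ 2 + τ ^ 2)) := by positivity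
  linarith

lemma stechkinF_zero_le {η : ℝ} (hη : 0 < η) (hη' : η ≤ 1 / 10) :
    stechkinF η 0 ≤ 1 / η - 7 / 10 := by
  rw [stechkinF_eq hη]
  have h2 : 0 ≤ ∑' ρ : ℂ, (xiOrder ρ : ℝ) * stechkinPair η ρ.re (0 - ρ.im) :=
    tsum_nonneg fun ρ => xiOrder_mul_stechkinPair_nonneg hη hη' ρ _
  have h3 := (digamma_re_bounds (x := (3 + η) / 2) (by linarith)).2
  have h4 := (digamma_re_bounds (x := 163 / 200) (by norm_num)).1
  rw [show ((163 / 200 + 1 : ℝ)) = 363 / 200 by norm_num] at h4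
  have h5 := Real.one_sub_inv_le_log_of_pos (x := 163 / 200) (by norm_num)
  have h6 : Real.log ((3 + η) / 2) ≤ 9 / 20 := by
    have := log_le_of_pow_le (a := 31 / 20) (by norm_num) 9 20 (by norm_num) (by norm_num)
    exact (Real.log_le_log (y := 31 / 20) (by linarith) (by linarith)).trans (by exact_mod_cast this)
  have h7 := le_log_pi
  have h8 : η / (η ^ 2 + 0 ^ 2) = 1 / η := by
    field_simp
    ring
  rw [h8]
  have e (x : ℝ) : ((x : ℝ) : ℂ) + ((0 / 2 : ℝ) : ℂ) * Complex.I = x := by simp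
  rw [e, e]
  generalize ∑' ρ : ℂ, (xiOrder ρ : ℝ) * stechkinPair η ρ.re (0 - ρ.im) = D0 at *
  generalize (digamma ((3 + η) / 2 : ℝ)).re = D1 at *
  generalize (digamma (363 / 200 : ℝ)).re = D2 at *
  norm_num at h5 ⊢
  linarith

lemma stechkinF_le_sub_sum {η τ l : ℝ} (hη : 0 < η) (hη' : η ≤ 1 / 10) (hl : 5 ≤ l)
    (hτ : Real.log |τ| - 9 / 5 ≤ l) (hτ1 : 1 ≤ |τ|) (S : Finset ℂ) (hS : ∀ ρ ∈ S, 1 / 2 < ρ.re) :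
    stechkinF η τ ≤ 63 / 226 * l -
      ∑ ρ ∈ S, (xiOrder ρ : ℝ) * stechkinPair η ρ.re (τ - ρ.im) := by
  classical
  have h1 := stechkinF_le_sub_tsum hη hη' hl hτ
  have h2 : η / (η ^ 2 + τ ^ 2) ≤ 50 / 113 * (63 / 100 / ((63 / 100) ^ 2 + τ ^ 2)) := by
    have : 1 ≤ τ ^ 2 := by
      rw [← sq_abs]
      nlinarith
    rw [← mul_div_assoc, div_le_div_iff₀ (by positivity) (by positivity)]
    nlinarith
  have hinj : Function.Injective fun ρ : ℂ => 1 - conj ρ := fun a b hab => by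
    simpa only [sub_right_inj, (starRingEnd ℂ).injective.eq_iff] using hab
  have hdisj : Disjoint S (S.image fun ρ => 1 - conj ρ) := by
    rw [Finset.disjoint_left]
    intro ρ hρ hρ'
    obtain ⟨r, hr, rfl⟩ := Finset.mem_image.1 hρ'
    have a := hS _ hρ
    have b := hS _ hr
    simp at a
    linarith
  have h3 := (hasSum_stechkinPair hη τ).summable.sum_le_tsum
    (S ∪ S.image fun ρ => 1 - conj ρ) fun ρ _ => xiOrder_mul_stechkinPair_nonneg hη hη' ρ _
  rw [Finset.sum_union hdisj, Finset.sum_image hinj.injOn] at h3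
  have h4 : ∑ ρ ∈ S, (xiOrder (1 - conj ρ) : ℝ) *
      stechkinPair η (1 - conj ρ).re (τ - (1 - conj ρ).im) =
      ∑ ρ ∈ S, (xiOrder ρ : ℝ) * stechkinPair η ρ.re (τ - ρ.im) := by
    refine Finset.sum_congr rfl fun ρ _ => ?_
    rw [xiOrder_one_sub, xiOrder_conj]
    simp [stechkinPair_mirror]
  rw [h4] at h3
  linarith

end

section

open Filter Topology Metric ComplexConjugate

lemma trig_polynomial_nonneg (s p θ : ℝ) :
    0 ≤ (3 + 4 * (s ^ 2 + 2 * p) + 8 * p ^ 2) + (12 * s + 16 * s * p) * Real.cos θ +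
      (4 + 4 * (s ^ 2 + 2 * p)) * Real.cos (2 * θ) + 4 * s * Real.cos (3 * θ) +
      Real.cos (4 * θ) := by
  have h4 : Real.cos (4 * θ) = 2 * (2 * Real.cos θ ^ 2 - 1) ^ 2 - 1 := by
    rw [show 4 * θ = 2 * (2 * θ) by ring, Real.cos_two_mul, Real.cos_two_mul]
  rw [h4, Real.cos_three_mul, Real.cos_two_mul]
  have := sq_nonneg (Real.cos θ ^ 2 + s * Real.cos θ + p)
  linarith

lemma stechkinF_combination_nonneg {η : ℝ} (hη : 0 < η) (hη' : η ≤ 1 / 10) (s p γ : ℝ) :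
    0 ≤ (3 + 4 * (s ^ 2 + 2 * p) + 8 * p ^ 2) * stechkinF η 0 +
      (12 * s + 16 * s * p) * stechkinF η γ +
      (4 + 4 * (s ^ 2 + 2 * p)) * stechkinF η (2 * γ) + 4 * s * stechkinF η (3 * γ) +
      stechkinF η (4 * γ) := by
  have h := (((((hasSum_stechkinF hη 0).mul_left (3 + 4 * (s ^ 2 + 2 * p) + 8 * p ^ 2)).add
    ((hasSum_stechkinF hη γ).mul_left (12 * s + 16 * s * p))).add
    ((hasSum_stechkinF hη (2 * γ)).mul_left (4 + 4 * (s ^ 2 + 2 * p)))).add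
    ((hasSum_stechkinF hη (3 * γ)).mul_left (4 * s))).add (hasSum_stechkinF hη (4 * γ))
  rw [← h.tsum_eq]
  refine tsum_nonneg fun n => ?_
  have h1 := stechkinCoeff_nonneg (η := η) (by linarith) n
  have h2 := mul_nonneg h1 (trig_polynomial_nonneg s p (γ * Real.log n))
  rw [zero_mul, Real.cos_zero, mul_assoc 2 γ, mul_assoc 3 γ, mul_assoc 4 γ]
  linarith

/-- An explicit zero-free region. -/
theorem zero_free_region {ρ : ℂ} (hρ : xiOrder ρ ≠ 0) {l : ℝ} (hl : 5 ≤ l)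
    (hγ : Real.log |ρ.im| - 9 / 5 ≤ l) : 41 / 400 ≤ (1 - ρ.re) * l := by
  by_cases hβ : ρ.re ≤ 1 / 2
  · nlinarith
  push Not at hβ
  have hre := xiOrder_re_mem hρ
  have hγ1 := one_lt_abs_im_of_xiOrder hρ
  have hl0 : 0 < l := by linarith
  obtain ⟨η, hη⟩ : ∃ η, η = 42 / 125 / l := ⟨_, rfl⟩
  have hηl : η * l = 42 / 125 := by rw [hη]; field_simp
  have hη0 : 0 < η := by rw [hη]; positivity
  have hη1 : η ≤ 1 / 10 := by
    rw [hη, div_le_iff₀ hl0]; linarith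
  have h := stechkinF_combination_nonneg hη0 hη1 (1189 / 1000) (252 / 1000) ρ.im
  have f0 := stechkinF_zero_le hη0 hη1
  have f1 := stechkinF_le_sub_sum hη0 hη1 hl hγ hγ1.le {ρ} (by simpa using hβ)
  rw [Finset.sum_singleton, sub_self] at f1
  have f1' := le_stechkinPair_zero hη0 hη1 hre.1 hre.2
  have f1'' := stechkinPair_nonneg hη0 hη1 hre.1 hre.2 0
  have f1''' : stechkinPair η ρ.re 0 ≤ xiOrder ρ * stechkinPair η ρ.re 0 :=
    le_mul_of_one_le_left f1'' (by exact_mod_cast Nat.one_le_iff_ne_zero.2 hρ)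
  have fj (j : ℝ) (hj : 1 ≤ j) : stechkinF η (j * ρ.im) ≤ 63 / 226 * (l + Real.log j) := by
    have hj0 : 0 ≤ Real.log j := Real.log_nonneg hj
    have := stechkinF_le_sub_sum (τ := j * ρ.im) (l := l + Real.log j) hη0 hη1 (by linarith)
      (by
        rw [abs_mul, abs_of_pos (by linarith : 0 < j), Real.log_mul (by linarith) (by linarith)]
        linarith)
      (by rw [abs_mul, abs_of_pos (by linarith : 0 < j)]; nlinarith) ∅ (by simp)
    simpa using this
  have f2 := fj 2 (by norm_num)
  have f3 := fj 3 (by norm_num)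
  have f4 := fj 4 (by norm_num)
  have l2 := Real.log_two_lt_d9
  have l3 : Real.log 3 ≤ 11 / 10 := by
    exact_mod_cast log_le_of_pow_le (a := 3) (by norm_num) 11 10 (by norm_num) (by norm_num)
  have l4 : Real.log 4 = 2 * Real.log 2 := by
    rw [show (4 : ℝ) = 2 ^ 2 by norm_num, Real.log_pow]
    norm_num
  rw [l4] at f4
  have hinv : 1 / η = l / (42 / 125) := by rw [hη]; field_simp
  rw [hinv] at f0
  have hδ : 0 < η + (1 - ρ.re) := by linarith
  have key : (19062 / 1000) * (1 / (η + (1 - ρ.re))) ≤ (4345 / 100) * l := by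
    norm_num at h
    nlinarith
  rw [mul_one_div, div_le_iff₀ hδ] at key
  nlinarith

end

section

open Filter Topology Metric ComplexConjugate

lemma stechkinF_quadratic_nonneg {η : ℝ} (hη : 0 < η) (hη' : η ≤ 1 / 10) {ι : Type*}
    (S : Finset ι) (m γ : ι → ℝ) (t : ℝ) :
    0 ≤ t ^ 2 * stechkinF η 0 + 2 * t * ∑ j ∈ S, m j * stechkinF η (γ j) +
      ∑ j ∈ S, ∑ k ∈ S, m j * m k * stechkinF η (γ j - γ k) := by
  have h := (((hasSum_stechkinF hη 0).mul_left (t ^ 2)).add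
    ((hasSum_sum (s := S) fun j _ => (hasSum_stechkinF hη (γ j)).mul_left (m j)).mul_left
      (2 * t))).add
    (hasSum_sum (s := S) fun j _ => hasSum_sum (s := S) fun k _ =>
      (hasSum_stechkinF hη (γ j - γ k)).mul_left (m j * m k))
  rw [← h.tsum_eq]
  refine tsum_nonneg fun n => ?_
  have h1 := stechkinCoeff_nonneg (η := η) (by linarith) n
  generalize stechkinCoeff η n = A at *
  generalize Real.log n = u
  have e1 : ∑ j ∈ S, ∑ k ∈ S, m j * m k * (A * Real.cos ((γ j - γ k) * u)) =
      A * ((∑ j ∈ S, m j * Real.cos (γ j * u)) ^ 2 + (∑ j ∈ S, m j * Real.sin (γ j * u)) ^ 2) := by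
    rw [sq, sq, Finset.sum_mul_sum, Finset.sum_mul_sum, ← Finset.sum_add_distrib, Finset.mul_sum]
    refine Finset.sum_congr rfl fun j _ => ?_
    rw [← Finset.sum_add_distrib, Finset.mul_sum]
    refine Finset.sum_congr rfl fun k _ => ?_
    rw [sub_mul, Real.cos_sub]
    ring
  have e2 : ∑ j ∈ S, m j * (A * Real.cos (γ j * u)) = A * ∑ j ∈ S, m j * Real.cos (γ j * u) := by
    rw [Finset.mul_sum]
    exact Finset.sum_congr rfl fun j _ => by ring
  rw [e1, e2, zero_mul, Real.cos_zero]
  have := mul_nonneg h1 (add_nonneg (sq_nonneg (t + ∑ j ∈ S, m j * Real.cos (γ j * u)))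
    (sq_nonneg (∑ j ∈ S, m j * Real.sin (γ j * u))))
  linarith

lemma le_stechkinPair_of_le {η β X : ℝ} (hη : 0 < η) (hη' : η ≤ 1 / 10) (h0 : 0 < β) (h1 : β < 1)
    (hX : X ≤ 3 * η) (hβ : 1 - X ≤ β) (y : ℝ) :
    1 / 2 * (η / (η + X)) * (η / (η ^ 2 + y ^ 2)) ≤ stechkinPair η β y := by
  refine le_trans ?_ (le_stechkinPair hη hη' h0 h1 (by linarith) y)
  rw [mul_assoc]
  gcongr
  have he : η ≤ 1 + η - β := by linarith
  have he' : 1 + η - β ≤ η + X := by linarith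
  generalize 1 + η - β = e at *
  have hX0 : 0 < η + X := by linarith
  have he0 : 0 < e := by linarith
  rw [div_mul_div_comm, div_le_div_iff₀ (by positivity) (by positivity)]
  have a1 : η ^ 2 * e * e ≤ η ^ 2 * e * (η + X) := by gcongr
  have a2 : y ^ 2 * (η * η) ≤ y ^ 2 * (e * (η + X)) := by
    gcongr
    linarith
  linarith

/-- An explicit zero-density estimate near the line `re = 1`. -/
theorem zero_density {S : Finset ℂ} {η X l α : ℝ} (hη : 0 < η) (hη' : η ≤ 1 / 10) (hX0 : 0 < X)
    (hX : X ≤ 3 * η) (hl : 5 ≤ l)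
    (hS : ∀ ρ ∈ S, xiOrder ρ ≠ 0 ∧ 0 < ρ.im ∧ Real.log ρ.im - 9 / 5 ≤ l ∧ 1 - X ≤ ρ.re)
    (hα : α = η * (1 / (η + X) - 13 / 200 - 63 / 226 * l)) (hα0 : 0 < α)
    (hD : 0 < α ^ 2 - η * (63 / 226 * l)) :
    ∑ ρ ∈ S, (xiOrder ρ : ℝ) ≤ 1 / (α ^ 2 - η * (63 / 226 * l)) := by
  set N := ∑ ρ ∈ S, (xiOrder ρ : ℝ) with hN
  have hN0 : 0 ≤ N := Finset.sum_nonneg fun _ _ => Nat.cast_nonneg _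
  have hηX : 0 < η + X := by linarith
  set b := η / (η + X) with hb
  have hb0 : 0 < b := by positivity
  have hαb : α = b - η * (13 / 200 + 63 / 226 * l) := by
    rw [hα, hb]; ring
  have hαb' : α ≤ b := by
    rw [hαb]; nlinarith
  have hfac : 0 < 1 / (η + X) - 13 / 200 - 63 / 226 * l := by
    rw [hα] at hα0
    exact (mul_pos_iff_of_pos_left hη).1 hα0
  by_cases ht : N * α * b < 1
  · have h1 : α ^ 2 - η * (63 / 226 * l) ≤ α * b := by nlinarith
    calc N ≤ 1 / (α * b) := by
          rw [le_div_iff₀ (by positivity)]; linarith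
      _ ≤ _ := one_div_le_one_div_of_le hD h1
  push Not at ht
  obtain ⟨t, htdef⟩ : ∃ t, t = N * α := ⟨_, rfl⟩
  have ht0 : 0 ≤ t := by rw [htdef]; positivity
  have hpos := stechkinF_quadratic_nonneg hη hη' S (fun ρ => (xiOrder ρ : ℝ)) (fun ρ => ρ.im) t
  have f0 : stechkinF η 0 ≤ 1 / η := by linarith [stechkinF_zero_le hη hη']
  set Q := ∑ j ∈ S, ∑ k ∈ S, (xiOrder j : ℝ) * xiOrder k * stechkinPair η k.re (j.im - k.im) with hQ
  set P := ∑ j ∈ S, ∑ k ∈ S, (xiOrder j : ℝ) * xiOrder k * (η / (η ^ 2 + (j.im - k.im) ^ 2)) with hP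
  have f1 : ∑ j ∈ S, (xiOrder j : ℝ) * stechkinF η j.im ≤ N * (63 / 226 * l) - Q := by
    rw [hN, hQ, Finset.sum_mul, ← Finset.sum_sub_distrib]
    refine Finset.sum_le_sum fun j hj => ?_
    obtain ⟨h1, h2, h3, h4⟩ := hS j hj
    have h5 := stechkinF_le_sub_sum (τ := j.im) hη hη' hl (by rwa [abs_of_pos h2])
      (one_lt_abs_im_of_xiOrder h1).le S fun ρ hρ => by
        have := (hS ρ hρ).2.2.2
        linarith
    have h6 := mul_le_mul_of_nonneg_left h5 (Nat.cast_nonneg (α := ℝ) (xiOrder j))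
    rw [mul_sub, Finset.mul_sum] at h6
    refine h6.trans (le_of_eq ?_)
    congr 1
    exact Finset.sum_congr rfl fun k _ => by ring
  have f2 : ∑ j ∈ S, ∑ k ∈ S, (xiOrder j : ℝ) * xiOrder k * stechkinF η (j.im - k.im) ≤
      P + N ^ 2 * (63 / 226 * l) := by
    rw [hP, sq N, hN, Finset.sum_mul_sum, Finset.sum_mul, ← Finset.sum_add_distrib]
    refine Finset.sum_le_sum fun j hj => ?_
    rw [Finset.sum_mul, ← Finset.sum_add_distrib]
    refine Finset.sum_le_sum fun k hk => ?_
    rw [← mul_add]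
    refine mul_le_mul_of_nonneg_left (stechkinF_le hη hη' hl ?_) (by positivity)
    obtain ⟨-, j2, j3, -⟩ := hS j hj
    obtain ⟨-, k2, k3, -⟩ := hS k hk
    rcases eq_or_ne (j.im - k.im) 0 with h0 | h0
    · rw [h0]; simp; linarith
    · rcases le_total j.im k.im with hjk | hjk
      · have := Real.log_le_log (abs_pos.2 h0) (show |j.im - k.im| ≤ k.im by
          rw [abs_of_nonpos (by linarith)]; linarith)
        linarith
      · have := Real.log_le_log (abs_pos.2 h0) (show |j.im - k.im| ≤ j.im by
          rw [abs_of_nonneg (by linarith)]; linarith)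
        linarith
  have hm (j : ℂ) (hj : j ∈ S) : (xiOrder j : ℝ) ≤ (xiOrder j : ℝ) * xiOrder j :=
    le_mul_of_one_le_left (Nat.cast_nonneg _)
      (by exact_mod_cast Nat.one_le_iff_ne_zero.2 (hS j hj).1)
  have hc0 : 0 ≤ 1 / 2 * (1 / (η + X)) - 13 / 200 := by linarith
  have f3 : 1 / 2 * b * P + N * (1 / 2 * (1 / (η + X)) - 13 / 200) ≤ Q := by
    rw [hP, hN, hQ, Finset.mul_sum, Finset.sum_mul, ← Finset.sum_add_distrib]
    refine Finset.sum_le_sum fun j hj => ?_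
    have hjre := xiOrder_re_mem (hS j hj).1
    have key (k : ℂ) (hk : k ∈ S) : 1 / 2 * b * ((xiOrder j : ℝ) * xiOrder k *
        (η / (η ^ 2 + (j.im - k.im) ^ 2))) ≤
        (xiOrder j : ℝ) * xiOrder k * stechkinPair η k.re (j.im - k.im) := by
      have hkre := xiOrder_re_mem (hS k hk).1
      have := le_stechkinPair_of_le hη hη' hkre.1 hkre.2 hX (hS k hk).2.2.2 (j.im - k.im)
      have := mul_le_mul_of_nonneg_left this
        (by positivity : (0 : ℝ) ≤ (xiOrder j : ℝ) * xiOrder k)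
      refine le_trans (le_of_eq ?_) this
      ring
    classical
    rw [Finset.mul_sum, ← Finset.add_sum_erase _ _ hj, ← Finset.add_sum_erase S
      (fun k => (xiOrder j : ℝ) * xiOrder k * stechkinPair η k.re (j.im - k.im)) hj]
    have h1 := Finset.sum_le_sum fun k (hk : k ∈ S.erase j) => key k (Finset.mem_of_mem_erase hk)
    have h2 : 1 / 2 * b * ((xiOrder j : ℝ) * xiOrder j * (η / (η ^ 2 + (j.im - j.im) ^ 2))) +
        (xiOrder j : ℝ) * (1 / 2 * (1 / (η + X)) - 13 / 200) ≤
        (xiOrder j : ℝ) * xiOrder j * stechkinPair η j.re (j.im - j.im) := by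
      rw [sub_self]
      have h3 := le_stechkinPair_zero hη hη' hjre.1 hjre.2
      have h4 : 1 / (η + X) ≤ 1 / (η + (1 - j.re)) :=
        one_div_le_one_div_of_le (by linarith) (by linarith [(hS j hj).2.2.2])
      have h5 : 1 / 2 * b * (η / (η ^ 2 + 0 ^ 2)) = 1 / 2 * (1 / (η + X)) := by
        rw [hb]; field_simp; ring
      calc _ = (xiOrder j : ℝ) * xiOrder j * (1 / 2 * b * (η / (η ^ 2 + 0 ^ 2))) +
            (xiOrder j : ℝ) * (1 / 2 * (1 / (η + X)) - 13 / 200) := by ring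
        _ ≤ (xiOrder j : ℝ) * xiOrder j * (1 / 2 * (1 / (η + X))) +
            (xiOrder j : ℝ) * xiOrder j * (1 / 2 * (1 / (η + X)) - 13 / 200) := by
          rw [h5]
          gcongr
          exact hm j hj
        _ = (xiOrder j : ℝ) * xiOrder j * (1 / (η + X) - 13 / 200) := by ring
        _ ≤ _ := by
          gcongr
          linarith
    linarith
  have f4 : N / η ≤ P := by
    rw [hP, hN, Finset.sum_div]
    refine Finset.sum_le_sum fun j hj => ?_
    refine le_trans ?_ (Finset.single_le_sum (f := fun k => (xiOrder j : ℝ) * xiOrder k *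
      (η / (η ^ 2 + (j.im - k.im) ^ 2))) (fun k _ => by positivity) hj)
    have : η / (η ^ 2 + (j.im - j.im) ^ 2) = 1 / η := by
      rw [sub_self]; field_simp; ring
    simp only [this]
    rw [mul_one_div]
    gcongr
    exact hm j hj
  have g1 : 0 ≤ t ^ 2 * (1 / η) + 2 * t * (N * (63 / 226 * l) -
      (1 / 2 * b * P + N * (1 / 2 * (1 / (η + X)) - 13 / 200))) + (P + N ^ 2 * (63 / 226 * l)) := by
    refine hpos.trans ?_
    gcongr
    linarith
  have g2 : (t * b - 1) * (N / η) ≤ (t * b - 1) * P :=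
    mul_le_mul_of_nonneg_left f4 (by rw [htdef]; linarith)
  have g3 : 0 ≤ t ^ 2 * (1 / η) + 2 * t * (N * (63 / 226 * l) -
      N * (1 / 2 * (1 / (η + X)) - 13 / 200)) - (t * b - 1) * (N / η) +
      N ^ 2 * (63 / 226 * l) := by linarith
  have g4 : 0 ≤ N * (1 - N * (α ^ 2 - η * (63 / 226 * l))) := by
    have e : N * (1 - N * (α ^ 2 - η * (63 / 226 * l))) = η * (t ^ 2 * (1 / η) +
        2 * t * (N * (63 / 226 * l) -
      N * (1 / 2 * (1 / (η + X)) - 13 / 200)) - (t * b - 1) * (N / η) +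
      N ^ 2 * (63 / 226 * l)) := by
      rw [htdef, hα, hb]
      field_simp
      ring
    rw [e]
    positivity
  have hNpos : 0 < N := by
    rcases hN0.lt_or_eq with h | h
    · exact h
    · rw [← h] at ht; norm_num at ht
  rw [le_div_iff₀ hD]
  have := (mul_nonneg_iff_of_pos_left hNpos).1 g4
  linarith

end

section

open Filter Topology Metric ComplexConjugate MeasureTheory Set

/-- `F` is the Laplace transform of `H` on the line `re s = 2`, where `H` is continuous on
`[0, ∞)`, vanishes at `0` and grows at most like `C exp (3 v / 2)`. -/
structure IsLaplacePair (H : ℝ → ℂ) (F : ℂ → ℂ) (C : ℝ) : Prop where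
  cont : ContinuousOn H (Ici 0)
  zero : H 0 = 0
  bound : ∀ v, 0 ≤ v → ‖H v‖ ≤ C * Real.exp (3 / 2 * v)
  transform : ∀ s : ℂ, s.re = 2 → ∫ v in Ioi (0 : ℝ), H v * Complex.exp (-s * v) = F s

namespace IsLaplacePair

variable {H H' : ℝ → ℂ} {F F' : ℂ → ℂ} {C C' : ℝ}

lemma norm_mul_exp_le (h : IsLaplacePair H F C) {s : ℂ} (hs : s.re = 2) {v : ℝ} (hv : 0 ≤ v) :
    ‖H v * Complex.exp (-s * v)‖ ≤ C * Real.exp (-(1 / 2) * v) := by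
  rw [norm_mul, Complex.norm_exp]
  have e1 : (-s * v).re = -2 * v := by simp [hs]
  rw [e1]
  calc _ ≤ C * Real.exp (3 / 2 * v) * Real.exp (-2 * v) := by
        gcongr
        exact h.bound v hv
    _ = _ := by rw [mul_assoc, ← Real.exp_add]; ring_nf

lemma integrableOn (h : IsLaplacePair H F C) {s : ℂ} (hs : s.re = 2) :
    IntegrableOn (fun v : ℝ => H v * Complex.exp (-s * v)) (Ioi 0) := by
  refine Integrable.mono' ((integrableOn_exp_mul_Ioi (a := -(1 / 2)) (by norm_num) 0).const_mul C)
    ?_ ?_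
  · refine ContinuousOn.aestronglyMeasurable ?_ measurableSet_Ioi
    exact (h.cont.mono Ioi_subset_Ici_self).mul (by fun_prop)
  · refine (ae_restrict_iff' measurableSet_Ioi).2 (Eventually.of_forall fun v hv => ?_)
    exact h.norm_mul_exp_le hs (le_of_lt hv)

lemma add (h : IsLaplacePair H F C) (h' : IsLaplacePair H' F' C') :
    IsLaplacePair (fun v => H v + H' v) (fun s => F s + F' s) (C + C') where
  cont := h.cont.add h'.cont
  zero := by simp [h.zero, h'.zero]
  bound v hv := (norm_add_le _ _).trans (by
    rw [add_mul]; exact add_le_add (h.bound v hv) (h'.bound v hv))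
  transform s hs := by
    simp only [add_mul]
    rw [integral_add (h.integrableOn hs) (h'.integrableOn hs), h.transform s hs, h'.transform s hs]

lemma const_mul (h : IsLaplacePair H F C) (c : ℂ) :
    IsLaplacePair (fun v => c * H v) (fun s => c * F s) (‖c‖ * C) where
  cont := continuousOn_const.mul h.cont
  zero := by simp [h.zero]
  bound v hv := by
    rw [norm_mul, mul_assoc]
    exact mul_le_mul_of_nonneg_left (h.bound v hv) (norm_nonneg c)
  transform s hs := by
    simp only [mul_assoc]
    rw [integral_const_mul, h.transform s hs]

lemma tsum {ι : Type*} [Countable ι] {H : ι → ℝ → ℂ} {F : ι → ℂ → ℂ} {C : ι → ℝ}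
    (h : ∀ i, IsLaplacePair (H i) (F i) (C i)) (hC : Summable C) :
    IsLaplacePair (fun v => ∑' i, H i v) (fun s => ∑' i, F i s) (∑' i, C i) where
  cont := by
    have h1 : ContinuousOn (fun v : ℝ => ∑' i, Complex.exp (-(3 / 2) * v) * H i v) (Ici 0) := by
      refine continuousOn_tsum (fun i => ContinuousOn.mul (by fun_prop) (h i).cont) hC ?_
      intro i v hv
      rw [norm_mul, Complex.norm_exp]
      have e1 : (-(3 / 2) * (v : ℂ)).re = -(3 / 2 * v) := by
        simp [Complex.mul_re]
      rw [e1]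
      calc _ ≤ Real.exp (-(3 / 2 * v)) * (C i * Real.exp (3 / 2 * v)) := by
            gcongr
            exact (h i).bound v hv
        _ = C i := by rw [mul_left_comm, ← Real.exp_add]; simp
    have h2 : ContinuousOn (fun v : ℝ => Complex.exp (3 / 2 * v) *
        ∑' i, Complex.exp (-(3 / 2) * v) * H i v) (Ici 0) := ContinuousOn.mul (by fun_prop) h1
    refine h2.congr fun v _ => ?_
    simp only
    rw [tsum_mul_left, ← mul_assoc, ← Complex.exp_add]
    simp
  zero := by simp [(h _).zero]
  bound v hv := by
    rw [← tsum_mul_right]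
    exact tsum_of_norm_bounded (hC.mul_right _).hasSum fun i => (h i).bound v hv
  transform s hs := by
    have h1 := hasSum_integral_of_summable_integral_norm (μ := volume.restrict (Ioi (0 : ℝ)))
      (F := fun i v => H i v * Complex.exp (-s * v)) (fun i => (h i).integrableOn hs) (by
      refine Summable.of_nonneg_of_le (fun i => by positivity) (fun i => ?_)
        (hC.mul_right (∫ v in Ioi (0 : ℝ), Real.exp (-(1 / 2) * v)))
      rw [← integral_const_mul]
      refine setIntegral_mono_on ((h i).integrableOn hs).norm
        ((integrableOn_exp_mul_Ioi (a := -(1 / 2)) (by norm_num) 0).const_mul _)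
        measurableSet_Ioi fun v hv => ?_
      exact (h i).norm_mul_exp_le hs (le_of_lt hv))
    have h2 := h1.tsum_eq
    simp only [fun i => (h i).transform s hs] at h2
    rw [h2]
    refine integral_congr_ae (Eventually.of_forall fun v => ?_)
    simp only
    rw [tsum_mul_right]

/-- Uniqueness of Laplace transforms. -/
theorem eq_zero (h : IsLaplacePair H F C) (hF : ∀ s : ℂ, s.re = 2 → F s = 0) {v : ℝ}
    (hv : 0 ≤ v) : H v = 0 := by
  set f : ℝ → ℂ := fun v => H (max v 0) * Complex.exp (-2 * v) with hf
  have hf0 (v : ℝ) (hv : v ≤ 0) : f v = 0 := by simp [hf, max_eq_right hv, h.zero]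
  have hf1 (v : ℝ) (hv : v ∈ Ioi (0 : ℝ)) : f v = H v * Complex.exp (-2 * v) := by
    rw [hf]
    simp only
    rw [max_eq_left (le_of_lt hv)]
  have hcont : Continuous f := by
    refine Continuous.mul ?_ (by fun_prop)
    have : ContinuousOn (fun v : ℝ => H (max v 0)) univ :=
      h.cont.comp (by fun_prop) fun v _ => le_max_right v 0
    exact continuousOn_univ.1 this
  have hsupp : ∀ g : ℝ → ℂ, Function.support (fun v => g v * f v) ⊆ Ioi 0 := by
    intro g v hv
    by_contra hv'
    exact hv (by simp [hf0 v (not_lt.1 hv')])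
  have hf_int : Integrable f := by
    have h2 : IntegrableOn f (Ioi 0) :=
      (h.integrableOn (s := 2) (by simp)).congr_fun (fun v hv => (hf1 v hv).symm) measurableSet_Ioi
    refine (integrableOn_iff_integrable_of_support_subset ?_).1 h2
    simpa using hsupp fun _ => 1
  have hft : FourierTransform.fourier f = 0 := by
    funext w
    rw [Real.fourier_real_eq_integral_exp_smul]
    simp only [smul_eq_mul, Pi.zero_apply]
    rw [← setIntegral_eq_integral_of_forall_compl_eq_zero (s := Ioi 0)]
    · rw [← hF (2 + 2 * Real.pi * w * Complex.I) (by simp), ← h.transform _ (by simp)]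
      refine setIntegral_congr_fun measurableSet_Ioi fun v hv => ?_
      rw [hf1 v hv, mul_left_comm, ← Complex.exp_add]
      congr 2
      push_cast
      ring
    · intro v hv
      rw [hf0 v (not_lt.1 hv), mul_zero]
  have h3 := hcont.fourierInv_fourier_eq hf_int (by rw [hft]; exact integrable_zero _ _ _)
  rw [hft] at h3
  have h4 : f v = 0 := by
    rw [← h3, Real.fourierInv_eq]
    simp
  have h5 : f v = H v * Complex.exp (-2 * v) := by
    rw [hf]
    simp only
    rw [max_eq_left hv]
  rw [h5] at h4
  simpa using h4

end IsLaplacePair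

end

section

open Filter Topology Metric ComplexConjugate MeasureTheory Set

open Complex (digamma)

open scoped ArithmeticFunction.vonMangoldt

lemma tendsto_pow_mul_cexp_neg {s : ℂ} (hs : 1 ≤ s.re) (n : ℕ) :
    Tendsto (fun v : ℝ => (v : ℂ) ^ n * Complex.exp (-s * v)) atTop (𝓝 0) := by
  refine squeeze_zero_norm' ?_ (Real.tendsto_pow_mul_exp_neg_atTop_nhds_zero n)
  filter_upwards [eventually_ge_atTop 0] with v hv
  rw [norm_mul, norm_pow, Complex.norm_real, Real.norm_of_nonneg hv, Complex.norm_exp]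
  gcongr
  have : (-s * v).re = -(s.re * v) := by simp
  rw [this]
  nlinarith

/-- The truncated quadratic `(v - c)₊² / 2`. -/
noncomputable def posSq (c v : ℝ) : ℂ := ((max (v - c) 0 ^ 2 / 2 : ℝ) : ℂ)

lemma isLaplacePair_posSq {c : ℝ} (hc : 0 ≤ c) :
    IsLaplacePair (posSq c) (fun s => Complex.exp (-s * c) / s ^ 3) (Real.exp (-(3 / 2) * c)) := by
  have hcont : Continuous (posSq c) := by
    unfold posSq
    fun_prop
  have hbound : ∀ v, 0 ≤ v → ‖posSq c v‖ ≤ Real.exp (-(3 / 2) * c) * Real.exp (3 / 2 * v) := by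
    intro v _
    unfold posSq
    rw [Complex.norm_real, Real.norm_of_nonneg (by positivity), ← Real.exp_add]
    rcases le_total (v - c) 0 with h | h
    · rw [max_eq_right h]
      norm_num
      positivity
    · rw [max_eq_left h]
      have h1 := Real.quadratic_le_exp_of_nonneg h
      have h2 := Real.exp_le_exp.2 (show v - c ≤ -(3 / 2) * c + 3 / 2 * v by linarith)
      linarith
  refine ⟨hcont.continuousOn, by simp [posSq, max_eq_right (neg_nonpos.2 hc)], hbound,
    fun s hs => ?_⟩
  have hs0 : s ≠ 0 := fun h => by simp [h] at hs
  have hf_int : IntegrableOn (fun v : ℝ => posSq c v * Complex.exp (-s * v)) (Ioi 0) :=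
    Integrable.mono' ((integrableOn_exp_mul_Ioi (a := -(1 / 2)) (by norm_num) 0).const_mul
      (Real.exp (-(3 / 2) * c)))
      ((hcont.mul (by fun_prop)).aestronglyMeasurable)
      ((ae_restrict_iff' measurableSet_Ioi).2 (Eventually.of_forall fun v hv => by
        rw [norm_mul, Complex.norm_exp]
        have e1 : (-s * v).re = -2 * v := by simp [hs]
        rw [e1]
        calc _ ≤ Real.exp (-(3 / 2) * c) * Real.exp (3 / 2 * v) * Real.exp (-2 * v) := by
              gcongr
              exact hbound v (le_of_lt hv)
          _ = _ := by rw [mul_assoc, ← Real.exp_add (3 / 2 * v)]; ring_nf))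
  rw [setIntegral_eq_of_subset_of_forall_sdiff_eq_zero measurableSet_Ioi
    (Ioi_subset_Ioi hc) fun v hv => by
      have : v ≤ c := not_lt.1 hv.2
      simp [posSq, max_eq_right (sub_nonpos.2 this)]]
  set A : ℝ → ℂ := fun v => -(Complex.exp (-s * c) *
    (((v - c : ℝ) : ℂ) ^ 2 * Complex.exp (-s * (v - c : ℝ)) * (1 / (2 * s)) +
      ((v - c : ℝ) : ℂ) ^ 1 * Complex.exp (-s * (v - c : ℝ)) * (1 / s ^ 2) +
      ((v - c : ℝ) : ℂ) ^ 0 * Complex.exp (-s * (v - c : ℝ)) * (1 / s ^ 3))) with hA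
  have hderiv : ∀ v : ℝ, HasDerivAt A (((v - c : ℝ) : ℂ) ^ 2 / 2 * Complex.exp (-s * v)) v := by
    intro v
    have h1 : HasDerivAt (fun v : ℝ => ((v - c : ℝ) : ℂ)) 1 v := by
      exact_mod_cast ((hasDerivAt_id v).sub_const c).ofReal_comp
    have h2 := (h1.const_mul (-s)).cexp
    have h3 := (((((h1.pow 2).mul h2).mul_const (1 / (2 * s))).add
      (((h1.pow 1).mul h2).mul_const (1 / s ^ 2))).add
      (((h1.pow 0).mul h2).mul_const (1 / s ^ 3))).const_mul (Complex.exp (-s * c))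
    refine h3.neg.congr_deriv ?_
    have e : Complex.exp (-s * v) = Complex.exp (-s * c) * Complex.exp (-s * (v - c : ℝ)) := by
      rw [← Complex.exp_add]; congr 1; push_cast; ring
    simp only [Pi.pow_apply]
    rw [e]
    field_simp
    push_cast
    ring
  have htend : Tendsto A atTop (𝓝 0) := by
    have hs1 : 1 ≤ s.re := by rw [hs]; norm_num
    have hsub : Tendsto (fun v : ℝ => v - c) atTop atTop := tendsto_atTop_add_const_right _ _ tendsto_id
    have h1 := ((((((tendsto_pow_mul_cexp_neg hs1 2).comp hsub).mul_const (1 / (2 * s))).add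
      (((tendsto_pow_mul_cexp_neg hs1 1).comp hsub).mul_const (1 / s ^ 2))).add
      (((tendsto_pow_mul_cexp_neg hs1 0).comp hsub).mul_const (1 / s ^ 3))).const_mul
        (Complex.exp (-s * c))).neg
    simpa [hA] using h1
  have heq : ∀ v ∈ Ioi c, posSq c v * Complex.exp (-s * v) =
      ((v - c : ℝ) : ℂ) ^ 2 / 2 * Complex.exp (-s * v) := by
    intro v hv
    have hv' : 0 ≤ v - c := sub_nonneg.2 (le_of_lt hv)
    unfold posSq
    rw [max_eq_left hv']
    push_cast
    rfl
  rw [setIntegral_congr_fun measurableSet_Ioi heq, integral_Ioi_of_hasDerivAt_of_tendsto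
    (hderiv c).continuousAt.continuousWithinAt (fun v _ => hderiv v)
    (((hf_int.mono_set (Ioi_subset_Ioi hc)).congr_fun heq measurableSet_Ioi)) htend]
  simp only [hA]
  simp [div_eq_mul_inv]

/-- The second order Taylor remainder of the exponential, `exp (a v) - 1 - a v`. -/
noncomputable def expRem (a : ℂ) (v : ℝ) : ℂ := Complex.exp (a * v) - 1 - a * v

lemma isLaplacePair_expRem {a : ℂ} (ha : a.re ≤ 1) :
    IsLaplacePair (expRem a) (fun s => a ^ 2 / (s ^ 2 * (s - a))) (2 + ‖a‖) := by
  have hcont : Continuous (expRem a) := by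
    unfold expRem
    fun_prop
  have hbound : ∀ v, 0 ≤ v → ‖expRem a v‖ ≤ (2 + ‖a‖) * Real.exp (3 / 2 * v) := by
    intro v hv
    unfold expRem
    have h1 : ‖Complex.exp (a * v)‖ ≤ Real.exp (3 / 2 * v) := by
      rw [Complex.norm_exp]
      have : (a * v).re = a.re * v := by simp
      rw [this]
      gcongr
      linarith
    have h2 : v ≤ Real.exp (3 / 2 * v) := by
      have := Real.add_one_le_exp (3 / 2 * v)
      linarith
    have h3 : 1 ≤ Real.exp (3 / 2 * v) := Real.one_le_exp (by positivity)
    have h4 : ‖a * (v : ℂ)‖ ≤ ‖a‖ * Real.exp (3 / 2 * v) := by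
      rw [norm_mul, Complex.norm_real, Real.norm_of_nonneg hv]
      gcongr
    have h5 := norm_sub_le (Complex.exp (a * v) - 1) (a * v)
    have h6 := norm_sub_le (Complex.exp (a * v)) 1
    rw [norm_one] at h6
    linarith
  refine ⟨hcont.continuousOn, by simp [expRem], hbound, fun s hs => ?_⟩
  have hs0 : s ≠ 0 := fun h => by simp [h] at hs
  have hsa : s - a ≠ 0 := fun h => by
    have := congrArg Complex.re h
    simp [hs] at this
    linarith
  have hf_int : IntegrableOn (fun v : ℝ => expRem a v * Complex.exp (-s * v)) (Ioi 0) :=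
    Integrable.mono' ((integrableOn_exp_mul_Ioi (a := -(1 / 2)) (by norm_num) 0).const_mul
      (2 + ‖a‖))
      ((hcont.mul (by fun_prop)).aestronglyMeasurable)
      ((ae_restrict_iff' measurableSet_Ioi).2 (Eventually.of_forall fun v hv => by
        rw [norm_mul, Complex.norm_exp]
        have e1 : (-s * v).re = -2 * v := by simp [hs]
        rw [e1]
        calc _ ≤ (2 + ‖a‖) * Real.exp (3 / 2 * v) * Real.exp (-2 * v) := by
              gcongr
              exact hbound v (le_of_lt hv)
          _ = _ := by rw [mul_assoc, ← Real.exp_add (3 / 2 * v)]; ring_nf))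
  set A : ℝ → ℂ := fun v => -((v : ℂ) ^ 0 * Complex.exp (-(s - a) * v) * (1 / (s - a))) +
    (v : ℂ) ^ 0 * Complex.exp (-s * v) * (1 / s + a / s ^ 2) +
    (v : ℂ) ^ 1 * Complex.exp (-s * v) * (a / s) with hA
  have hderiv : ∀ v : ℝ, HasDerivAt A (expRem a v * Complex.exp (-s * v)) v := by
    intro v
    have h1 : HasDerivAt (fun v : ℝ => (v : ℂ)) 1 v := by
      exact_mod_cast (hasDerivAt_id v).ofReal_comp
    have h2 := (h1.const_mul (-s)).cexp
    have h2' := (h1.const_mul (-(s - a))).cexp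
    have h3 := (((((h1.pow 0).mul h2').mul_const (1 / (s - a))).neg).add
      (((h1.pow 0).mul h2).mul_const (1 / s + a / s ^ 2))).add
      (((h1.pow 1).mul h2).mul_const (a / s))
    refine h3.congr_deriv ?_
    have e : Complex.exp (-(s - a) * v) = Complex.exp (a * v) * Complex.exp (-s * v) := by
      rw [← Complex.exp_add]; congr 1; ring
    unfold expRem
    simp only [Pi.pow_apply]
    rw [e]
    field_simp
    push_cast
    ring
  have htend : Tendsto A atTop (𝓝 0) := by
    have hs1 : 1 ≤ s.re := by rw [hs]; norm_num
    have hs2 : 1 ≤ (s - a).re := by rw [Complex.sub_re, hs]; linarith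
    have h1 := ((((tendsto_pow_mul_cexp_neg hs2 0).mul_const (1 / (s - a))).neg).add
      ((tendsto_pow_mul_cexp_neg hs1 0).mul_const (1 / s + a / s ^ 2))).add
      ((tendsto_pow_mul_cexp_neg hs1 1).mul_const (a / s))
    simpa [hA] using h1
  rw [integral_Ioi_of_hasDerivAt_of_tendsto
    (hderiv 0).continuousAt.continuousWithinAt (fun v _ => hderiv v) hf_int htend]
  simp only [hA]
  simp
  field_simp
  ring

end

section

open Filter Topology Metric ComplexConjugate MeasureTheory Set

open Complex (digamma)

open scoped ArithmeticFunction.vonMangoldt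

/-- The nontrivial zeros of the Riemann zeta function. -/
abbrev XiZero : Type := {ρ : ℂ // xiOrder ρ ≠ 0}

instance : Countable XiZero := by
  have h := summable_xiOrder_div_norm_sq.countable_support
  refine (h.mono fun ρ hρ => ?_).to_subtype
  have hρ0 : ρ ≠ 0 := fun h0 => by
    have := xiOrder_re_mem hρ
    simp [h0] at this
  simp only [Function.mem_support]
  have : (xiOrder ρ : ℝ) ≠ 0 := by exact_mod_cast hρ
  positivity

lemma XiZero.tsum_eq {E : Type*} [NormedAddCommGroup E] (f : ℂ → E)
    (hf : ∀ ρ, xiOrder ρ = 0 → f ρ = 0) : ∑' ρ : XiZero, f ρ = ∑' ρ, f ρ :=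
  tsum_subtype_eq_of_support_subset (s := {ρ | xiOrder ρ ≠ 0}) fun ρ hρ h => hρ (hf ρ h)

lemma XiZero.summable {f : ℂ → ℝ} (hf : Summable f) : Summable fun ρ : XiZero => f ρ :=
  hf.subtype _

lemma XiZero.one_lt_norm (ρ : XiZero) : 1 < ‖(ρ : ℂ)‖ :=
  (one_lt_abs_im_of_xiOrder ρ.2).trans_le (Complex.abs_im_le_norm _)

lemma isLaplacePair_vonMangoldt :
    IsLaplacePair (fun v => ∑' n : ℕ, (Λ n : ℂ) * posSq (Real.log n) v)
      (fun s => ∑' n : ℕ, (Λ n : ℂ) * (Complex.exp (-s * (Real.log n : ℝ)) / s ^ 3))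
      (∑' n : ℕ, ‖(Λ n : ℂ)‖ * Real.exp (-(3 / 2) * Real.log n)) := by
  refine IsLaplacePair.tsum (fun n => (isLaplacePair_posSq (Real.log_natCast_nonneg n)).const_mul _) ?_
  have h := (LSeries_vonMangoldt_ofReal (σ := 3 / 2) (by norm_num)).summable
  refine h.congr fun n => ?_
  rcases Nat.eq_zero_or_pos n with rfl | hn
  · simp
  · rw [Complex.norm_real, Real.norm_of_nonneg ArithmeticFunction.vonMangoldt_nonneg,
      Real.rpow_def_of_pos (by exact_mod_cast hn), mul_comm (Real.log n)]

lemma tsum_vonMangoldt_exp (s : ℂ) :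
    ∑' n : ℕ, (Λ n : ℂ) * (Complex.exp (-s * (Real.log n : ℝ)) / s ^ 3) =
      LSeries (fun n : ℕ => (Λ n : ℂ)) s / s ^ 3 := by
  rw [LSeries, ← tsum_div_const]
  refine tsum_congr fun n => ?_
  rcases Nat.eq_zero_or_pos n with rfl | hn
  · simp
  · have hn' : (n : ℂ) ≠ 0 := by exact_mod_cast hn.ne'
    rw [LSeries.term_of_ne_zero hn.ne', mul_div_assoc', div_eq_mul_inv (Λ n : ℂ), ← Complex.cpow_neg,
      Complex.cpow_def_of_ne_zero hn', ← Complex.natCast_log, mul_comm (-s)]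

lemma isLaplacePair_zeros :
    IsLaplacePair (fun v => ∑' ρ : XiZero, (xiOrder ρ / (ρ : ℂ) ^ 3) * expRem ρ v)
      (fun s => ∑' ρ : XiZero, (xiOrder ρ / (ρ : ℂ) ^ 3) * ((ρ : ℂ) ^ 2 / (s ^ 2 * (s - ρ))))
      (∑' ρ : XiZero, ‖(xiOrder ρ / (ρ : ℂ) ^ 3)‖ * (2 + ‖(ρ : ℂ)‖)) := by
  refine IsLaplacePair.tsum (fun ρ =>
    (isLaplacePair_expRem (xiOrder_re_mem ρ.2).2.le).const_mul _) ?_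
  refine Summable.of_nonneg_of_le (fun ρ => by positivity) (fun ρ => ?_)
    ((XiZero.summable summable_xiOrder_div_norm_sq).mul_left 3)
  have h1 := ρ.one_lt_norm
  rw [norm_div, norm_pow, Complex.norm_natCast]
  calc (xiOrder ρ : ℝ) / ‖(ρ : ℂ)‖ ^ 3 * (2 + ‖(ρ : ℂ)‖) ≤
        (xiOrder ρ : ℝ) / ‖(ρ : ℂ)‖ ^ 3 * (3 * ‖(ρ : ℂ)‖) := by
        gcongr; linarith
    _ = _ := by field_simp

/-- The `k`-th trivial zero of the Riemann zeta function. -/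
noncomputable def trivialZero (k : ℕ) : ℂ := -(2 * (k + 1))

lemma norm_trivialZero (k : ℕ) : ‖trivialZero k‖ = 2 * (k + 1) := by
  unfold trivialZero
  rw [norm_neg, norm_mul]
  have : ‖((k : ℂ) + 1)‖ = k + 1 := by
    rw [← Nat.cast_succ, Complex.norm_natCast]; push_cast; rfl
  rw [this]
  norm_num

lemma trivialZero_re (k : ℕ) : (trivialZero k).re = -(2 * (k + 1)) := by
  simp [trivialZero]

lemma trivialZero_ne_zero (k : ℕ) : trivialZero k ≠ 0 := by
  rw [← norm_pos_iff, norm_trivialZero]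
  positivity

lemma isLaplacePair_trivialZeros :
    IsLaplacePair (fun v => ∑' k : ℕ, (1 / trivialZero k ^ 3) * expRem (trivialZero k) v)
      (fun s => ∑' k : ℕ, (1 / trivialZero k ^ 3) *
        (trivialZero k ^ 2 / (s ^ 2 * (s - trivialZero k))))
      (∑' k : ℕ, ‖1 / trivialZero k ^ 3‖ * (2 + ‖trivialZero k‖)) := by
  refine IsLaplacePair.tsum (fun k => (isLaplacePair_expRem (by
    rw [trivialZero_re]; have : (0 : ℝ) ≤ k := k.cast_nonneg; linarith)).const_mul _) ?_
  have hs : Summable fun k : ℕ => 1 / ((k + 1 : ℕ) : ℝ) ^ 2 :=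
    (summable_nat_add_iff 1).2 (Real.summable_one_div_nat_pow.2 (by norm_num : 1 < 2))
  refine Summable.of_nonneg_of_le (fun k => by positivity) (fun k => ?_) hs
  rw [norm_div, norm_pow, norm_one, norm_trivialZero]
  have : (0 : ℝ) ≤ k := k.cast_nonneg
  push_cast
  rw [div_mul_eq_mul_div, div_le_div_iff₀ (by positivity) (by positivity)]
  have : (0 : ℝ) ≤ ((k : ℝ) + 1) ^ 2 := by positivity
  nlinarith

/-- The constant term of the explicit formula. -/
noncomputable def explicitConst : ℂ :=
  -1 - Real.log Real.pi / 2 - Real.eulerMascheroniConstant / 2 - logDeriv riemannXi 0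

theorem explicit_formula {v : ℝ} (hv : 0 ≤ v) :
    ∑' n : ℕ, (Λ n : ℂ) * posSq (Real.log n) v =
      expRem 1 v + explicitConst * posSq 0 v -
        ∑' ρ : XiZero, (xiOrder ρ / (ρ : ℂ) ^ 3) * expRem ρ v -
        ∑' k : ℕ, (1 / trivialZero k ^ 3) * expRem (trivialZero k) v := by
  have h := (((isLaplacePair_vonMangoldt.add
    ((isLaplacePair_expRem (a := 1) (by simp)).const_mul (-1))).add
    ((isLaplacePair_posSq le_rfl).const_mul (-explicitConst))).add isLaplacePair_zeros).add
    isLaplacePair_trivialZeros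
  have h0 := h.eq_zero (fun s hs => ?_) hv
  · linear_combination h0
  have hs1 : 1 < s.re := by rw [hs]; norm_num
  have hs0 : s ≠ 0 := fun h => by simp [h] at hs
  have hs1' : s - 1 ≠ 0 := fun h => by
    have := congrArg Complex.re h
    simp [hs] at this
    linarith
  have e1 : ∑' ρ : XiZero, (xiOrder ρ / (ρ : ℂ) ^ 3) * ((ρ : ℂ) ^ 2 / (s ^ 2 * (s - ρ))) =
      (logDeriv riemannXi s - logDeriv riemannXi 0) / s ^ 3 := by
    rw [logDeriv_riemannXi (riemannXi_ne_zero_of_one_le_re hs1.le), add_sub_cancel_left,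
      ← XiZero.tsum_eq (fun ρ => (xiOrder ρ : ℂ) * (1 / (s - ρ) + 1 / ρ)) (by simp +contextual),
      ← tsum_div_const]
    refine tsum_congr fun ρ => ?_
    have hρ := xiOrder_re_mem ρ.2
    have hρ0 : (ρ : ℂ) ≠ 0 := fun h0 => by simp [h0] at hρ
    have hsρ : s - ρ ≠ 0 := fun h0 => by
      have := congrArg Complex.re h0
      simp [hs] at this
      linarith
    generalize (xiOrder ρ : ℂ) = m
    field_simp
    ring
  have hz : 0 < (s / 2 + 1).re := by
    have : (s / 2 + 1).re = s.re / 2 + 1 := by simp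
    rw [this, hs]
    norm_num
  have e2 : ∑' k : ℕ, (1 / trivialZero k ^ 3) *
        (trivialZero k ^ 2 / (s ^ 2 * (s - trivialZero k))) =
      -((digamma (s / 2 + 1) + Real.eulerMascheroniConstant) / 2 / s ^ 3) := by
    rw [digamma_eq_tsum hz, ← tsum_div_const, ← tsum_div_const, ← tsum_neg]
    refine tsum_congr fun k => ?_
    have ht := trivialZero_ne_zero k
    have hst : s - trivialZero k ≠ 0 := fun h0 => by
      have := congrArg Complex.re h0
      rw [Complex.sub_re, hs, trivialZero_re] at this
      have h2 : (0 : ℝ) ≤ k := k.cast_nonneg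
      simp at this
      linarith
    have hk : (k : ℂ) + 1 = -trivialZero k / 2 := by unfold trivialZero; ring
    have hk' : s / 2 + 1 + k = (s - trivialZero k) / 2 := by unfold trivialZero; ring
    rw [hk, hk']
    field_simp
    ring
  rw [tsum_vonMangoldt_exp s, e1, e2, LSeries_vonMangoldt_eq hs1]
  unfold explicitConst
  simp only [Complex.ofReal_zero, mul_zero, Complex.exp_zero]
  field_simp
  ring

end

section

open Complex (digamma)

open scoped ArithmeticFunction.vonMangoldt

/-- The second difference with step `h`. -/
def secondDiff {E : Type*} [AddCommGroup E] [Module ℝ E] (h : ℝ) (f : ℝ → E) (v : ℝ) : E :=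
  f (v + 2 * h) - (2 : ℝ) • f (v + h) + f v

lemma secondDiff_tsum {ι : Type*} {h v : ℝ} {f : ι → ℝ → ℂ}
    (hf : ∀ w, v ≤ w → Summable fun i => f i w) (hh : 0 ≤ h) :
    secondDiff h (fun w => ∑' i, f i w) v = ∑' i, secondDiff h (f i) v ∧
      Summable fun i => secondDiff h (f i) v := by
  have h0 := (hf v le_rfl).hasSum
  have h1 := (hf (v + h) (by linarith)).hasSum
  have h2 := (hf (v + 2 * h) (by linarith)).hasSum
  have h3 := (h2.sub (h1.const_smul (2 : ℝ))).add h0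
  exact ⟨h3.tsum_eq.symm, h3.summable⟩

lemma secondDiff_expRem (h v : ℝ) (a : ℂ) :
    secondDiff h (expRem a) v = Complex.exp (a * v) * (Complex.exp (a * h) - 1) ^ 2 := by
  have h1 : Complex.exp (a * (v + h : ℝ)) = Complex.exp (a * v) * Complex.exp (a * h) := by
    rw [← Complex.exp_add]; congr 1; push_cast; ring
  have h2 : Complex.exp (a * (v + 2 * h : ℝ)) =
      Complex.exp (a * v) * Complex.exp (a * h) * Complex.exp (a * h) := by
    rw [← Complex.exp_add, ← Complex.exp_add]; congr 1; push_cast; ring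
  unfold secondDiff expRem
  rw [h1, h2, Complex.real_smul]
  push_cast
  ring

lemma secondDiff_posSq (c h v : ℝ) :
    secondDiff h (posSq c) v =
      ((max (v + 2 * h - c) 0 ^ 2 / 2 - 2 * (max (v + h - c) 0 ^ 2 / 2) + max (v - c) 0 ^ 2 / 2 :
        ℝ) : ℂ) := by
  unfold secondDiff posSq
  rw [Complex.real_smul]
  push_cast
  ring

lemma secondDiff_posSq_re_mem {h : ℝ} (hh : 0 ≤ h) (c v : ℝ) :
    0 ≤ (secondDiff h (posSq c) v).re ∧ (secondDiff h (posSq c) v).re ≤ h ^ 2 := by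
  rw [secondDiff_posSq, Complex.ofReal_re]
  rcases max_cases (v + 2 * h - c) 0 with ⟨h1, h1'⟩ | ⟨h1, h1'⟩ <;>
  rcases max_cases (v + h - c) 0 with ⟨h2, h2'⟩ | ⟨h2, h2'⟩ <;>
  rcases max_cases (v - c) 0 with ⟨h3, h3'⟩ | ⟨h3, h3'⟩ <;>
  rw [h1, h2, h3] <;> constructor <;> nlinarith

lemma secondDiff_posSq_of_le {h c v : ℝ} (hh : 0 ≤ h) (hc : c ≤ v) :
    secondDiff h (posSq c) v = ((h ^ 2 : ℝ) : ℂ) := by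
  rw [secondDiff_posSq, max_eq_left (by linarith), max_eq_left (by linarith),
    max_eq_left (by linarith)]
  congr 1
  ring

lemma posSq_eq_zero {c v : ℝ} (h : v ≤ c) : posSq c v = 0 := by
  unfold posSq
  rw [max_eq_right (by linarith)]
  simp

lemma tsum_vonMangoldt_posSq {v u : ℝ} (h : v ≤ u) :
    ∑' n : ℕ, (Λ n : ℂ) * posSq (Real.log n) v =
      ∑ n ∈ Finset.Ioc 0 ⌊Real.exp u⌋₊, (Λ n : ℂ) * posSq (Real.log n) v := by
  refine tsum_eq_sum fun n hn => ?_
  rcases Nat.eq_zero_or_pos n with rfl | h0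
  · simp
  have hn' : ⌊Real.exp u⌋₊ < n := by
    by_contra! h1
    exact hn (Finset.mem_Ioc.2 ⟨h0, h1⟩)
  have h1 : Real.exp u < n := Nat.lt_of_floor_lt hn'
  have h2 : u ≤ Real.log n := by
    rw [Real.le_log_iff_exp_le (by exact_mod_cast h0)]
    exact h1.le
  rw [posSq_eq_zero (h.trans h2), mul_zero]

/-- The left-hand side of the explicit formula. -/
noncomputable def psiTwo (v : ℝ) : ℂ := ∑' n : ℕ, (Λ n : ℂ) * posSq (Real.log n) v

lemma secondDiff_psiTwo {h : ℝ} (hh : 0 ≤ h) (v : ℝ) :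
    (secondDiff h psiTwo v).re = ∑ n ∈ Finset.Ioc 0 ⌊Real.exp (v + 2 * h)⌋₊,
      Λ n * (secondDiff h (posSq (Real.log n)) v).re := by
  unfold secondDiff psiTwo
  rw [tsum_vonMangoldt_posSq (le_refl (v + 2 * h)),
    tsum_vonMangoldt_posSq (show v + h ≤ v + 2 * h by linarith),
    tsum_vonMangoldt_posSq (show v ≤ v + 2 * h by linarith), Finset.smul_sum,
    ← Finset.sum_sub_distrib, ← Finset.sum_add_distrib, Complex.re_sum]
  refine Finset.sum_congr rfl fun n _ => ?_
  simp only [Complex.add_re, Complex.sub_re, Complex.real_smul, Complex.re_ofReal_mul]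
  ring

lemma psi_exp_mul_sq_le {h : ℝ} (hh : 0 ≤ h) (v : ℝ) :
    Chebyshev.psi (Real.exp v) * h ^ 2 ≤ (secondDiff h psiTwo v).re := by
  rw [secondDiff_psiTwo hh, Chebyshev.psi, Finset.sum_mul]
  refine (Finset.sum_le_sum fun n hn => ?_).trans
    (Finset.sum_le_sum_of_subset_of_nonneg (Finset.Ioc_subset_Ioc_right
      (Nat.floor_le_floor (Real.exp_le_exp.2 (by linarith : v ≤ v + 2 * h)))) fun n _ _ =>
        mul_nonneg ArithmeticFunction.vonMangoldt_nonneg (secondDiff_posSq_re_mem hh _ _).1)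
  have hn' := Finset.mem_Ioc.1 hn
  have h1 : Real.log n ≤ v := by
    rw [Real.log_le_iff_le_exp (by exact_mod_cast hn'.1)]
    exact (Nat.cast_le.2 hn'.2).trans (Nat.floor_le (Real.exp_nonneg _))
  rw [secondDiff_posSq_of_le hh h1, Complex.ofReal_re]

lemma le_psi_exp_mul_sq {h : ℝ} (hh : 0 ≤ h) (v : ℝ) :
    (secondDiff h psiTwo v).re ≤ Chebyshev.psi (Real.exp (v + 2 * h)) * h ^ 2 := by
  rw [secondDiff_psiTwo hh, Chebyshev.psi, Finset.sum_mul]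
  exact Finset.sum_le_sum fun n _ => mul_le_mul_of_nonneg_left
    (secondDiff_posSq_re_mem hh _ _).2 ArithmeticFunction.vonMangoldt_nonneg

lemma xiOrder_div_im_sq_le (ρ : XiZero) :
    (xiOrder ρ : ℝ) / (ρ : ℂ).im ^ 2 ≤ 101 * (xiOrder ρ * (1 / (10 ^ 2 + (ρ : ℂ).im ^ 2))) := by
  have h1 := one_lt_abs_im_of_xiOrder ρ.2
  have h2 : 1 < (ρ : ℂ).im ^ 2 := by rw [← sq_abs]; nlinarith
  have h3 : 1 / (ρ : ℂ).im ^ 2 ≤ 101 * (1 / (10 ^ 2 + (ρ : ℂ).im ^ 2)) := by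
    rw [mul_one_div, div_le_div_iff₀ (by linarith) (by linarith)]
    linarith
  calc (xiOrder ρ : ℝ) / (ρ : ℂ).im ^ 2 = xiOrder ρ * (1 / (ρ : ℂ).im ^ 2) := by ring
    _ ≤ xiOrder ρ * (101 * (1 / (10 ^ 2 + (ρ : ℂ).im ^ 2))) := by gcongr
    _ = _ := by ring

lemma summable_xiOrder_div_im_sq : Summable fun ρ : XiZero => (xiOrder ρ : ℝ) / (ρ : ℂ).im ^ 2 :=
  ((XiZero.summable (summable_xiOrder_div_sq_add_im_sq (T := 10) (by norm_num))).mul_left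
    101).of_nonneg_of_le (fun ρ => by positivity) xiOrder_div_im_sq_le

lemma tsum_xiOrder_div_im_sq_le : ∑' ρ : XiZero, (xiOrder ρ : ℝ) / (ρ : ℂ).im ^ 2 ≤ 15 := by
  have h1 := XiZero.summable (summable_xiOrder_div_sq_add_im_sq (T := 10) (by norm_num))
  have h2 := summable_xiOrder_div_im_sq.tsum_le_tsum xiOrder_div_im_sq_le (h1.mul_left 101)
  rw [tsum_mul_left, XiZero.tsum_eq (fun ρ : ℂ => (xiOrder ρ : ℝ) * (1 / (10 ^ 2 + ρ.im ^ 2)))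
    (by simp +contextual)] at h2
  have h3 := tsum_xiOrder_div_sq_add_im_sq_le (T := 10) le_rfl
  have h4 : Real.log 10 ≤ 5 / 2 := by
    have := log_le_of_pow_le (a := 10) (by norm_num) 5 2 (by norm_num) (by norm_num)
    exact_mod_cast this
  linarith

lemma abs_explicitConst_re_le : |explicitConst.re| ≤ 20 := by
  have e : explicitConst.re =
      -1 - Real.log Real.pi / 2 - Real.eulerMascheroniConstant / 2 - (logDeriv riemannXi 0).re := by
    unfold explicitConst
    have : (-1 - Real.log Real.pi / 2 - Real.eulerMascheroniConstant / 2 : ℂ) =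
      ((-1 - Real.log Real.pi / 2 - Real.eulerMascheroniConstant / 2 : ℝ) : ℂ) := by push_cast; ring
    rw [this, Complex.sub_re, Complex.ofReal_re]
  have h1 : |∑' ρ : ℂ, (xiOrder ρ : ℝ) * (1 / ρ).re| ≤ 15 := by
    rw [← XiZero.tsum_eq (fun ρ => (xiOrder ρ : ℝ) * (1 / ρ).re) (by simp +contextual)]
    rw [← Real.norm_eq_abs]
    refine (tsum_of_norm_bounded summable_xiOrder_div_im_sq.hasSum fun ρ => ?_).trans
      tsum_xiOrder_div_im_sq_le
    have hρ := xiOrder_re_mem ρ.2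
    have hi := one_lt_abs_im_of_xiOrder ρ.2
    have h2 : 1 < (ρ : ℂ).im ^ 2 := by rw [← sq_abs]; nlinarith
    rw [norm_mul, Real.norm_natCast, one_div, Complex.inv_re, Real.norm_eq_abs, abs_div,
      abs_of_pos hρ.1, abs_of_nonneg (Complex.normSq_nonneg _), div_eq_mul_one_div (xiOrder ρ : ℝ)]
    refine mul_le_mul_of_nonneg_left ?_ (by positivity)
    have h3 : (ρ : ℂ).im ^ 2 ≤ Complex.normSq ρ := by rw [Complex.normSq_apply]; nlinarith
    exact div_le_div₀ zero_le_one hρ.2.le (by linarith) h3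
  have h2 := le_log_pi
  have h3 := Real.log_le_sub_one_of_pos Real.pi_pos
  have h4 := Real.pi_lt_four
  have h5 := Real.one_half_lt_eulerMascheroniConstant
  have h6 := Real.eulerMascheroniConstant_lt_two_thirds
  rw [abs_le] at h1
  rw [e, re_logDeriv_riemannXi_zero, abs_le]
  constructor <;> linarith

lemma summable_zeros_expRem {w : ℝ} (hw : 0 ≤ w) :
    Summable fun ρ : XiZero => (xiOrder ρ / (ρ : ℂ) ^ 3) * expRem ρ w := by
  refine Summable.of_norm_bounded
    (summable_xiOrder_div_im_sq.mul_right (3 * Real.exp (3 / 2 * w))) fun ρ => ?_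
  have h1 := ρ.one_lt_norm
  have hi := one_lt_abs_im_of_xiOrder ρ.2
  have h2 := Complex.abs_im_le_norm (ρ : ℂ)
  have h4 : (ρ : ℂ).im ^ 2 ≤ ‖(ρ : ℂ)‖ ^ 2 := by rw [← sq_abs]; gcongr
  have h5 : 0 < (ρ : ℂ).im ^ 2 := by rw [← sq_abs]; nlinarith
  rw [norm_mul, norm_div, norm_pow, Complex.norm_natCast]
  calc (xiOrder ρ : ℝ) / ‖(ρ : ℂ)‖ ^ 3 * ‖expRem ρ w‖
      ≤ (xiOrder ρ : ℝ) / ‖(ρ : ℂ)‖ ^ 3 * ((3 * ‖(ρ : ℂ)‖) * Real.exp (3 / 2 * w)) := by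
        gcongr
        refine ((isLaplacePair_expRem (xiOrder_re_mem ρ.2).2.le).bound w hw).trans ?_
        gcongr
        linarith
    _ = (xiOrder ρ : ℝ) / ‖(ρ : ℂ)‖ ^ 2 * (3 * Real.exp (3 / 2 * w)) := by field_simp
    _ ≤ _ := by gcongr

lemma summable_one_div_succ_sq : Summable fun k : ℕ => 1 / ((k : ℝ) + 1) ^ 2 := by
  have := (summable_nat_add_iff 1).2 (Real.summable_one_div_nat_pow.2 (by norm_num : 1 < 2))
  exact this.congr fun k => by push_cast; rfl

lemma summable_trivialZeros_expRem {w : ℝ} (hw : 0 ≤ w) :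
    Summable fun k : ℕ => (1 / trivialZero k ^ 3) * expRem (trivialZero k) w := by
  refine Summable.of_norm_bounded
    (summable_one_div_succ_sq.mul_right (Real.exp (3 / 2 * w))) fun k => ?_
  have hk : (0 : ℝ) ≤ k := k.cast_nonneg
  have h1 : (trivialZero k).re ≤ 1 := by rw [trivialZero_re]; linarith
  rw [norm_mul, norm_div, norm_pow, norm_one, norm_trivialZero]
  calc 1 / (2 * ((k : ℝ) + 1)) ^ 3 * ‖expRem (trivialZero k) w‖
      ≤ 1 / (2 * ((k : ℝ) + 1)) ^ 3 * ((8 * (k + 1)) * Real.exp (3 / 2 * w)) := by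
        gcongr
        refine ((isLaplacePair_expRem h1).bound w hw).trans ?_
        rw [norm_trivialZero]
        gcongr
        linarith
    _ = _ := by field_simp; ring

lemma norm_tsum_trivialZeros_le {h v : ℝ} (hh : 0 ≤ h) (hv : 0 ≤ v) :
    ‖∑' k : ℕ, (1 / trivialZero k ^ 3) * (Complex.exp (trivialZero k * v) *
      (Complex.exp (trivialZero k * h) - 1) ^ 2)‖ ≤ 1 := by
  have e1 : ∀ (k : ℕ) {u : ℝ}, 0 ≤ u → ∃ r : ℝ, 0 ≤ r ∧ r ≤ 1 ∧
      Complex.exp (trivialZero k * u) = r := fun k u hu => by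
    refine ⟨Real.exp (-(2 * (k + 1)) * u), by positivity, Real.exp_le_one_iff.2 ?_, ?_⟩
    · have : (0 : ℝ) ≤ (2 * (k + 1)) * u := by positivity
      linarith
    · unfold trivialZero; push_cast; rfl
  have h2 : HasSum (fun k : ℕ => 1 / ((k : ℝ) + 1) ^ 2) (Real.pi ^ 2 / 6) := by
    have := (hasSum_nat_add_iff' 1).2 hasSum_zeta_two
    simpa using this
  refine (tsum_of_norm_bounded (h2.mul_left (1 / 8)) fun k => ?_).trans ?_
  · obtain ⟨r, hr0, hr1, hr⟩ := e1 k hv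
    obtain ⟨t, ht0, ht1, ht⟩ := e1 k hh
    have hk : (0 : ℝ) ≤ k := k.cast_nonneg
    rw [hr, ht, norm_mul, norm_div, norm_pow, norm_one, norm_trivialZero]
    have : ‖((r : ℂ) * ((t : ℂ) - 1) ^ 2)‖ ≤ 1 := by
      rw [show ((r : ℂ) * ((t : ℂ) - 1) ^ 2) = ((r * (t - 1) ^ 2 : ℝ) : ℂ) by push_cast; rfl,
        Complex.norm_real, Real.norm_of_nonneg (by positivity)]
      nlinarith [sq_nonneg (t - 1)]
    calc _ ≤ 1 / (2 * ((k : ℝ) + 1)) ^ 3 * 1 := by gcongr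
      _ = 1 / 8 * (1 / ((k : ℝ) + 1) ^ 3) := by field_simp; ring
      _ ≤ _ := by
        gcongr
        · linarith
        · norm_num
  · have := Real.pi_pos
    have := Real.pi_lt_four
    nlinarith

/-- The weight with which a zero enters the smoothed explicit formula for `psi (exp u)`. -/
noncomputable def zeroWeight (h u : ℝ) (ρ : ℂ) : ℝ :=
  Real.exp (ρ.re * u) * min (1 / |ρ.im|) (4 / (h ^ 2 * |ρ.im| ^ 3))

lemma norm_exp_sub_one_le (z : ℂ) (hz : 0 ≤ z.re) :
    ‖Complex.exp z - 1‖ ≤ 2 * Real.exp z.re ∧ ‖Complex.exp z - 1‖ ≤ ‖z‖ * Real.exp z.re := by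
  constructor
  · refine (norm_sub_le _ _).trans ?_
    rw [Complex.norm_exp, norm_one]
    linarith [Real.one_le_exp hz]
  · have h := Convex.norm_image_sub_le_of_norm_hasDerivWithin_le
      (f := Complex.exp) (f' := Complex.exp) (s := {w : ℂ | w.re ≤ z.re}) (C := Real.exp z.re)
      (x := 0) (y := z) (fun w _ => (Complex.hasDerivAt_exp w).hasDerivWithinAt)
      (fun w hw => by rw [Complex.norm_exp]; exact Real.exp_le_exp.2 hw)
      (convex_halfSpace_re_le z.re) (by simpa using hz) (by simp)
    rw [Complex.exp_zero, sub_zero] at h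
    linarith

lemma norm_secondDiff_zero_le {h v : ℝ} (hh : 0 < h) (ρ : XiZero) :
    ‖(xiOrder ρ / (ρ : ℂ) ^ 3) * (Complex.exp (ρ * v) * (Complex.exp (ρ * h) - 1) ^ 2)‖ ≤
      h ^ 2 * (xiOrder ρ * zeroWeight h (v + 2 * h) ρ) := by
  have hβ := xiOrder_re_mem ρ.2
  have hi : 0 < |(ρ : ℂ).im| := zero_lt_one.trans (one_lt_abs_im_of_xiOrder ρ.2)
  have hn := Complex.abs_im_le_norm (ρ : ℂ)
  have hn0 : 0 < ‖(ρ : ℂ)‖ := hi.trans_le hn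
  have hre : ((ρ : ℂ) * h).re = (ρ : ℂ).re * h := Complex.re_mul_ofReal _ _
  obtain ⟨h1, h2⟩ := norm_exp_sub_one_le ((ρ : ℂ) * h) (by rw [hre]; exact mul_nonneg hβ.1.le hh.le)
  rw [hre] at h1 h2
  rw [norm_mul ((ρ : ℂ)), Complex.norm_real, Real.norm_of_nonneg hh.le] at h2
  rw [norm_mul, norm_mul, norm_div, norm_pow, norm_pow, Complex.norm_natCast, Complex.norm_exp,
    Complex.re_mul_ofReal]
  have e1 : Real.exp ((ρ : ℂ).re * (v + 2 * h)) =
      Real.exp ((ρ : ℂ).re * v) * Real.exp ((ρ : ℂ).re * h) ^ 2 := by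
    rw [← Real.exp_nat_mul, ← Real.exp_add]; congr 1; push_cast; ring
  unfold zeroWeight
  rw [e1]
  set N := ‖Complex.exp ((ρ : ℂ) * h) - 1‖
  set E := Real.exp ((ρ : ℂ).re * h)
  have hE : 0 < E := Real.exp_pos _
  have hN : 0 ≤ N := norm_nonneg _
  have key : N ^ 2 / ‖(ρ : ℂ)‖ ^ 3 ≤
      h ^ 2 * (E ^ 2 * min (1 / |(ρ : ℂ).im|) (4 / (h ^ 2 * |(ρ : ℂ).im| ^ 3))) := by
    have h3 : N ^ 2 / ‖(ρ : ℂ)‖ ^ 3 ≤ h ^ 2 * (E ^ 2 * (1 / |(ρ : ℂ).im|)) :=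
      calc N ^ 2 / ‖(ρ : ℂ)‖ ^ 3 ≤ (‖(ρ : ℂ)‖ * h * E) ^ 2 / ‖(ρ : ℂ)‖ ^ 3 := by gcongr
        _ = h ^ 2 * (E ^ 2 * (1 / ‖(ρ : ℂ)‖)) := by field_simp
        _ ≤ _ := by gcongr
    have h4 : N ^ 2 / ‖(ρ : ℂ)‖ ^ 3 ≤ h ^ 2 * (E ^ 2 * (4 / (h ^ 2 * |(ρ : ℂ).im| ^ 3))) :=
      calc N ^ 2 / ‖(ρ : ℂ)‖ ^ 3 ≤ (2 * E) ^ 2 / |(ρ : ℂ).im| ^ 3 := by gcongr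
        _ = _ := by field_simp; ring
    rcases min_choice (1 / |(ρ : ℂ).im|) (4 / (h ^ 2 * |(ρ : ℂ).im| ^ 3)) with e | e <;> rw [e]
    · exact h3
    · exact h4
  calc (xiOrder ρ : ℝ) / ‖(ρ : ℂ)‖ ^ 3 * (Real.exp ((ρ : ℂ).re * v) * N ^ 2)
      = xiOrder ρ * Real.exp ((ρ : ℂ).re * v) * (N ^ 2 / ‖(ρ : ℂ)‖ ^ 3) := by ring
    _ ≤ xiOrder ρ * Real.exp ((ρ : ℂ).re * v) *
      (h ^ 2 * (E ^ 2 * min (1 / |(ρ : ℂ).im|) (4 / (h ^ 2 * |(ρ : ℂ).im| ^ 3)))) := by gcongr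
    _ = _ := by ring

lemma zeroWeight_nonneg (h u : ℝ) (ρ : ℂ) : 0 ≤ zeroWeight h u ρ := by
  unfold zeroWeight
  positivity

lemma summable_zeroWeight {h : ℝ} (hh : 0 < h) (u : ℝ) :
    Summable fun ρ : XiZero => (xiOrder ρ : ℝ) * zeroWeight h u ρ := by
  refine (summable_xiOrder_div_im_sq.mul_right (Real.exp |u| * (4 / h ^ 2))).of_nonneg_of_le
    (fun ρ => mul_nonneg (by positivity) (zeroWeight_nonneg _ _ _)) fun ρ => ?_
  have hβ := xiOrder_re_mem ρ.2
  have hi := one_lt_abs_im_of_xiOrder ρ.2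
  have h1 : Real.exp ((ρ : ℂ).re * u) ≤ Real.exp |u| := by
    refine Real.exp_le_exp.2 ((le_abs_self _).trans ?_)
    rw [abs_mul, abs_of_pos hβ.1]
    exact mul_le_of_le_one_left (abs_nonneg _) hβ.2.le
  have h2 : zeroWeight h u ρ ≤ Real.exp |u| * (4 / (h ^ 2 * |(ρ : ℂ).im| ^ 2)) := by
    unfold zeroWeight
    gcongr
    refine (min_le_right _ _).trans ?_
    have : |(ρ : ℂ).im| ^ 2 ≤ |(ρ : ℂ).im| ^ 3 := pow_le_pow_right₀ hi.le (by norm_num)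
    gcongr
  calc (xiOrder ρ : ℝ) * zeroWeight h u ρ
      ≤ xiOrder ρ * (Real.exp |u| * (4 / (h ^ 2 * |(ρ : ℂ).im| ^ 2))) := by gcongr
    _ = _ := by rw [sq_abs]; field_simp

theorem abs_secondDiff_psiTwo_sub_le {h v : ℝ} (hh : 0 < h) (hv : 0 ≤ v) :
    |(secondDiff h psiTwo v).re - Real.exp v * (Real.exp h - 1) ^ 2| ≤
      20 * h ^ 2 + 1 + h ^ 2 * ∑' ρ : XiZero, (xiOrder ρ : ℝ) * zeroWeight h (v + 2 * h) ρ := by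
  have h1 := (secondDiff_tsum (h := h) (v := v)
    (fun w hw => summable_zeros_expRem (hv.trans hw)) hh.le).1
  have h2 := (secondDiff_tsum (h := h) (v := v)
    (fun w hw => summable_trivialZeros_expRem (hv.trans hw)) hh.le).1
  have e1 : ∀ (a c : ℂ), secondDiff h (fun w => c * expRem a w) v =
      c * (Complex.exp (a * v) * (Complex.exp (a * h) - 1) ^ 2) := fun a c => by
    rw [← secondDiff_expRem]
    simp only [secondDiff, Complex.real_smul]
    ring
  simp only [e1] at h1 h2
  have h3 : secondDiff h psiTwo v = secondDiff h (expRem 1) v + explicitConst * secondDiff h (posSq 0) v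
      - secondDiff h (fun w => ∑' ρ : XiZero, (xiOrder ρ / (ρ : ℂ) ^ 3) * expRem ρ w) v
      - secondDiff h (fun w => ∑' k : ℕ, (1 / trivialZero k ^ 3) * expRem (trivialZero k) w) v := by
    simp only [secondDiff, psiTwo, Complex.real_smul]
    rw [explicit_formula hv, explicit_formula (by linarith : 0 ≤ v + h),
      explicit_formula (by linarith : 0 ≤ v + 2 * h)]
    ring
  rw [h1, h2, secondDiff_expRem, secondDiff_posSq_of_le hh.le hv] at h3
  have e2 : Complex.exp (1 * v) * (Complex.exp (1 * h) - 1) ^ 2 =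
      ((Real.exp v * (Real.exp h - 1) ^ 2 : ℝ) : ℂ) := by push_cast; simp
  have h4 := norm_tsum_trivialZeros_le hh.le hv
  have h5 : ‖∑' ρ : XiZero, (xiOrder ρ / (ρ : ℂ) ^ 3) *
      (Complex.exp (ρ * v) * (Complex.exp (ρ * h) - 1) ^ 2)‖ ≤
      h ^ 2 * ∑' ρ : XiZero, (xiOrder ρ : ℝ) * zeroWeight h (v + 2 * h) ρ :=
    tsum_of_norm_bounded ((summable_zeroWeight hh _).hasSum.mul_left _) (norm_secondDiff_zero_le hh)
  have h6 := (Complex.abs_re_le_norm _).trans h4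
  have h7 := (Complex.abs_re_le_norm _).trans h5
  have h8 : |explicitConst.re * h ^ 2| ≤ 20 * h ^ 2 := by
    rw [abs_mul, abs_of_nonneg (sq_nonneg h)]
    exact mul_le_mul_of_nonneg_right abs_explicitConst_re_le (sq_nonneg h)
  rw [e2] at h3
  have h9 := congrArg Complex.re h3
  rw [Complex.sub_re, Complex.sub_re, Complex.add_re, Complex.ofReal_re, Complex.re_mul_ofReal] at h9
  rw [abs_le] at h6 h7 h8 ⊢
  constructor <;> linarith

end

lemma zero_density_abs {N X l : ℝ} (S : Finset ℂ)
    (hN : ∀ S' : Finset ℂ, (∀ ρ ∈ S', xiOrder ρ ≠ 0 ∧ 0 < ρ.im ∧ Real.log ρ.im - 9 / 5 ≤ l ∧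
      1 - X ≤ ρ.re) → ∑ ρ ∈ S', (xiOrder ρ : ℝ) ≤ N)
    (hS : ∀ ρ ∈ S, xiOrder ρ ≠ 0 ∧ Real.log |ρ.im| - 9 / 5 ≤ l ∧ 1 - X ≤ ρ.re) :
    ∑ ρ ∈ S, (xiOrder ρ : ℝ) ≤ 2 * N := by
  classical
  have h1 := hN (S.filter fun ρ => 0 < ρ.im) fun ρ hρ => by
    obtain ⟨hρ, hi⟩ := Finset.mem_filter.1 hρ
    obtain ⟨a, b, c⟩ := hS ρ hρ
    rw [abs_of_pos hi] at b
    exact ⟨a, hi, b, c⟩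
  have h2 := hN ((S.filter fun ρ => ¬ 0 < ρ.im).image (starRingEnd ℂ)) fun ρ hρ => by
    obtain ⟨z, hz, rfl⟩ := Finset.mem_image.1 hρ
    obtain ⟨hz, hi⟩ := Finset.mem_filter.1 hz
    obtain ⟨a, b, c⟩ := hS z hz
    have hi' : 0 < -z.im := by
      have h1 := one_lt_abs_im_of_xiOrder a
      rw [abs_of_nonpos (not_lt.1 hi)] at h1
      linarith
    rw [abs_of_nonpos (not_lt.1 hi)] at b
    rw [xiOrder_conj, Complex.conj_im, Complex.conj_re]
    exact ⟨a, hi', b, c⟩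
  rw [Finset.sum_image fun a _ b _ h => (starRingEnd ℂ).injective h] at h2
  simp only [xiOrder_conj] at h2
  rw [← Finset.sum_filter_add_sum_filter_not S fun ρ => 0 < ρ.im]
  linarith

/-- The region `1 - X / q ≤ re ρ`, `log |im ρ| - 9 / 5 ≤ Y q`. -/
def zeroBox (q X Y : ℝ) : Set ℂ :=
  {ρ | (1 - ρ.re) * q ≤ X ∧ Real.log |ρ.im| - 9 / 5 ≤ Y * q}

open Classical in
lemma tsum_zeroBox_le {q X Y N : ℝ} (a : ℝ) (hq : 5567 / 100 ≤ q) (ha : 0 < a) (ha5 : a ≤ 5)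
    (hX : 0 < X) (hXa : X ≤ 3 * a) (hY : 9 / 100 ≤ Y)
    (hα : 0 < a / (a + X) - a * (63 / 226 * Y + 117 / 100000))
    (hD : 1 / N ≤ (a / (a + X) - a * (63 / 226 * Y + 117 / 100000)) ^ 2 - a * (63 / 226) * Y)
    (hN : 0 < N) :
    Summable (fun ρ : XiZero => if (ρ : ℂ) ∈ zeroBox q X Y then (xiOrder ρ : ℝ) else 0) ∧
    ∑' ρ : XiZero, (if (ρ : ℂ) ∈ zeroBox q X Y then (xiOrder ρ : ℝ) else 0) ≤ 2 * N := by
  have hq0 : 0 < q := by linarith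
  have key : ∀ u : Finset XiZero,
      ∑ ρ ∈ u, (if (ρ : ℂ) ∈ zeroBox q X Y then (xiOrder ρ : ℝ) else 0) ≤ 2 * N := fun u => by
    rw [← Finset.sum_filter]
    have e : ∑ ρ ∈ u.filter fun ρ : XiZero => (ρ : ℂ) ∈ zeroBox q X Y, (xiOrder ρ : ℝ) =
        ∑ ρ ∈ (u.filter fun ρ : XiZero => (ρ : ℂ) ∈ zeroBox q X Y).map
          (Function.Embedding.subtype _), (xiOrder ρ : ℝ) :=
      (Finset.sum_map _ (Function.Embedding.subtype _) fun ρ : ℂ => (xiOrder ρ : ℝ)).symm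
    rw [e]
    refine zero_density_abs (X := X / q) (l := Y * q) _ (fun S' hS' => ?_)
      fun ρ hρ => ?_
    · have hα' : a / (a + X) - a * (63 / 226 * Y + 117 / 100000) ≤
          a / q * (1 / (a / q + X / q) - 13 / 200 - 63 / 226 * (Y * q)) := by
        have e1 : a / q * (1 / (a / q + X / q) - 13 / 200 - 63 / 226 * (Y * q)) =
            a / (a + X) - a * (63 / 226 * Y + 13 / 200 / q) := by
          field_simp
          ring
        have h2 : 13 / 200 / q ≤ 117 / 100000 := by
          rw [div_le_iff₀ hq0]
          linarith
        rw [e1]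
        gcongr
      have hD' : 1 / N ≤ (a / q * (1 / (a / q + X / q) - 13 / 200 - 63 / 226 * (Y * q))) ^ 2 -
          a / q * (63 / 226 * (Y * q)) := by
        have e1 : a / q * (63 / 226 * (Y * q)) = a * (63 / 226) * Y := by field_simp
        rw [e1]
        have := pow_le_pow_left₀ hα.le hα' 2
        linarith
      have hD0 := (one_div_pos.2 hN).trans_le hD'
      refine (zero_density (η := a / q) (by positivity) ?_ (by positivity) ?_ ?_ hS' rfl
        (hα.trans_le hα') hD0).trans ?_
      · rw [div_le_iff₀ hq0]; linarith
      · rw [← mul_div_assoc]; gcongr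
      · nlinarith
      · rw [div_le_iff₀ hD0]
        rwa [div_le_iff₀ hN, mul_comm] at hD'
    · obtain ⟨z, hz, rfl⟩ := Finset.mem_map.1 hρ
      obtain ⟨_, h1, h2⟩ := Finset.mem_filter.1 hz
      refine ⟨z.2, h2, ?_⟩
      have : 1 - (z : ℂ).re ≤ X / q := by rwa [le_div_iff₀ hq0]
      simp only [Function.Embedding.subtype_apply]
      linarith
  have h0 : ∀ ρ : XiZero, 0 ≤ (if (ρ : ℂ) ∈ zeroBox q X Y then (xiOrder ρ : ℝ) else 0) :=
    fun ρ => by split_ifs <;> positivity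
  have hs := summable_of_sum_le h0 key
  exact ⟨hs, hs.tsum_le_of_sum_le key⟩

lemma zero_coordinates (ρ : XiZero) {q : ℝ} (hq : 5567 / 100 ≤ q) {x y : ℝ}
    (hx : x = (1 - (ρ : ℂ).re) * q) (hy : y * q = Real.log |(ρ : ℂ).im| - 9 / 5) :
    0 < x ∧ -(33 / 1000) ≤ y ∧ (41 / 400 ≤ x * y ∨ 1139 / 1000 ≤ x) := by
  have hq0 : 0 < q := by linarith
  have hβ := xiOrder_re_mem ρ.2
  have hl := Real.log_pos (one_lt_abs_im_of_xiOrder ρ.2)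
  refine ⟨hx ▸ mul_pos (by linarith) hq0, ?_, ?_⟩
  · by_contra! h
    nlinarith
  · rcases le_total 5 (y * q) with h | h
    · left
      have := zero_free_region ρ.2 h hy.ge
      rw [hx]
      linarith
    · right
      have := zero_free_region ρ.2 le_rfl (hy.ge.trans h)
      rw [hx]
      nlinarith

lemma box_cover {x y : ℝ} (hx : 0 < x) (hy : -(33 / 1000) ≤ y)
    (h : 41 / 400 ≤ x * y ∨ 1139 / 1000 ≤ x) :
    (16 / 25 ≤ x + y ∧ x ≤ 1111 / 2000 ∧ y ≤ 1111 / 2000) ∨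
    (37 / 50 ≤ x + y ∧ (
      (x ≤ 1353 / 1000 ∧ y ≤ 355 / 1000) ∨ (x ≤ 965 / 1000 ∧ y ≤ 498 / 1000) ∨
      (x ≤ 822 / 1000 ∧ y ≤ 585 / 1000) ∨ (x ≤ 735 / 1000 ∧ y ≤ 654 / 1000) ∨
      (x ≤ 666 / 1000 ∧ y ≤ 722 / 1000) ∨ (x ≤ 598 / 1000 ∧ y ≤ 804 / 1000) ∨
      (x ≤ 516 / 1000 ∧ y ≤ 931 / 1000) ∨ (x ≤ 389 / 1000 ∧ y ≤ 12372 / 10000))) ∨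
    33 / 25 ≤ x + y := by
  by_cases h1 : 33 / 25 ≤ x + y
  · exact Or.inr (Or.inr h1)
  push Not at h1
  by_cases h2 : 37 / 50 ≤ x + y
  · refine Or.inr (Or.inl ⟨h2, ?_⟩)
    rcases le_total y (355 / 1000) with a1 | a1
    · left; constructor <;> linarith
    right
    rcases le_total y (498 / 1000) with a2 | a2
    · left; constructor <;> linarith
    right
    rcases le_total y (585 / 1000) with a3 | a3
    · left; constructor <;> linarith
    right
    rcases le_total y (654 / 1000) with a4 | a4
    · left; constructor <;> linarith
    right
    rcases le_total y (722 / 1000) with a5 | a5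
    · left; constructor <;> linarith
    right
    rcases le_total y (804 / 1000) with a6 | a6
    · left; constructor <;> linarith
    right
    rcases le_total y (931 / 1000) with a7 | a7
    · left; constructor <;> linarith
    right
    refine ⟨by linarith, ?_⟩
    rcases h with h | h
    · by_contra! h3
      nlinarith
    · linarith
  · push Not at h2
    left
    have h' : 41 / 400 ≤ x * y := h.resolve_right fun h => by linarith
    have hy0 : 0 < y := by
      by_contra! h0
      nlinarith
    refine ⟨?_, ?_, ?_⟩
    · nlinarith [sq_nonneg (x - y)]
    · by_contra! h3
      nlinarith
    · by_contra! h3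
      nlinarith

/-- The bound for `|im ρ|⁻¹ exp (-(1 - re ρ) q²)` in terms of the coordinates of `ρ`. -/
lemma exp_div_abs_im_le (ρ : XiZero) {q w x y : ℝ} (hq : 0 < q)
    (hx : x = (1 - (ρ : ℂ).re) * q) (hy : y * q = Real.log |(ρ : ℂ).im| - 9 / 5) (hw : w ≤ x + y) :
    Real.exp ((ρ : ℂ).re * q ^ 2) * (1 / |(ρ : ℂ).im|) ≤
      Real.exp (q ^ 2) * Real.exp (-(9 / 5) - w * q) := by
  have hi : 0 < |(ρ : ℂ).im| := zero_lt_one.trans (one_lt_abs_im_of_xiOrder ρ.2)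
  rw [one_div, ← Real.exp_log (inv_pos.2 hi), Real.log_inv, ← Real.exp_add, ← Real.exp_add]
  refine Real.exp_le_exp.2 ?_
  have : w * q ≤ (x + y) * q := by gcongr
  rw [add_mul, hy, hx] at this
  nlinarith

open Classical in
/-- The multiplicity of `ρ` if it lies in `zeroBox q X Y`, and `0` otherwise. -/
noncomputable def boxOrder (q X Y : ℝ) (ρ : XiZero) : ℝ :=
  if (ρ : ℂ) ∈ zeroBox q X Y then (xiOrder ρ : ℝ) else 0

lemma boxOrder_nonneg (q X Y : ℝ) (ρ : XiZero) : 0 ≤ boxOrder q X Y ρ := by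
  unfold boxOrder
  split_ifs <;> positivity

lemma boxOrder_of_le {q X Y x y : ℝ} (hq : 0 < q) {ρ : XiZero} (hx : x = (1 - (ρ : ℂ).re) * q)
    (hy : y * q = Real.log |(ρ : ℂ).im| - 9 / 5) (h : x ≤ X ∧ y ≤ Y) :
    boxOrder q X Y ρ = xiOrder ρ := by
  refine if_pos ⟨hx ▸ h.1, ?_⟩
  rw [← hy]
  exact mul_le_mul_of_nonneg_right h.2 hq.le

/-- The sum of the multiplicities over a covering of the zeros close to the line `re s = 1`. -/
noncomputable def coverOrder (q : ℝ) (ρ : XiZero) : ℝ :=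
  boxOrder q (1353 / 1000) (355 / 1000) ρ +
  boxOrder q (965 / 1000) (498 / 1000) ρ +
  boxOrder q (822 / 1000) (585 / 1000) ρ +
  boxOrder q (735 / 1000) (654 / 1000) ρ +
  boxOrder q (666 / 1000) (722 / 1000) ρ +
  boxOrder q (598 / 1000) (804 / 1000) ρ +
  boxOrder q (516 / 1000) (931 / 1000) ρ +
  boxOrder q (389 / 1000) (12372 / 10000) ρ

lemma hasSum_boxOrder {q X Y N : ℝ} (a : ℝ) (hq : 5567 / 100 ≤ q) (ha : 0 < a) (ha5 : a ≤ 5)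
    (hX : 0 < X) (hXa : X ≤ 3 * a) (hY : 9 / 100 ≤ Y)
    (hα : 0 < a / (a + X) - a * (63 / 226 * Y + 117 / 100000))
    (hD : 1 / N ≤ (a / (a + X) - a * (63 / 226 * Y + 117 / 100000)) ^ 2 - a * (63 / 226) * Y)
    (hN : 0 < N) : ∃ c ≤ 2 * N, HasSum (boxOrder q X Y) c := by
  obtain ⟨h1, h2⟩ := tsum_zeroBox_le a hq ha ha5 hX hXa hY hα hD hN
  exact ⟨_, h2, h1.hasSum⟩

lemma hasSum_coverOrder {q : ℝ} (hq : 5567 / 100 ≤ q) : ∃ c ≤ 2400, HasSum (coverOrder q) c := by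
  obtain ⟨c0, l0, s0⟩ := hasSum_boxOrder (X := 1353 / 1000) (Y := 355 / 1000) (N := 150) (94 / 100) hq
    (by norm_num) (by norm_num) (by norm_num) (by norm_num) (by norm_num) (by norm_num)
    (by norm_num) (by norm_num)
  obtain ⟨c1, l1, s1⟩ := hasSum_boxOrder (X := 965 / 1000) (Y := 498 / 1000) (N := 150) (67 / 100) hq
    (by norm_num) (by norm_num) (by norm_num) (by norm_num) (by norm_num) (by norm_num)
    (by norm_num) (by norm_num)
  obtain ⟨c2, l2, s2⟩ := hasSum_boxOrder (X := 822 / 1000) (Y := 585 / 1000) (N := 150) (57 / 100) hq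
    (by norm_num) (by norm_num) (by norm_num) (by norm_num) (by norm_num) (by norm_num)
    (by norm_num) (by norm_num)
  obtain ⟨c3, l3, s3⟩ := hasSum_boxOrder (X := 735 / 1000) (Y := 654 / 1000) (N := 150) (51 / 100) hq
    (by norm_num) (by norm_num) (by norm_num) (by norm_num) (by norm_num) (by norm_num)
    (by norm_num) (by norm_num)
  obtain ⟨c4, l4, s4⟩ := hasSum_boxOrder (X := 666 / 1000) (Y := 722 / 1000) (N := 150) (47 / 100) hq
    (by norm_num) (by norm_num) (by norm_num) (by norm_num) (by norm_num) (by norm_num)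
    (by norm_num) (by norm_num)
  obtain ⟨c5, l5, s5⟩ := hasSum_boxOrder (X := 598 / 1000) (Y := 804 / 1000) (N := 150) (42 / 100) hq
    (by norm_num) (by norm_num) (by norm_num) (by norm_num) (by norm_num) (by norm_num)
    (by norm_num) (by norm_num)
  obtain ⟨c6, l6, s6⟩ := hasSum_boxOrder (X := 516 / 1000) (Y := 931 / 1000) (N := 150) (36 / 100) hq
    (by norm_num) (by norm_num) (by norm_num) (by norm_num) (by norm_num) (by norm_num)
    (by norm_num) (by norm_num)
  obtain ⟨c7, l7, s7⟩ := hasSum_boxOrder (X := 389 / 1000) (Y := 12372 / 10000) (N := 150) (27 / 100) hq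
    (by norm_num) (by norm_num) (by norm_num) (by norm_num) (by norm_num) (by norm_num)
    (by norm_num) (by norm_num)
  refine ⟨_, ?_, ((((((s0.add s1).add s2).add s3).add s4).add s5).add s6).add s7⟩
  linarith

lemma zeroWeight_mul_le {h q : ℝ} (hh : 0 < h) (hq : 5567 / 100 ≤ q) (ρ : XiZero) :
    xiOrder ρ * zeroWeight h (q ^ 2) ρ ≤ Real.exp (q ^ 2) *
      (Real.exp (-(9 / 5) - 16 / 25 * q) * boxOrder q (1111 / 2000) (1111 / 2000) ρ +
        Real.exp (-(9 / 5) - 37 / 50 * q) * coverOrder q ρ +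
        Real.exp (-(9 / 5) - 33 / 25 * q) *
          (2 * (2 / h) ^ 2 * (xiOrder ρ * (1 / ((2 / h) ^ 2 + (ρ : ℂ).im ^ 2))))) := by
  have hq0 : 0 < q := by linarith
  obtain ⟨x, hx⟩ : ∃ x, x = (1 - (ρ : ℂ).re) * q := ⟨_, rfl⟩
  obtain ⟨y, hy⟩ : ∃ y, y * q = Real.log |(ρ : ℂ).im| - 9 / 5 :=
    ⟨(Real.log |(ρ : ℂ).im| - 9 / 5) / q, div_mul_cancel₀ _ hq0.ne'⟩
  have hi : 0 < |(ρ : ℂ).im| := zero_lt_one.trans (one_lt_abs_im_of_xiOrder ρ.2)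
  have hm : (0 : ℝ) ≤ xiOrder ρ := Nat.cast_nonneg _
  have hb := boxOrder_nonneg q (1111 / 2000) (1111 / 2000) ρ
  have hc : 0 ≤ coverOrder q ρ := by
    unfold coverOrder
    have hnn := fun X Y => boxOrder_nonneg q X Y ρ
    linarith [hnn (1353 / 1000) (355 / 1000), hnn (965 / 1000) (498 / 1000), hnn (822 / 1000) (585 / 1000),
      hnn (735 / 1000) (654 / 1000), hnn (666 / 1000) (722 / 1000), hnn (598 / 1000) (804 / 1000),
      hnn (516 / 1000) (931 / 1000), hnn (389 / 1000) (12372 / 10000)]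
  have hw : zeroWeight h (q ^ 2) ρ ≤ Real.exp ((ρ : ℂ).re * q ^ 2) * (1 / |(ρ : ℂ).im|) := by
    unfold zeroWeight
    gcongr
    exact min_le_left _ _
  have hT : 0 < 2 / h := by positivity
  have hg : 0 ≤ 2 * (2 / h) ^ 2 * (xiOrder ρ * (1 / ((2 / h) ^ 2 + (ρ : ℂ).im ^ 2))) := by positivity
  obtain ⟨hx0, hy0, hxy⟩ := zero_coordinates ρ hq hx hy
  rcases box_cover hx0 hy0 hxy with ⟨h1, h2⟩ | ⟨h1, h2⟩ | h1
  · rw [boxOrder_of_le hq0 hx hy h2]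
    have := hw.trans (exp_div_abs_im_le ρ hq0 hx hy h1)
    calc _ ≤ xiOrder ρ * (Real.exp (q ^ 2) * Real.exp (-(9 / 5) - 16 / 25 * q)) := by gcongr
      _ = Real.exp (q ^ 2) * (Real.exp (-(9 / 5) - 16 / 25 * q) * xiOrder ρ + 0 + 0) := by ring
      _ ≤ _ := by gcongr <;> positivity
  · have hcov : (xiOrder ρ : ℝ) ≤ coverOrder q ρ := by
      have hnn := fun X Y => boxOrder_nonneg q X Y ρ
      unfold coverOrder
      rcases h2 with h | h | h | h | h | h | h | h <;>
      · rw [← boxOrder_of_le hq0 hx hy h]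
        linarith [hnn (1353 / 1000) (355 / 1000), hnn (965 / 1000) (498 / 1000), hnn (822 / 1000) (585 / 1000),
          hnn (735 / 1000) (654 / 1000), hnn (666 / 1000) (722 / 1000), hnn (598 / 1000) (804 / 1000),
          hnn (516 / 1000) (931 / 1000), hnn (389 / 1000) (12372 / 10000)]
    have := hw.trans (exp_div_abs_im_le ρ hq0 hx hy h1)
    calc _ ≤ coverOrder q ρ * (Real.exp (q ^ 2) * Real.exp (-(9 / 5) - 37 / 50 * q)) :=
          mul_le_mul hcov this (zeroWeight_nonneg _ _ _) hc
      _ = Real.exp (q ^ 2) * (0 + Real.exp (-(9 / 5) - 37 / 50 * q) * coverOrder q ρ + 0) := by ring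
      _ ≤ _ := by gcongr <;> positivity
  · have h2 := exp_div_abs_im_le ρ hq0 hx hy h1
    have h3 : zeroWeight h (q ^ 2) ρ ≤ Real.exp ((ρ : ℂ).re * q ^ 2) * (1 / |(ρ : ℂ).im|) *
        (2 * (2 / h) ^ 2 * (1 / ((2 / h) ^ 2 + (ρ : ℂ).im ^ 2))) := by
      unfold zeroWeight
      rw [mul_assoc]
      gcongr
      rw [← sq_abs (ρ : ℂ).im]
      generalize |(ρ : ℂ).im| = g at *
      rw [show 4 / (h ^ 2 * g ^ 3) = 1 / g * ((2 / h) ^ 2 / g ^ 2) by field_simp; norm_num]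
      generalize 2 / h = T at *
      rcases le_total g T with hgT | hgT
      · refine (min_le_left _ _).trans (le_mul_of_one_le_right (by positivity) ?_)
        rw [mul_one_div, le_div_iff₀ (by positivity)]
        nlinarith
      · refine (min_le_right _ _).trans (mul_le_mul_of_nonneg_left ?_ (by positivity))
        rw [mul_one_div, div_le_div_iff₀ (by positivity) (by positivity)]
        have : T ^ 2 ≤ g ^ 2 := by gcongr
        nlinarith [mul_nonneg (sq_nonneg T) (sub_nonneg.2 this)]
    calc _ ≤ xiOrder ρ * (Real.exp (q ^ 2) * Real.exp (-(9 / 5) - 33 / 25 * q) *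
          (2 * (2 / h) ^ 2 * (1 / ((2 / h) ^ 2 + (ρ : ℂ).im ^ 2)))) := by
          refine mul_le_mul_of_nonneg_left (h3.trans ?_) hm
          gcongr
      _ = Real.exp (q ^ 2) * (0 + 0 + Real.exp (-(9 / 5) - 33 / 25 * q) *
          (2 * (2 / h) ^ 2 * (xiOrder ρ * (1 / ((2 / h) ^ 2 + (ρ : ℂ).im ^ 2))))) := by ring
      _ ≤ _ := by gcongr <;> positivity

theorem tsum_zeroWeight_le {h q : ℝ} (hh : 0 < h) (hT : 10 ≤ 2 / h) (hq : 5567 / 100 ≤ q) :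
    ∑' ρ : XiZero, (xiOrder ρ : ℝ) * zeroWeight h (q ^ 2) ρ ≤ Real.exp (q ^ 2) *
      (22 * Real.exp (-(9 / 5) - 16 / 25 * q) + 2400 * Real.exp (-(9 / 5) - 37 / 50 * q) +
        Real.exp (-(9 / 5) - 33 / 25 * q) * ((2 / h) ^ 2 * Real.log (2 / h) / (2 / h - 1))) := by
  obtain ⟨c0, l0, s0⟩ := hasSum_boxOrder (X := 1111 / 2000) (Y := 1111 / 2000) (N := 11) (3 / 4) hq
    (by norm_num) (by norm_num) (by norm_num) (by norm_num) (by norm_num) (by norm_num)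
    (by norm_num) (by norm_num)
  obtain ⟨c1, l1, s1⟩ := hasSum_coverOrder hq
  have hT1 : 1 < 2 / h := by linarith
  have s2 := (XiZero.summable (summable_xiOrder_div_sq_add_im_sq hT1)).hasSum
  have l2 := tsum_xiOrder_div_sq_add_im_sq_le hT
  rw [← XiZero.tsum_eq (fun ρ : ℂ => (xiOrder ρ : ℝ) * (1 / ((2 / h) ^ 2 + ρ.im ^ 2)))
    (by simp +contextual)] at l2
  have s3 := (((s0.mul_left (Real.exp (-(9 / 5) - 16 / 25 * q))).add
    (s1.mul_left (Real.exp (-(9 / 5) - 37 / 50 * q)))).add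
    ((s2.mul_left (2 * (2 / h) ^ 2)).mul_left (Real.exp (-(9 / 5) - 33 / 25 * q)))).mul_left
      (Real.exp (q ^ 2))
  refine (hasSum_le (zeroWeight_mul_le hh hq) (summable_zeroWeight hh (q ^ 2)).hasSum s3).trans ?_
  set T := 2 / h
  set S := ∑' ρ : XiZero, (xiOrder ρ : ℝ) * (1 / (T ^ 2 + (ρ : ℂ).im ^ 2))
  have h1 : Real.exp (-(9 / 5) - 16 / 25 * q) * c0 ≤ 22 * Real.exp (-(9 / 5) - 16 / 25 * q) := by
    rw [mul_comm]
    gcongr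
    linarith
  have h2 : Real.exp (-(9 / 5) - 37 / 50 * q) * c1 ≤ 2400 * Real.exp (-(9 / 5) - 37 / 50 * q) := by
    rw [mul_comm]
    gcongr
  have h3 : 2 * T ^ 2 * S ≤ T ^ 2 * Real.log T / (T - 1) :=
    calc _ ≤ 2 * T ^ 2 * (Real.log T / (2 * (T - 1))) := by gcongr
      _ = _ := by
        have : T - 1 ≠ 0 := by linarith
        field_simp
  gcongr

lemma pow_mul_exp_neg_le {q₀ q a : ℝ} {n : ℕ} (hq₀ : 0 < q₀) (hq : q₀ ≤ q) (hn : n ≤ a * q₀) :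
    q ^ n * Real.exp (-(9 / 5) - a * q) ≤ q₀ ^ n * Real.exp (-(9 / 5) - a * q₀) := by
  have h1 : (q / q₀) ^ n ≤ Real.exp (a * (q - q₀)) := by
    have h2 : q / q₀ ≤ Real.exp (q / q₀ - 1) := by linarith [Real.add_one_le_exp (q / q₀ - 1)]
    have h3 : 0 ≤ q / q₀ := div_nonneg (hq₀.le.trans hq) hq₀.le
    calc (q / q₀) ^ n ≤ Real.exp (q / q₀ - 1) ^ n := by gcongr
      _ = Real.exp (n * ((q - q₀) / q₀)) := by
        rw [← Real.exp_nat_mul, sub_div, div_self hq₀.ne']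
      _ ≤ Real.exp (a * q₀ * ((q - q₀) / q₀)) := by
        have : 0 ≤ (q - q₀) / q₀ := div_nonneg (by linarith) hq₀.le
        gcongr
      _ = _ := by congr 1; field_simp
  have e1 : Real.exp (-(9 / 5) - a * q₀) = Real.exp (a * (q - q₀)) * Real.exp (-(9 / 5) - a * q) := by
    rw [← Real.exp_add]; ring_nf
  rw [div_pow, div_le_iff₀ (by positivity)] at h1
  rw [e1, ← mul_assoc, mul_comm (q₀ ^ n)]
  gcongr

lemma exp_neg_le {n : ℕ} {t : ℝ} (ht : 0 ≤ t) :
    Real.exp (-(n + t)) ≤ ((2.7182818283 : ℝ) ^ n * (1 + t + t ^ 2 / 2))⁻¹ := by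
  rw [Real.exp_neg, Real.exp_add, ← mul_one (n : ℝ), Real.exp_nat_mul]
  have h1 := Real.quadratic_le_exp_of_nonneg ht
  have h2 := Real.exp_one_gt_d9.le
  gcongr

lemma log_le_mul {q : ℝ} (hq : 5567 / 100 ≤ q) :
    Real.log (3 / 200 * q ^ 10) ≤ 36 * (q / (5567 / 100)) := by
  set r := q / (5567 / 100) with hr
  have hr1 : 1 ≤ r := by rw [hr, le_div_iff₀ (by norm_num)]; linarith
  have e : 3 / 200 * q ^ 10 = (3 / 200 * (5567 / 100) ^ 10) * r ^ 10 := by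
    rw [hr]; field_simp
  have h1 : Real.log (3 / 200 * (5567 / 100) ^ 10) ≤ 36 := by
    have := log_le_of_pow_le (a := 3 / 200 * (5567 / 100) ^ 10) (by norm_num) 36 1 (by norm_num)
      (by norm_num)
    simpa using this
  have h2 := Real.log_le_sub_one_of_pos (zero_lt_one.trans_le hr1)
  rw [e, Real.log_mul (by norm_num) (by positivity), Real.log_pow]
  push_cast
  linarith

lemma tsum_zeroWeight_mul_le {q : ℝ} (hq : 5567 / 100 ≤ q) :
    (∑' ρ : XiZero, (xiOrder ρ : ℝ) * zeroWeight (400 / (3 * q ^ 10)) (q ^ 2) ρ) * q ^ 10 ≤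
      620 * Real.exp (q ^ 2) := by
  have hq0 : 0 < q := by linarith
  have hT : 2 / (400 / (3 * q ^ 10)) = 3 / 200 * q ^ 10 := by field_simp; norm_num
  have hQ : (5567 / 100 : ℝ) ^ 10 ≤ q ^ 10 := by gcongr
  have hQ' : (100000000000 : ℝ) ≤ q ^ 10 := le_trans (by norm_num) hQ
  have h := tsum_zeroWeight_le (h := 400 / (3 * q ^ 10)) (by positivity) (by rw [hT]; linarith) hq
  rw [hT] at h
  have a1 : 22 * (q ^ 10 * Real.exp (-(9 / 5) - 16 / 25 * q)) ≤ 356 := by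
    have h1 := pow_mul_exp_neg_le (n := 10) (a := 16 / 25) (by norm_num) hq (by norm_num)
    have h2 := exp_neg_le (n := 37) (t := 4288 / 10000) (by norm_num)
    rw [show -(((37 : ℕ) : ℝ) + 4288 / 10000) = -(9 / 5) - 16 / 25 * (5567 / 100) by norm_num] at h2
    have h3 := h1.trans (mul_le_mul_of_nonneg_left h2 (by positivity))
    have h4 := mul_le_mul_of_nonneg_left h3 (by norm_num : (0 : ℝ) ≤ 22)
    exact h4.trans (by norm_num)
  have a2 : 2400 * (q ^ 10 * Real.exp (-(9 / 5) - 37 / 50 * q)) ≤ 164 := by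
    have h1 := pow_mul_exp_neg_le (n := 10) (a := 37 / 50) (by norm_num) hq (by norm_num)
    have h2 := exp_neg_le (n := 42) (t := 9958 / 10000) (by norm_num)
    rw [show -(((42 : ℕ) : ℝ) + 9958 / 10000) = -(9 / 5) - 37 / 50 * (5567 / 100) by norm_num] at h2
    have h3 := h1.trans (mul_le_mul_of_nonneg_left h2 (by positivity))
    have h4 := mul_le_mul_of_nonneg_left h3 (by norm_num : (0 : ℝ) ≤ 2400)
    exact h4.trans (by norm_num)
  have a3 : 541 / 1000 / (5567 / 100) * (q ^ 21 * Real.exp (-(9 / 5) - 33 / 25 * q)) ≤ 100 := by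
    have h1 := pow_mul_exp_neg_le (n := 21) (a := 33 / 25) (by norm_num) hq (by norm_num)
    have h2 := exp_neg_le (n := 75) (t := 2844 / 10000) (by norm_num)
    rw [show -(((75 : ℕ) : ℝ) + 2844 / 10000) = -(9 / 5) - 33 / 25 * (5567 / 100) by norm_num] at h2
    have h3 := h1.trans (mul_le_mul_of_nonneg_left h2 (by positivity))
    have h4 := mul_le_mul_of_nonneg_left h3 (by norm_num : (0 : ℝ) ≤ 541 / 1000 / (5567 / 100))
    exact h4.trans (by norm_num)
  have a4 : (3 / 200 * q ^ 10) ^ 2 * Real.log (3 / 200 * q ^ 10) / (3 / 200 * q ^ 10 - 1) ≤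
      541 / 1000 / (5567 / 100) * q ^ 11 := by
    rw [div_le_iff₀ (by linarith)]
    calc _ ≤ (3 / 200 * q ^ 10) ^ 2 * (36 * (q / (5567 / 100))) := by
          gcongr
          exact log_le_mul hq
      _ = (q ^ 11 / (5567 / 100)) * (36 * (3 / 200) ^ 2 * q ^ 10) := by ring
      _ ≤ (q ^ 11 / (5567 / 100)) * (541 / 1000 * (3 / 200 * q ^ 10 - 1)) := by
          refine mul_le_mul_of_nonneg_left ?_ (by positivity)
          linarith
      _ = _ := by ring
  calc _ ≤ Real.exp (q ^ 2) * (22 * Real.exp (-(9 / 5) - 16 / 25 * q) +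
        2400 * Real.exp (-(9 / 5) - 37 / 50 * q) + Real.exp (-(9 / 5) - 33 / 25 * q) *
          (541 / 1000 / (5567 / 100) * q ^ 11)) * q ^ 10 := by
        gcongr
        exact h.trans (by gcongr)
    _ = Real.exp (q ^ 2) * (22 * (q ^ 10 * Real.exp (-(9 / 5) - 16 / 25 * q)) +
        2400 * (q ^ 10 * Real.exp (-(9 / 5) - 37 / 50 * q)) +
        541 / 1000 / (5567 / 100) * (q ^ 21 * Real.exp (-(9 / 5) - 33 / 25 * q))) := by ring
    _ ≤ Real.exp (q ^ 2) * 620 := by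
        gcongr
        linarith
    _ = _ := mul_comm _ _

lemma tsum_zeroWeight_add_le {h u δ : ℝ} (hh : 0 < h) (hδ : 0 ≤ δ) :
    ∑' ρ : XiZero, (xiOrder ρ : ℝ) * zeroWeight h (u + δ) ρ ≤
      Real.exp δ * ∑' ρ : XiZero, (xiOrder ρ : ℝ) * zeroWeight h u ρ := by
  refine hasSum_le (fun ρ => ?_) (summable_zeroWeight hh _).hasSum
    ((summable_zeroWeight hh u).hasSum.mul_left _)
  have hβ := xiOrder_re_mem ρ.2
  have h1 : Real.exp ((ρ : ℂ).re * (u + δ)) ≤ Real.exp δ * Real.exp ((ρ : ℂ).re * u) := by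
    rw [← Real.exp_add]
    refine Real.exp_le_exp.2 ?_
    nlinarith
  unfold zeroWeight
  calc _ ≤ (xiOrder ρ : ℝ) * (Real.exp δ * Real.exp ((ρ : ℂ).re * u) *
        min (1 / |(ρ : ℂ).im|) (4 / (h ^ 2 * |(ρ : ℂ).im| ^ 3))) := by gcongr
    _ = _ := by ring

theorem abs_psi_exp_sub_le {L : ℝ} (hL : 3100 ≤ L) :
    |Chebyshev.psi (Real.exp L) - Real.exp L| ≤ 900 * Real.exp L / L ^ 5 := by
  have hL0 : 0 < L := by linarith
  have hL5 : (3100 : ℝ) ^ 5 ≤ L ^ 5 := by gcongr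
  obtain ⟨h, hh⟩ : ∃ h, h = 400 / (3 * L ^ 5) := ⟨_, rfl⟩
  have hh0 : 0 < h := by rw [hh]; positivity
  have hhL : h * L ^ 5 = 400 / 3 := by rw [hh]; field_simp
  have hh1 : h ≤ 1 / 10000 := by
    rw [hh, div_le_div_iff₀ (by positivity) (by norm_num)]
    linarith
  set Z := ∑' ρ : XiZero, (xiOrder ρ : ℝ) * zeroWeight h L ρ with hZ
  have hZ0 : 0 ≤ Z := tsum_nonneg fun ρ => mul_nonneg (Nat.cast_nonneg _) (zeroWeight_nonneg _ _ _)
  have hZle : Z * L ^ 5 ≤ 620 * Real.exp L := by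
    have := tsum_zeroWeight_mul_le (q := √L) (Real.le_sqrt_of_sq_le (by linarith))
    have e1 : √L ^ 10 = L ^ 5 := by rw [show (10 : ℕ) = 2 * 5 by norm_num, pow_mul, Real.sq_sqrt hL0.le]
    rwa [e1, Real.sq_sqrt hL0.le, ← hh] at this
  have hC : (20 + 1 / h ^ 2) * L ^ 5 ≤ Real.exp L := by
    have h1 := Real.pow_div_factorial_le_exp L hL0.le 25
    refine le_trans ?_ h1
    have e1 : 1 / h ^ 2 = 9 / 160000 * L ^ 10 := by rw [hh]; field_simp; norm_num
    rw [e1]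
    have h2 : (3100 : ℝ) ^ 10 ≤ L ^ 10 := by gcongr
    have h3 : 20 + 9 / 160000 * L ^ 10 ≤ L ^ 10 := by linarith
    rw [le_div_iff₀ (by positivity)]
    calc (20 + 9 / 160000 * L ^ 10) * L ^ 5 * (Nat.factorial 25 : ℝ)
        ≤ L ^ 10 * L ^ 5 * L ^ 10 := by
          gcongr
          exact le_trans (by norm_num [Nat.factorial]) h2
      _ = _ := by ring
  have hexp : Real.exp h ≤ 1 + h + h ^ 2 := by
    have := Real.abs_exp_sub_one_sub_id_le (x := h) (by rw [abs_of_pos hh0]; linarith)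
    linarith [(abs_le.1 this).2]
  have hexp' : Real.exp (-h) ≤ 1 - h + h ^ 2 := by
    have := Real.abs_exp_sub_one_sub_id_le (x := -h) (by rw [abs_neg, abs_of_pos hh0]; linarith)
    have := (abs_le.1 this).2
    rw [neg_sq] at this
    linarith
  have hh2 : 0 < h ^ 2 := by positivity
  have hX := Real.exp_pos L
  have hup : Chebyshev.psi (Real.exp L) ≤
      Real.exp L * (1 + h) ^ 2 + (20 + 1 / h ^ 2) + 1001 / 1000 * Z := by
    have h1 := psi_exp_mul_sq_le hh0.le L
    have h2 := (abs_le.1 (abs_secondDiff_psiTwo_sub_le hh0 hL0.le)).2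
    have h3 := tsum_zeroWeight_add_le (u := L) hh0 (by positivity : 0 ≤ 2 * h)
    have h4 : Real.exp (2 * h) ≤ 1001 / 1000 := by
      have := Real.abs_exp_sub_one_sub_id_le (x := 2 * h) (by rw [abs_of_pos (by linarith)]; linarith)
      nlinarith [(abs_le.1 this).2]
    have h5 := h3.trans (mul_le_mul_of_nonneg_right h4 hZ0)
    have h6 : (Real.exp h - 1) ^ 2 ≤ h ^ 2 * (1 + h) ^ 2 := by
      rw [← mul_pow]
      exact pow_le_pow_left₀ (by linarith [Real.add_one_le_exp h]) (by linarith) 2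
    refine le_of_mul_le_mul_right ?_ hh2
    calc _ ≤ Real.exp L * (Real.exp h - 1) ^ 2 + (20 * h ^ 2 + 1 + h ^ 2 *
          ∑' ρ : XiZero, (xiOrder ρ : ℝ) * zeroWeight h (L + 2 * h) ρ) := by linarith
      _ ≤ Real.exp L * (h ^ 2 * (1 + h) ^ 2) + (20 * h ^ 2 + 1 + h ^ 2 * (1001 / 1000 * Z)) := by gcongr
      _ = _ := by field_simp; ring
  have hlo : Real.exp L * (1 - h) ^ 2 - (20 + 1 / h ^ 2) - Z ≤ Chebyshev.psi (Real.exp L) := by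
    have h1 := le_psi_exp_mul_sq hh0.le (L - 2 * h)
    have h2 := (abs_le.1 (abs_secondDiff_psiTwo_sub_le (v := L - 2 * h) hh0 (by linarith))).1
    rw [sub_add_cancel] at h1 h2
    have h6 : Real.exp L * (h ^ 2 * (1 - h) ^ 2) ≤
        Real.exp (L - 2 * h) * (Real.exp h - 1) ^ 2 := by
      have e1 : Real.exp (L - 2 * h) * (Real.exp h - 1) ^ 2 =
          Real.exp L * (1 - Real.exp (-h)) ^ 2 := by
        have e2 : Real.exp (L - 2 * h) = Real.exp L * Real.exp (-h) ^ 2 := by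
          rw [← Real.exp_nat_mul, ← Real.exp_add]; congr 1; push_cast; ring
        have e3 : Real.exp (-h) * Real.exp h = 1 := by rw [← Real.exp_add]; simp
        rw [e2, mul_assoc, ← mul_pow, mul_sub, e3, mul_one]
      rw [e1, ← mul_pow]
      refine mul_le_mul_of_nonneg_left (pow_le_pow_left₀ ?_ (by linarith) 2) hX.le
      exact mul_nonneg hh0.le (by linarith)
    refine le_of_mul_le_mul_right ?_ hh2
    calc _ = Real.exp L * (h ^ 2 * (1 - h) ^ 2) - (20 * h ^ 2 + 1 + h ^ 2 * Z) := by
          field_simp; ring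
      _ ≤ _ := by linarith
  have hL5' : 0 < L ^ 5 := by positivity
  have e1 : Real.exp L * h * L ^ 5 = 400 / 3 * Real.exp L := by rw [mul_assoc, hhL]; ring
  have e2 : Real.exp L * h ^ 2 * L ^ 5 ≤ Real.exp L := by
    calc _ = (Real.exp L * h * L ^ 5) * h := by ring
      _ ≤ (Real.exp L * h * L ^ 5) * (1 / 10000) := by gcongr
      _ ≤ _ := by rw [e1]; linarith
  have e3 : 0 ≤ Real.exp L * h ^ 2 * L ^ 5 := by positivity
  rw [abs_le, neg_le, neg_sub, le_div_iff₀ hL5', le_div_iff₀ hL5']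
  constructor
  · have := mul_le_mul_of_nonneg_right hlo hL5'.le
    nlinarith
  · have := mul_le_mul_of_nonneg_right hup hL5'.le
    nlinarith

lemma abs_theta_sub_le {t : ℝ} (ht : Real.exp 3100 ≤ t) :
    |Chebyshev.theta t - t| ≤ 901 * t / Real.log t ^ 5 := by
  have ht0 : 0 < t := (Real.exp_pos _).trans_le ht
  obtain ⟨L, rfl⟩ : ∃ L, Real.exp L = t := ⟨_, Real.exp_log ht0⟩
  have hL : 3100 ≤ L := Real.exp_le_exp.1 ht
  have hL0 : 0 < L := by linarith
  rw [Real.log_exp]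
  have h1 := abs_le.1 (abs_psi_exp_sub_le hL)
  have h2 := Chebyshev.theta_le_psi (Real.exp L)
  have h3 := Chebyshev.psi_sub_theta_le (Real.one_le_exp hL0.le)
  rw [Real.log_exp, ← Real.exp_half] at h3
  have h4 : 2 * Real.exp (L / 2) * L ≤ Real.exp L / L ^ 5 := by
    have h5 := Real.pow_div_factorial_le_exp (L / 2) (by positivity) 9
    have h6 : 2 * L ^ 6 ≤ Real.exp (L / 2) := by
      refine le_trans ?_ h5
      have h7 : (3100 : ℝ) ^ 3 ≤ L ^ 3 := by gcongr
      rw [le_div_iff₀ (by positivity)]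
      calc 2 * L ^ 6 * (Nat.factorial 9 : ℝ) = L ^ 6 * (2 * (Nat.factorial 9 : ℝ)) := by ring
        _ ≤ L ^ 6 * (L ^ 3 / 2 ^ 9) := by
          gcongr
          norm_num [Nat.factorial] at h7 ⊢
          linarith
        _ = _ := by ring
    rw [le_div_iff₀ (by positivity)]
    calc _ = Real.exp (L / 2) * (2 * L ^ 6) := by ring
      _ ≤ Real.exp (L / 2) * Real.exp (L / 2) := by gcongr
      _ = _ := by rw [← Real.exp_add, add_halves]
  have e : 901 * Real.exp L / L ^ 5 = 900 * Real.exp L / L ^ 5 + Real.exp L / L ^ 5 := by ring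
  rw [abs_le, e]
  constructor <;> linarith

/-- A truncation of the asymptotic expansion of `∫ 1 / log² t`, with last coefficient `c`. -/
noncomputable def logSqPrimitive (c t : ℝ) : ℝ :=
  t * (1 / Real.log t ^ 2 + 2 / Real.log t ^ 3 + 6 / Real.log t ^ 4 + 24 / Real.log t ^ 5 +
    c / Real.log t ^ 6)

lemma hasDerivAt_logSqPrimitive (c : ℝ) {t : ℝ} (ht : 1 < t) :
    HasDerivAt (logSqPrimitive c)
      (1 / Real.log t ^ 2 + (c - 120) / Real.log t ^ 6 - 6 * c / Real.log t ^ 7) t := by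
  have hl := Real.log_pos ht
  have ht0 : t ≠ 0 := by linarith
  have hk (a : ℝ) (n : ℕ) : HasDerivAt (fun t => a / Real.log t ^ (n + 1))
      (-(a * (n + 1)) / (t * Real.log t ^ (n + 2))) t := by
    have := ((Real.hasDerivAt_log ht0).pow (n + 1)).inv (pow_ne_zero _ hl.ne')
    have := this.const_mul a
    simp only [div_eq_mul_inv]
    refine this.congr_deriv ?_
    simp only [Pi.pow_apply]
    generalize Real.log t = l at hl
    push_cast
    field_simp
    ring
  have h := (hasDerivAt_id t).mul (((((hk 1 1).add (hk 2 2)).add (hk 6 3)).add (hk 24 4)).add (hk c 5))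
  have e : logSqPrimitive c = fun t => t * (1 / Real.log t ^ 2 + 2 / Real.log t ^ 3 +
    6 / Real.log t ^ 4 + 24 / Real.log t ^ 5 + c / Real.log t ^ 6) := rfl
  rw [e]
  refine h.congr_deriv ?_
  simp only [Pi.add_apply, id]
  generalize Real.log t = l at hl
  field_simp
  ring

lemma abs_theta_div_sub_le {t : ℝ} (ht : Real.exp 3100 ≤ t) :
    |Chebyshev.theta t / (t * Real.log t ^ 2) - 1 / Real.log t ^ 2| ≤
      (3 / 10) / Real.log t ^ 6 := by
  have ht0 : 0 < t := (Real.exp_pos _).trans_le ht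
  have hl : 3100 ≤ Real.log t := (Real.le_log_iff_exp_le ht0).2 ht
  have h := abs_theta_sub_le ht
  generalize Real.log t = l at *
  have hl0 : 0 < l := by linarith
  have e : Chebyshev.theta t / (t * l ^ 2) - 1 / l ^ 2 =
      (Chebyshev.theta t - t) / (t * l ^ 2) := by field_simp
  rw [e, abs_div, abs_of_pos (by positivity : 0 < t * l ^ 2), div_le_iff₀ (by positivity)]
  refine h.trans ?_
  have e2 : 3 / 10 / l ^ 6 * (t * l ^ 2) = (3 / 10 * l) * t / l ^ 5 := by field_simp
  rw [e2]
  gcongr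
  linarith

lemma intervalIntegrable_theta_div {a b : ℝ} (ha : 2 ≤ a) (hab : a ≤ b) :
    IntervalIntegrable (fun t => Chebyshev.theta t / (t * Real.log t ^ 2)) MeasureTheory.volume a b := by
  refine MeasureTheory.IntegrableOn.intervalIntegrable ?_
  rw [Set.uIcc_of_le hab]
  exact (Chebyshev.integrableOn_theta_div_id_mul_log_sq b).mono_set (Set.Icc_subset_Icc_left ha)

lemma intervalIntegrable_deriv_logSqPrimitive (c : ℝ) {a b : ℝ} (ha : 1 < a) (hab : a ≤ b) :
    IntervalIntegrable (fun t => 1 / Real.log t ^ 2 + (c - 120) / Real.log t ^ 6 -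
      6 * c / Real.log t ^ 7) MeasureTheory.volume a b := by
  refine ContinuousOn.intervalIntegrable fun t ht => ?_
  rw [Set.uIcc_of_le hab] at ht
  have hl := (Real.log_pos (ha.trans_le ht.1)).ne'
  have ht0 : t ≠ 0 := by linarith [ht.1]
  refine ContinuousAt.continuousWithinAt ?_
  fun_prop (disch := first | assumption | positivity)

lemma integral_deriv_logSqPrimitive (c : ℝ) {a b : ℝ} (ha : 1 < a) (hab : a ≤ b) :
    ∫ t in a..b, (1 / Real.log t ^ 2 + (c - 120) / Real.log t ^ 6 - 6 * c / Real.log t ^ 7) =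
      logSqPrimitive c b - logSqPrimitive c a := by
  refine intervalIntegral.integral_eq_sub_of_hasDerivAt (fun t ht => ?_)
    (intervalIntegrable_deriv_logSqPrimitive c ha hab)
  rw [Set.uIcc_of_le hab] at ht
  exact hasDerivAt_logSqPrimitive c (ha.trans_le ht.1)

lemma integral_theta_div_mem {x : ℝ} (hx : Real.exp 3100 ≤ x) :
    logSqPrimitive 119 x - logSqPrimitive 119 (Real.exp 3100) ≤
        ∫ t in (Real.exp 3100)..x, Chebyshev.theta t / (t * Real.log t ^ 2) ∧
      ∫ t in (Real.exp 3100)..x, Chebyshev.theta t / (t * Real.log t ^ 2) ≤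
        logSqPrimitive 122 x - logSqPrimitive 122 (Real.exp 3100) := by
  have hA : (2 : ℝ) ≤ Real.exp 3100 := by linarith [Real.add_one_le_exp 3100]
  have hA1 : (1 : ℝ) < Real.exp 3100 := by linarith
  have key {t : ℝ} (ht : t ∈ Set.Icc (Real.exp 3100) x) : 0 < Real.log t ∧
      1 / Real.log t ^ 7 ≤ 1 / 3100 * (1 / Real.log t ^ 6) := by
    have hl : 3100 ≤ Real.log t := (Real.le_log_iff_exp_le (by linarith [ht.1])).2 ht.1
    have hl0 : 0 < Real.log t := by linarith
    refine ⟨hl0, ?_⟩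
    rw [one_div_mul_one_div, pow_succ' _ 6]
    gcongr
  rw [← integral_deriv_logSqPrimitive 119 hA1 hx, ← integral_deriv_logSqPrimitive 122 hA1 hx]
  constructor
  · refine intervalIntegral.integral_mono_on hx (intervalIntegrable_deriv_logSqPrimitive _ hA1 hx)
      (intervalIntegrable_theta_div hA hx) fun t ht => ?_
    have h := (abs_le.1 (abs_theta_div_sub_le ht.1)).1
    obtain ⟨hl, h1⟩ := key ht
    have h2 : 0 < 1 / Real.log t ^ 7 := by positivity
    have h3 : 0 < 1 / Real.log t ^ 6 := by positivity
    rw [div_eq_mul_one_div (119 - 120 : ℝ), div_eq_mul_one_div (6 * 119 : ℝ)]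
    rw [div_eq_mul_one_div (3 / 10 : ℝ)] at h
    linarith
  · refine intervalIntegral.integral_mono_on hx (intervalIntegrable_theta_div hA hx)
      (intervalIntegrable_deriv_logSqPrimitive _ hA1 hx) fun t ht => ?_
    have h := (abs_le.1 (abs_theta_div_sub_le ht.1)).2
    obtain ⟨hl, h1⟩ := key ht
    have h3 : 0 < 1 / Real.log t ^ 6 := by positivity
    rw [div_eq_mul_one_div (122 - 120 : ℝ), div_eq_mul_one_div (6 * 122 : ℝ)]
    rw [div_eq_mul_one_div (3 / 10 : ℝ)] at h
    linarith

lemma integral_theta_div_two_mem {A : ℝ} (hA : 2 ≤ A) :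
    0 ≤ ∫ t in (2 : ℝ)..A, Chebyshev.theta t / (t * Real.log t ^ 2) ∧
      ∫ t in (2 : ℝ)..A, Chebyshev.theta t / (t * Real.log t ^ 2) ≤ 3 * A := by
  constructor
  · refine intervalIntegral.integral_nonneg hA fun t ht => ?_
    have := Chebyshev.theta_nonneg t
    have : 0 ≤ t := by linarith [ht.1]
    positivity
  · have h := intervalIntegral.integral_mono_on hA (intervalIntegrable_theta_div le_rfl hA)
      (intervalIntegrable_const (c := (3 : ℝ))) fun t ht => by
        have ht0 : 0 < t := by linarith [ht.1]
        have h1 := Chebyshev.theta_le_log4_mul_x ht0.le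
        have h2 : Real.log 2 ≤ Real.log t := Real.log_le_log (by norm_num) ht.1
        have h3 := Real.log_two_gt_d9
        rw [show (4 : ℝ) = 2 ^ 2 by norm_num, Real.log_pow] at h1
        push_cast at h1
        have h4 : Real.log 2 ^ 2 ≤ Real.log t ^ 2 := by gcongr
        rw [div_le_iff₀ (by have : 0 < Real.log t := by linarith
                            positivity)]
        refine h1.trans ?_
        have h5 : 2 * Real.log 2 ≤ 3 * Real.log t ^ 2 := by nlinarith
        nlinarith
    refine h.trans ?_
    rw [intervalIntegral.integral_const, smul_eq_mul]
    linarith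

lemma exp_mul_log_pow_le {x : ℝ} (hx : Real.exp 3157.442 ≤ x) :
    100 * (Real.exp 3100 * Real.log x ^ 6) ≤ x := by
  have hx0 : 0 < x := (Real.exp_pos _).trans_le hx
  obtain ⟨L, rfl⟩ : ∃ L, Real.exp L = x := ⟨_, Real.exp_log hx0⟩
  have hL : 3157.442 ≤ L := Real.exp_le_exp.1 hx
  have hL0 : 0 < L := by linarith
  rw [Real.log_exp]
  have h1 := pow_mul_exp_neg_le (n := 6) (a := 1) (q₀ := 3157.442) (by norm_num) hL (by norm_num)
  have e (y : ℝ) : Real.exp (-(9 / 5) - 1 * y) = Real.exp (-(9 / 5) - 3100) * Real.exp (3100 - y) := by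
    rw [← Real.exp_add]; ring_nf
  rw [e, e, mul_left_comm, mul_left_comm _ (Real.exp (-(9 / 5) - 3100))] at h1
  have h2 := le_of_mul_le_mul_left h1 (Real.exp_pos _)
  have h3 := exp_neg_le (n := 57) (t := 0.442) (by norm_num)
  rw [show -(((57 : ℕ) : ℝ) + 0.442) = 3100 - 3157.442 by norm_num] at h3
  have h4 := h2.trans (mul_le_mul_of_nonneg_left h3 (by positivity))
  have h5 : L ^ 6 * Real.exp (3100 - L) ≤ 1 / 100 := h4.trans (by norm_num)
  rw [Real.exp_sub, ← mul_div_assoc, div_le_iff₀ (Real.exp_pos _)] at h5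
  linarith

lemma logSqPrimitive_exp_mem {c : ℝ} (hc : 0 ≤ c) (hc' : c ≤ 1000) :
    0 ≤ logSqPrimitive c (Real.exp 3100) ∧
      logSqPrimitive c (Real.exp 3100) ≤ Real.exp 3100 := by
  unfold logSqPrimitive
  rw [Real.log_exp]
  refine ⟨by positivity, mul_le_of_le_one_right (Real.exp_pos _).le ?_⟩
  have : c / (3100 : ℝ) ^ 6 ≤ 1000 / (3100 : ℝ) ^ 6 := by gcongr
  norm_num at this ⊢
  linarith

/-- For every `x ≥ exp(3157.442)`, one has
`x·∑_{k=0}^{4} k!/log^{k+1} x + m_a·x/log⁶ x ≤ π(x) ≤ x·∑_{k=0}^{4} k!/log^{k+1} x + M_a·x/log⁶ x`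
with `m_a = −936.64603213534` and `M_a = 1177.56019022252`. -/
theorem pi_numeric_bounds (x : ℝ) (hx : x ≥ Real.exp 3157.442) :
    x * ∑ k ∈ Finset.range 5, (Nat.factorial k : ℝ) / (Real.log x) ^ (k + 1)
        + (-936.64603213534 : ℝ) * x / (Real.log x) ^ 6 ≤ primePi x ∧
      primePi x ≤ x * ∑ k ∈ Finset.range 5, (Nat.factorial k : ℝ) / (Real.log x) ^ (k + 1)
        + (1177.56019022252 : ℝ) * x / (Real.log x) ^ 6 := by
  have hA : (2 : ℝ) ≤ Real.exp 3100 := by linarith [Real.add_one_le_exp 3100]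
  have hAx : Real.exp 3100 ≤ x := le_trans (Real.exp_le_exp.2 (by norm_num)) hx
  have hx0 : 0 < x := by linarith
  have hl : 3100 ≤ Real.log x := (Real.le_log_iff_exp_le hx0).2 hAx
  have hl0 : 0 < Real.log x := by linarith
  have hpi : primePi x = Chebyshev.theta x / Real.log x +
      ((∫ t in (2 : ℝ)..Real.exp 3100, Chebyshev.theta t / (t * Real.log t ^ 2)) +
        ∫ t in (Real.exp 3100)..x, Chebyshev.theta t / (t * Real.log t ^ 2)) := by
    rw [intervalIntegral.integral_add_adjacent_intervals (intervalIntegrable_theta_div le_rfl hA)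
      (intervalIntegrable_theta_div hA hAx)]
    exact Chebyshev.primeCounting_eq_theta_div_log_add_integral (hA.trans hAx)
  obtain ⟨hI1, hI1'⟩ := integral_theta_div_two_mem hA
  obtain ⟨hI2, hI2'⟩ := integral_theta_div_mem hAx
  obtain ⟨-, hg⟩ := logSqPrimitive_exp_mem (c := 119) (by norm_num) (by norm_num)
  obtain ⟨hg', -⟩ := logSqPrimitive_exp_mem (c := 122) (by norm_num) (by norm_num)
  have hθ : |Chebyshev.theta x / Real.log x - x / Real.log x| ≤ 901 * (x / Real.log x ^ 6) := by
    rw [← sub_div, abs_div, abs_of_pos hl0, div_le_iff₀ hl0]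
    refine (abs_theta_sub_le hAx).trans_eq ?_
    field_simp
  obtain ⟨hθ, hθ'⟩ := abs_le.1 hθ
  have hsmall : Real.exp 3100 ≤ 1 / 100 * (x / Real.log x ^ 6) := by
    rw [← mul_div_assoc, le_div_iff₀ (by positivity)]
    linarith [exp_mul_log_pow_le hx]
  have hsum (c : ℝ) : x * ∑ k ∈ Finset.range 5, (Nat.factorial k : ℝ) / (Real.log x) ^ (k + 1) =
      x / Real.log x + logSqPrimitive c x - c * (x / Real.log x ^ 6) := by
    simp only [Finset.sum_range_succ, Finset.sum_range_zero, logSqPrimitive, Nat.factorial]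
    push_cast
    ring
  have hpos : 0 < x / Real.log x ^ 6 := by positivity
  rw [hpi, mul_div_assoc, mul_div_assoc]
  constructor
  · rw [hsum 119]
    linarith
  · rw [hsum 122]
    linarith
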